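/- Let λ > 1 and μ > 0. There exists ν₀ ≥ μϱ(λ) such that for every ν ≥ ν₀ the set Σ_{μ,ν,λ} is orbitally stable under the conservation laws, in the following sense: for every ε > 0 there exists δ > 0 such that whenever ζ₀ and ζ are nonnegative functions in L¹(Π) ∩ L²(Π) with x₂ζ₀, x₂ζ ∈ L¹(Π) satisfying E(ζ) = E(ζ₀), I(ζ) = I(ζ₀), ‖ζ‖_{L¹(Π)} = ‖ζ₀‖_{L¹(Π)}, ‖ζ‖_{L²(Π)} = ‖ζ₀‖_{L²(Π)}, and inf_{ω∈Σ_{μ,ν,λ}} { ‖ζ₀−ω‖_{L¹(Π)} + ‖ζ₀−ω‖_{L²(Π)} + ‖x₂(ζ₀−ω)‖_{L¹(Π)} } ≤ δ, then inf_{ω∈Σ_{μ,ν,λ}} { ‖ζ−ω‖_{L¹(Π)} + ‖ζ−ω‖_{L²(Π)} + ‖x₂(ζ−ω)‖_{L¹(Π)} } ≤ ε. -/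

import Mathlib

open MeasureTheory Real Filter

noncomputable section

/-- The upper half plane `Π = {x ∈ ℝ² : x₂ > 0}`. -/
def UHP : Set (ℝ × ℝ) := {x | 0 < x.2}

/-- Euclidean norm of a point of `ℝ²`. -/
def rad (x : ℝ × ℝ) : ℝ := Real.sqrt (x.1 ^ 2 + x.2 ^ 2)

/-- Modified Bessel function of the second kind of order `0`:
`K₀(r) = ∫₀^∞ exp(-r cosh t) dt`. -/
def K0 (r : ℝ) : ℝ := ∫ t in Set.Ioi (0 : ℝ), Real.exp (-(r * Real.cosh t))

/-- Fundamental solution `G(x,y) = (1/2π) K₀(|x-y|)` of `−Δ + Id` on `ℝ²`. -/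
def Gker (x y : ℝ × ℝ) : ℝ := (1 / (2 * Real.pi)) * K0 (rad (x - y))

/-- Reflection `x̄ = (x₁, −x₂)` across the `x₁`-axis. -/
def reflPt (x : ℝ × ℝ) : ℝ × ℝ := (x.1, -x.2)

/-- Green's function `G_Π(x,y) = G(x,y) − G(x̄,y)` of `−Δ + Id` on the half plane. -/
def GUHP (x y : ℝ × ℝ) : ℝ := Gker x y - Gker (reflPt x) y

/-- The operator `𝒢ω(x) = ∫_Π G_Π(x,y) ω(y) dy`. -/
def Gop (ω : ℝ × ℝ → ℝ) (x : ℝ × ℝ) : ℝ := ∫ y in UHP, GUHP x y * ω y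

/-- Kinetic energy `E(ω) = (1/2) ∫_Π ω 𝒢ω`. -/
def kineticE (ω : ℝ × ℝ → ℝ) : ℝ := (1 / 2) * ∫ x in UHP, ω x * Gop ω x

/-- Impulse `I(ω) = ∫_Π x₂ ω dx`. -/
def impulse (ω : ℝ × ℝ → ℝ) : ℝ := ∫ x in UHP, x.2 * ω x

/-- `L¹(Π)` norm. -/
def normL1 (f : ℝ × ℝ → ℝ) : ℝ := ∫ x in UHP, |f x|

/-- `L²(Π)` norm. -/
def normL2 (f : ℝ × ℝ → ℝ) : ℝ := (∫ x in UHP, (f x) ^ 2) ^ ((1 : ℝ) / 2)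

/-- `L^s(Π)` norm. -/
def normLs (s : ℝ) (f : ℝ × ℝ → ℝ) : ℝ := (∫ x in UHP, |f x| ^ s) ^ (1 / s)

/-- Nonnegative member of `L¹(Π) ∩ L²(Π)`. -/
def NonnegL1L2 (ω : ℝ × ℝ → ℝ) : Prop :=
  (∀ x ∈ UHP, 0 ≤ ω x) ∧ IntegrableOn ω UHP ∧ IntegrableOn (fun x => (ω x) ^ 2) UHP

/-- Steiner symmetry in the `x₁` variable. -/
def SteinerSym (f : ℝ × ℝ → ℝ) : Prop :=
  (∀ x : ℝ × ℝ, f (-x.1, x.2) = f x) ∧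
  ∀ x₂ : ℝ, 0 < x₂ → AntitoneOn (fun x₁ => f (x₁, x₂)) (Set.Ioi (0 : ℝ))

/-- The admissible class `𝒜_{μ,ν}`. -/
def InAdm (μ ν : ℝ) (ω : ℝ × ℝ → ℝ) : Prop :=
  (∀ x ∈ UHP, 0 ≤ ω x) ∧ IntegrableOn ω UHP ∧ IntegrableOn (fun x => (ω x) ^ 2) UHP ∧
  IntegrableOn (fun x => x.2 * ω x) UHP ∧
  impulse ω = μ ∧ (∫ x in UHP, ω x) ≤ ν

/-- The energy functional `ℰ_λ(ω) = E(ω) − (1/(2λ)) ∫_Π ω²`. -/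
def Efun (lam : ℝ) (ω : ℝ × ℝ → ℝ) : ℝ :=
  kineticE ω - (1 / (2 * lam)) * ∫ x in UHP, (ω x) ^ 2

/-- The supremum `S_{μ,ν,λ} = sup_{ω ∈ 𝒜_{μ,ν}} ℰ_λ(ω)`. -/
def Sval (lam μ ν : ℝ) : ℝ := sSup {s | ∃ ω, InAdm μ ν ω ∧ s = Efun lam ω}

/-- `ω` is a maximizer, i.e. `ω ∈ Σ_{μ,ν,λ}`. -/
def IsMaximizer (lam μ ν : ℝ) (ω : ℝ × ℝ → ℝ) : Prop :=
  InAdm μ ν ω ∧ Efun lam ω = Sval lam μ ν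

/-- Bessel function of the first kind of order one. -/
def J1 (r : ℝ) : ℝ :=
  ∑' k : ℕ, ((-1 : ℝ) ^ k / ((Nat.factorial k : ℝ) * (Nat.factorial (k + 1) : ℝ))) *
    (r / 2) ^ (2 * k + 1)

/-- Modified Bessel function of the second kind of order one. -/
def K1 (r : ℝ) : ℝ := ∫ t in Set.Ioi (0 : ℝ), Real.exp (-(r * Real.cosh t)) * Real.cosh t

/-- The set of `t > 0` with `J₁(√(λ−1) t) ≠ 0` solving the transcendental equation
`t (K₁'(t)/K₁(t) + (λ−1)^{-1/2} J₁'(√(λ−1)t)/J₁(√(λ−1)t)) = λ/(λ−1)`. -/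
def aSet (lam : ℝ) : Set ℝ :=
  {t | 0 < t ∧ J1 (Real.sqrt (lam - 1) * t) ≠ 0 ∧
    t * (deriv K1 t / K1 t +
      (1 / Real.sqrt (lam - 1)) *
        (deriv J1 (Real.sqrt (lam - 1) * t) / J1 (Real.sqrt (lam - 1) * t))) = lam / (lam - 1)}

/-- The smallest positive solution `a = a(λ)`. -/
def aLam (lam : ℝ) : ℝ := sInf (aSet lam)

/-- The stream function `Ψ_L^{λ,W}` of the Lamb dipole, written in polar coordinates
`x₁ = r cos θ`, `x₂ = r sin θ` (so that `sin θ = x₂ / r`). -/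
def PsiL (lam W : ℝ) (x : ℝ × ℝ) : ℝ :=
  if rad x ≤ aLam lam then
    ((-(W * aLam lam / (lam - 1)) / J1 (Real.sqrt (lam - 1) * aLam lam)) *
        J1 (Real.sqrt (lam - 1) * rad x) + (W * lam / (lam - 1)) * rad x) * (x.2 / rad x)
  else (W * aLam lam / K1 (aLam lam)) * K1 (rad x) * (x.2 / rad x)

/-- The Lamb dipole `ω_L^{λ,W} = λ (Ψ_L^{λ,W} − W x₂)₊` restricted to `Π`. -/
def omegaL (lam W : ℝ) (x : ℝ × ℝ) : ℝ :=
  if 0 < x.2 then lam * max (PsiL lam W x - W * x.2) 0 else 0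

/-- `ϱ(λ) = (∫_Π ω_L^{λ,1} dx) / I(ω_L^{λ,1})`. -/
def varrho (lam : ℝ) : ℝ := (∫ x in UHP, omegaL lam 1 x) / impulse (omegaL lam 1)

/-- The Laplacian on `ℝ²`, written coordinatewise. -/
def lap (ψ : ℝ × ℝ → ℝ) (x : ℝ × ℝ) : ℝ :=
  deriv (deriv fun t => ψ (t, x.2)) x.1 + deriv (deriv fun t => ψ (x.1, t)) x.2

/-- Distance (in `L¹ ∩ L²` plus weighted `L¹`) from `ζ` to a set of functions `S`. -/
def distToSet (S : Set ((ℝ × ℝ) → ℝ)) (ζ : (ℝ × ℝ) → ℝ) : ℝ :=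
  sInf {d | ∃ ω ∈ S, d = normL1 (fun x => ζ x - ω x) + normL2 (fun x => ζ x - ω x) +
    normL1 (fun x => x.2 * (ζ x - ω x))}

end

section
abbrev V4 := EuclideanSpace ℝ (Fin 4)

noncomputable def pt (t : ℝ) (X : V4) : ℝ := ((4 * π * t) ^ 2)⁻¹ * Real.exp (-‖X‖ ^ 2 / (4 * t))

noncomputable def kk (X : V4) : ℝ := ∫ t in Set.Ioi (0 : ℝ), Real.exp (-t) * pt t X

theorem pt_nonneg (t : ℝ) (X : V4) : 0 ≤ pt t X := by unfold pt; positivity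

theorem pt_pos {t : ℝ} (ht : 0 < t) (X : V4) : 0 < pt t X := by
  unfold pt; have := Real.pi_pos; positivity

theorem pt_continuous (t : ℝ) : Continuous (pt t) := by
  unfold pt; fun_prop

theorem pt_measurable2 : Measurable (fun p : ℝ × V4 => pt p.1 p.2) := by
  unfold pt; fun_prop

theorem pt_neg (t : ℝ) (X : V4) : pt t (-X) = pt t X := by simp [pt]

theorem pt_le (t : ℝ) (ht : 0 < t) (X : V4) : pt t X ≤ ((4 * π * t) ^ 2)⁻¹ := by
  unfold pt
  have : Real.exp (-‖X‖ ^ 2 / (4 * t)) ≤ 1 := by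
    apply Real.exp_le_one_iff.2
    apply div_nonpos_of_nonpos_of_nonneg <;> [skip; positivity]
    nlinarith [sq_nonneg ‖X‖]
  calc _ ≤ ((4 * π * t) ^ 2)⁻¹ * 1 := by gcongr
    _ = _ := by ring

theorem pt_integral {t : ℝ} (ht : 0 < t) : ∫ X, pt t X = 1 := by
  unfold pt
  rw [integral_const_mul]
  have h := GaussianFourier.integral_rexp_neg_mul_sq_norm (V := V4) (b := 1 / (4 * t)) (by positivity)
  have e : (fun X : V4 => Real.exp (-‖X‖ ^ 2 / (4 * t))) = fun v => Real.exp (-(1 / (4 * t)) * ‖v‖ ^ 2) := by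
    ext v; congr 1; field_simp
  rw [e, h]
  simp only [finrank_euclideanSpace, Fintype.card_fin]
  have : (((4 : ℕ) : ℝ) / 2) = ((2 : ℕ) : ℝ) := by norm_num
  rw [this, Real.rpow_natCast]
  have := Real.pi_pos
  field_simp

theorem pt_integrable {t : ℝ} (ht : 0 < t) : Integrable (pt t) := by
  by_contra h
  have := pt_integral ht
  rw [integral_undef h] at this
  norm_num at this

theorem pt_conv {s t : ℝ} (hs : 0 < s) (ht : 0 < t) (X : V4) :
    ∫ Y, pt s (X - Y) * pt t Y = pt (s + t) X := by
  have h := GaussianFourier.integral_cexp_neg_mul_sq_norm_add (V := V4)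
    (b := ((1 / (4 * s) + 1 / (4 * t) : ℝ) : ℂ)) (by rw [Complex.ofReal_re]; positivity)
    ((1 / (2 * s) : ℝ) : ℂ) X
  have e : ∀ v : V4, Complex.exp (-((1 / (4 * s) + 1 / (4 * t) : ℝ) : ℂ) * ‖v‖ ^ 2 +
      ((1 / (2 * s) : ℝ) : ℂ) * (inner ℝ X v : ℝ)) =
      ((Real.exp (-(1 / (4 * s) + 1 / (4 * t)) * ‖v‖ ^ 2 + (1 / (2 * s)) * inner ℝ X v) : ℝ) : ℂ) := by
    intro v; push_cast; rfl
  simp_rw [e] at h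
  rw [integral_complex_ofReal] at h
  simp only [finrank_euclideanSpace, Fintype.card_fin] at h
  have e2 : (((4 : ℕ) : ℂ) / 2) = ((2 : ℕ) : ℂ) := by norm_num
  rw [e2, Complex.cpow_natCast] at h
  have h' : ∫ v : V4, Real.exp (-(1 / (4 * s) + 1 / (4 * t)) * ‖v‖ ^ 2 + (1 / (2 * s)) * inner ℝ X v)
      = (π / (1 / (4 * s) + 1 / (4 * t))) ^ 2 *
        Real.exp ((1 / (2 * s)) ^ 2 * ‖X‖ ^ 2 / (4 * (1 / (4 * s) + 1 / (4 * t)))) := by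
    have := h
    norm_cast at this
  have e3 : ∀ Y, pt s (X - Y) * pt t Y = (((4 * π * s) ^ 2)⁻¹ * ((4 * π * t) ^ 2)⁻¹ *
      Real.exp (-‖X‖ ^ 2 / (4 * s))) *
      Real.exp (-(1 / (4 * s) + 1 / (4 * t)) * ‖Y‖ ^ 2 + (1 / (2 * s)) * inner ℝ X Y) := by
    intro Y
    unfold pt
    have : ‖X - Y‖ ^ 2 = ‖X‖ ^ 2 - 2 * inner ℝ X Y + ‖Y‖ ^ 2 := norm_sub_sq_real X Y
    rw [this]
    rw [show ∀ a b c d : ℝ, a * b * (c * d) = a * c * (b * d) by intros; ring, ← Real.exp_add,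
      mul_assoc _ (Real.exp _) (Real.exp _), ← Real.exp_add]
    congr 2
    field_simp
    ring
  simp_rw [e3]
  rw [integral_const_mul, h']
  unfold pt
  rw [show ∀ a b c d f : ℝ, a * b * c * (d * f) = a * b * d * (c * f) by intros; ring, ← Real.exp_add]
  have := Real.pi_pos
  have hst : 0 < s + t := by positivity
  congr 1
  · field_simp
    ring_nf
    try field_simp
    try ring
  · congr 1
    field_simp
    ring

theorem pt_anti {t : ℝ} (ht : 0 < t) {X Y : V4} (h : ‖X‖ < ‖Y‖) : pt t Y < pt t X := by
  unfold pt
  have := Real.pi_pos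
  gcongr

theorem pt_le2 {t : ℝ} (ht : 0 < t) {X : V4} (h : X ≠ 0) : pt t X ≤ 2 / ‖X‖ ^ 4 := by
  have hX : 0 < ‖X‖ := norm_pos_iff.2 h
  unfold pt
  set x := ‖X‖ ^ 2 / (4 * t) with hx
  have hx0 : 0 < x := by positivity
  have h1 : x ^ 2 / 2 ≤ Real.exp x := by
    have := Real.quadratic_le_exp_of_nonneg hx0.le; linarith
  have h2 : Real.exp (-‖X‖ ^ 2 / (4 * t)) = (Real.exp x)⁻¹ := by
    rw [← Real.exp_neg, hx]; congr 1; ring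
  rw [h2]
  have h3 : (Real.exp x)⁻¹ ≤ (x ^ 2 / 2)⁻¹ := by gcongr
  have hpi : 1 ≤ π := by linarith [Real.pi_gt_three]
  calc _ ≤ ((4 * 1 * t) ^ 2)⁻¹ * (x ^ 2 / 2)⁻¹ := by gcongr
    _ = 2 / ‖X‖ ^ 4 := by rw [hx]; field_simp; try norm_num

theorem pt_le4 {t : ℝ} (ht : 0 < t) {X : V4} {d : ℝ} (hd : 0 < d) (h : d ≤ ‖X‖) :
    pt t X ≤ (4 ^ 2 * 24 / d ^ 8) * t ^ 2 := by
  have hX : 0 < ‖X‖ := lt_of_lt_of_le hd h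
  unfold pt
  set x := d ^ 2 / (4 * t) with hx
  have hx0 : 0 < x := by positivity
  have h1 : x ^ 4 / 24 ≤ Real.exp x := by
    have := Real.pow_div_factorial_le_exp x hx0.le 4
    simpa [Nat.factorial] using this
  have h2 : Real.exp (-‖X‖ ^ 2 / (4 * t)) ≤ (Real.exp x)⁻¹ := by
    rw [← Real.exp_neg, hx, neg_div]; gcongr
  have h3 : (Real.exp x)⁻¹ ≤ (x ^ 4 / 24)⁻¹ := by gcongr
  have hpi : 1 ≤ π := by linarith [Real.pi_gt_three]
  calc _ ≤ ((4 * 1 * t) ^ 2)⁻¹ * (x ^ 4 / 24)⁻¹ := by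
        gcongr
        exact h2.trans h3
    _ = _ := by rw [hx]; field_simp; try norm_num

theorem expneg_int : IntegrableOn (fun t : ℝ => Real.exp (-t)) (Set.Ioi 0) := by
  simpa using integrableOn_exp_neg_Ioi 0

theorem expneg_integral : ∫ t in Set.Ioi (0 : ℝ), Real.exp (-t) = 1 := by
  simpa using integral_exp_neg_Ioi 0

theorem pt_meas_t (X : V4) : Measurable (fun t => pt t X) :=
  pt_measurable2.comp (measurable_id.prodMk measurable_const)

theorem kk_intOn {X : V4} (h : X ≠ 0) :
    IntegrableOn (fun t => Real.exp (-t) * pt t X) (Set.Ioi 0) := by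
  have := (expneg_int.mul_const (2 / ‖X‖ ^ 4))
  refine this.mono' ?_ ?_
  · exact ((by fun_prop : Measurable fun t : ℝ => Real.exp (-t)).mul (pt_meas_t X)).aestronglyMeasurable
  · filter_upwards [self_mem_ae_restrict measurableSet_Ioi] with t ht
    rw [Real.norm_of_nonneg (mul_nonneg (Real.exp_pos _).le (pt_nonneg _ _))]
    gcongr
    exact pt_le2 ht h

theorem kk_nonneg (X : V4) : 0 ≤ kk X :=
  setIntegral_nonneg measurableSet_Ioi fun _ _ => mul_nonneg (Real.exp_pos _).le (pt_nonneg _ _)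

theorem kk_le {X : V4} (h : X ≠ 0) : kk X ≤ 2 / ‖X‖ ^ 4 := by
  unfold kk
  calc _ ≤ ∫ t in Set.Ioi (0 : ℝ), Real.exp (-t) * (2 / ‖X‖ ^ 4) := by
        refine setIntegral_mono_on (kk_intOn h) (expneg_int.mul_const _) measurableSet_Ioi ?_
        intro t ht
        gcongr
        exact pt_le2 ht h
    _ = _ := by rw [integral_mul_const, expneg_integral, one_mul]

theorem kk_anti {X Y : V4} (hX : X ≠ 0) (h : ‖X‖ < ‖Y‖) : kk Y < kk X := by
  have hY : Y ≠ 0 := by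
    intro h0; rw [h0, norm_zero] at h; exact absurd h (not_lt.2 (norm_nonneg _))
  unfold kk
  rw [← sub_pos, ← integral_sub (kk_intOn hX) (kk_intOn hY)]
  have hpos : ∀ t ∈ Set.Ioi (0:ℝ), 0 < Real.exp (-t) * pt t X - Real.exp (-t) * pt t Y := by
    intro t ht
    rw [← mul_sub]
    exact mul_pos (Real.exp_pos _) (sub_pos.2 (pt_anti ht h))
  rw [setIntegral_pos_iff_support_of_nonneg_ae]
  · have : Set.Ioi (0:ℝ) ⊆ Function.support (fun t => Real.exp (-t) * pt t X - Real.exp (-t) * pt t Y) :=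
      fun t ht => (hpos t ht).ne'
    rw [Set.inter_eq_right.2 this]
    simp
  · filter_upwards [self_mem_ae_restrict measurableSet_Ioi] with t ht using (hpos t ht).le
  · exact (kk_intOn hX).sub (kk_intOn hY)

theorem kk_norm {X Y : V4} (h : ‖X‖ = ‖Y‖) : kk X = kk Y := by
  unfold kk pt; rw [h]

theorem kk_neg (X : V4) : kk (-X) = kk X := kk_norm (norm_neg X)

theorem kk_sub_comm (X Y : V4) : kk (X - Y) = kk (Y - X) := kk_norm (norm_sub_rev X Y)

theorem kkprod_meas : Measurable (fun p : V4 × ℝ => Real.exp (-p.2) * pt p.2 p.1) :=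
  (by fun_prop : Measurable fun p : V4 × ℝ => Real.exp (-p.2)).mul
    (pt_measurable2.comp measurable_swap)

theorem kk_meas : Measurable kk := by
  have : StronglyMeasurable (fun X : V4 => ∫ t in Set.Ioi (0 : ℝ), Real.exp (-t) * pt t X) :=
    (kkprod_meas.stronglyMeasurable).integral_prod_right'
  exact this.measurable

theorem kkprod_int : Integrable (fun p : V4 × ℝ => Real.exp (-p.2) * pt p.2 p.1)
    (volume.prod (volume.restrict (Set.Ioi 0))) := by
  rw [integrable_prod_iff' kkprod_meas.aestronglyMeasurable]
  constructor
  · filter_upwards [self_mem_ae_restrict measurableSet_Ioi] with t ht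
    exact (pt_integrable ht).const_mul _
  · refine expneg_int.congr ?_
    filter_upwards [self_mem_ae_restrict measurableSet_Ioi] with t ht
    have : ∀ X, ‖Real.exp (-t) * pt t X‖ = Real.exp (-t) * pt t X := fun X =>
      Real.norm_of_nonneg (mul_nonneg (Real.exp_pos _).le (pt_nonneg _ _))
    simp_rw [this]
    rw [integral_const_mul, pt_integral ht, mul_one]

theorem kk_integrable : Integrable kk := kkprod_int.integral_prod_left

theorem kk_integral : ∫ X, kk X = 1 := by
  unfold kk
  rw [integral_integral_swap kkprod_int, ← expneg_integral]
  refine setIntegral_congr_fun measurableSet_Ioi fun t ht => ?_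
  rw [integral_const_mul, pt_integral ht, mul_one]

end

section
noncomputable def BB (κ f g : V4 → ℝ) : ℝ := ∫ p : V4 × V4, f p.1 * g p.2 * κ (p.1 - p.2)

noncomputable def qq (f : V4 → ℝ) : ℝ := ∫ X, f X ^ 2

noncomputable def nn (f : V4 → ℝ) : ℝ := Real.sqrt (qq f)

theorem qq_nonneg (f : V4 → ℝ) : 0 ≤ qq f := integral_nonneg fun _ => sq_nonneg _

theorem nn_nonneg (f : V4 → ℝ) : 0 ≤ nn f := Real.sqrt_nonneg _

theorem nn_sq (f : V4 → ℝ) : nn f ^ 2 = qq f := Real.sq_sqrt (qq_nonneg f)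

theorem amgm_aux {A B b : ℝ} (hA : 0 ≤ A) (hB : 0 ≤ B)
    (h : ∀ s : ℝ, 0 < s → b ≤ (s * A + B / s) / 2) : b ≤ Real.sqrt A * Real.sqrt B := by
  rcases hA.eq_or_lt with rfl | hA
  · simp only [mul_zero, zero_add, Real.sqrt_zero, zero_mul] at *
    refine le_of_forall_pos_le_add fun ε hε => ?_
    have := h ((B + 1) / ε) (by positivity)
    refine this.trans ?_
    rw [div_div_eq_mul_div, zero_add, div_div, div_le_iff₀ (by positivity)]
    nlinarith
  rcases hB.eq_or_lt with rfl | hB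
  · simp only [zero_div, add_zero, Real.sqrt_zero, mul_zero] at *
    refine le_of_forall_pos_le_add fun ε hε => ?_
    have := h (ε / (A + 1)) (by positivity)
    refine this.trans ?_
    rw [zero_add, div_mul_eq_mul_div, div_div, div_le_iff₀ (by positivity)]
    nlinarith
  · have ha := Real.sqrt_pos.2 hA
    have hb := Real.sqrt_pos.2 hB
    have := h (Real.sqrt B / Real.sqrt A) (by positivity)
    refine this.trans (le_of_eq ?_)
    have e1 := Real.sq_sqrt hA.le
    have e2 := Real.sq_sqrt hB.le
    generalize Real.sqrt A = a at *
    generalize Real.sqrt B = c at *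
    subst e1 e2
    field_simp
    norm_num

theorem amgm_pt {a b s : ℝ} (hs : 0 < s) : |a * b| ≤ (s * a ^ 2 + b ^ 2 / s) / 2 := by
  have : (s * a ^ 2 + b ^ 2 / s) / 2 = (s ^ 2 * |a| ^ 2 + |b| ^ 2) / (2 * s) := by
    rw [sq_abs, sq_abs]; field_simp
  rw [this, abs_mul, le_div_iff₀ (by positivity)]
  nlinarith [sq_nonneg (s * |a| - |b|)]

theorem cs_int {f g : V4 → ℝ} (hf : MemLp f 2) (hg : MemLp g 2) : |∫ X, f X * g X| ≤ nn f * nn g := by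
  refine amgm_aux (qq_nonneg _) (qq_nonneg _) fun s hs => ?_
  have hi : Integrable (fun X => f X * g X) := hf.integrable_mul hg
  calc _ ≤ ∫ X, |f X * g X| := abs_integral_le_integral_abs
    _ ≤ ∫ X, (s * f X ^ 2 + g X ^ 2 / s) / 2 := by
        refine integral_mono hi.abs ?_ fun X => amgm_pt hs
        exact (((hf.integrable_sq.const_mul s).add (hg.integrable_sq.div_const s)).div_const 2)
    _ = _ := by
        rw [integral_div, integral_add (hf.integrable_sq.const_mul s) (hg.integrable_sq.div_const s),
          integral_const_mul, integral_div]; rfl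

theorem pint1 {f κ : V4 → ℝ} (hf : Integrable f) (hκ : Integrable κ) :
    Integrable (fun p : V4 × V4 => f p.1 * κ (p.1 - p.2)) ∧
    ∫ p : V4 × V4, f p.1 * κ (p.1 - p.2) = (∫ X, f X) * ∫ X, κ X := by
  have hκ' : Integrable (fun z => κ (-z)) := hκ.comp_neg
  have h0 : Integrable (fun p : V4 × V4 => f p.1 * κ (-p.2)) (volume.prod volume) := hf.mul_prod hκ'
  have hm := measurePreserving_prod_sub (volume : Measure V4) (volume : Measure V4)
  have e : (fun p : V4 × V4 => f p.1 * κ (p.1 - p.2)) =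
      (fun p : V4 × V4 => f p.1 * κ (-p.2)) ∘ (fun z : V4 × V4 => (z.1, z.2 - z.1)) := by
    ext p; simp
  have hi := hm.integrable_comp_of_integrable h0
  refine ⟨by rw [e]; exact hi, ?_⟩
  have hi' := hi
  rw [← e] at hi'
  rw [show (∫ p : V4 × V4, f p.1 * κ (p.1 - p.2)) = ∫ p, f p.1 * κ (p.1 - p.2) ∂(volume.prod volume) from rfl,
    integral_prod _ hi', ← integral_mul_const]
  congr 1; ext X
  simp only
  rw [integral_const_mul, integral_sub_left_eq_self κ volume X]

theorem pint2 {g κ : V4 → ℝ} (hg : Integrable g) (hκ : Integrable κ) :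
    Integrable (fun p : V4 × V4 => g p.2 * κ (p.1 - p.2)) ∧
    ∫ p : V4 × V4, g p.2 * κ (p.1 - p.2) = (∫ X, g X) * ∫ X, κ X := by
  obtain ⟨h1, h2⟩ := pint1 hg hκ.comp_neg
  have hs := Measure.measurePreserving_swap (μ := (volume : Measure V4)) (ν := (volume : Measure V4))
  have e : (fun p : V4 × V4 => g p.2 * κ (p.1 - p.2)) =
      (fun p : V4 × V4 => g p.1 * κ (-(p.1 - p.2))) ∘ Prod.swap := by
    ext p; simp
  refine ⟨by rw [e]; exact hs.integrable_comp_of_integrable h1, ?_⟩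
  rw [show (∫ X, κ X) = ∫ X, κ (-X) from (integral_neg_eq_self κ volume).symm, ← h2]
  have h3 := MeasurePreserving.integral_comp' (f := MeasurableEquiv.prodComm) hs
    (fun p : V4 × V4 => g p.1 * κ (-(p.1 - p.2)))
  refine Eq.trans ?_ h3
  exact integral_congr_ae (Eventually.of_forall fun p => congrFun e p)

theorem BB_meas {κ f g : V4 → ℝ} (hκ : AEStronglyMeasurable κ) (hf : AEStronglyMeasurable f)
    (hg : AEStronglyMeasurable g) :
    AEStronglyMeasurable (fun p : V4 × V4 => f p.1 * g p.2 * κ (p.1 - p.2)) := by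
  refine (AEStronglyMeasurable.mul ?_ ?_).mul ?_
  · exact hf.comp_quasiMeasurePreserving Measure.quasiMeasurePreserving_fst
  · exact hg.comp_quasiMeasurePreserving Measure.quasiMeasurePreserving_snd
  · exact hκ.comp_quasiMeasurePreserving (quasiMeasurePreserving_sub volume volume)

theorem BB_int {κ f g : V4 → ℝ} (hκ : Integrable κ) (hf : MemLp f 2) (hg : MemLp g 2) :
    Integrable (fun p : V4 × V4 => f p.1 * g p.2 * κ (p.1 - p.2)) := by
  have h := ((pint1 hf.integrable_sq hκ.abs).1.add (pint2 hg.integrable_sq hκ.abs).1)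
  refine h.mono' (BB_meas hκ.1 hf.1 hg.1) (Eventually.of_forall fun p => ?_)
  simp only [Pi.add_apply, norm_mul, Real.norm_eq_abs]
  have h1 : |f p.1| * |g p.2| ≤ f p.1 ^ 2 + g p.2 ^ 2 := by
    have := sq_nonneg (|f p.1| - |g p.2|)
    rw [← sq_abs (f p.1), ← sq_abs (g p.2)]
    nlinarith [sq_nonneg (|f p.1|), sq_nonneg (|g p.2|)]
  rw [← add_mul]
  gcongr

theorem BB_bound {κ f g : V4 → ℝ} (hκ : Integrable κ) (hf : MemLp f 2) (hg : MemLp g 2) :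
    |BB κ f g| ≤ (∫ X, |κ X|) * (nn f * nn g) := by
  set c := ∫ X, |κ X| with hc
  have hc0 : 0 ≤ c := integral_nonneg fun _ => abs_nonneg _
  have key : ∀ s : ℝ, 0 < s → |BB κ f g| ≤ (s * (c * qq f) + (c * qq g) / s) / 2 := by
    intro s hs
    obtain ⟨a1, a2⟩ := pint1 hf.integrable_sq hκ.abs
    obtain ⟨b1, b2⟩ := pint2 hg.integrable_sq hκ.abs
    calc _ ≤ ∫ p : V4 × V4, |f p.1 * g p.2 * κ (p.1 - p.2)| := abs_integral_le_integral_abs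
      _ ≤ ∫ p : V4 × V4, (s * (f p.1 ^ 2 * |κ (p.1 - p.2)|) + (g p.2 ^ 2 * |κ (p.1 - p.2)|) / s) / 2 := by
          refine integral_mono (BB_int hκ hf hg).abs
            (((a1.const_mul s).add (b1.div_const s)).div_const 2) fun p => ?_
          simp only
          rw [abs_mul]
          calc _ ≤ ((s * f p.1 ^ 2 + g p.2 ^ 2 / s) / 2) * |κ (p.1 - p.2)| := by
                gcongr; exact amgm_pt hs
            _ = _ := by ring
      _ = _ := by
          rw [integral_div, integral_add (a1.const_mul s) (b1.div_const s),
            integral_const_mul, integral_div, a2, b2]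
          simp only [qq, hc]; ring
  have := amgm_aux (mul_nonneg hc0 (qq_nonneg f)) (mul_nonneg hc0 (qq_nonneg g)) key
  rw [Real.sqrt_mul hc0, Real.sqrt_mul hc0] at this
  calc _ ≤ _ := this
    _ = (Real.sqrt c * Real.sqrt c) * (nn f * nn g) := by unfold nn; ring
    _ = _ := by rw [Real.mul_self_sqrt hc0]

theorem BB_add_left {κ f₁ f₂ g : V4 → ℝ} (hκ : Integrable κ) (hf : MemLp f₁ 2) (hf' : MemLp f₂ 2)
    (hg : MemLp g 2) : BB κ (fun X => f₁ X + f₂ X) g = BB κ f₁ g + BB κ f₂ g := by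
  unfold BB
  rw [← integral_add (BB_int hκ hf hg) (BB_int hκ hf' hg)]
  congr 1; ext p; ring

theorem BB_add_right {κ f g₁ g₂ : V4 → ℝ} (hκ : Integrable κ) (hf : MemLp f 2) (hg : MemLp g₁ 2)
    (hg' : MemLp g₂ 2) : BB κ f (fun X => g₁ X + g₂ X) = BB κ f g₁ + BB κ f g₂ := by
  unfold BB
  rw [← integral_add (BB_int hκ hf hg) (BB_int hκ hf hg')]
  congr 1; ext p; ring

theorem BB_smul_left (κ f g : V4 → ℝ) (c : ℝ) : BB κ (fun X => c * f X) g = c * BB κ f g := by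
  unfold BB
  rw [← integral_const_mul]
  congr 1; ext p; ring

theorem BB_smul_right (κ f g : V4 → ℝ) (c : ℝ) : BB κ f (fun X => c * g X) = c * BB κ f g := by
  unfold BB
  rw [← integral_const_mul]
  congr 1; ext p; ring

theorem BB_kadd {κ₁ κ₂ f g : V4 → ℝ} (hκ : Integrable κ₁) (hκ' : Integrable κ₂) (hf : MemLp f 2)
    (hg : MemLp g 2) : BB (fun X => κ₁ X + κ₂ X) f g = BB κ₁ f g + BB κ₂ f g := by
  unfold BB
  rw [← integral_add (BB_int hκ hf hg) (BB_int hκ' hf hg)]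
  congr 1; ext p; ring

theorem BB_comm {κ f g : V4 → ℝ} (hκ : ∀ X, κ (-X) = κ X) : BB κ f g = BB κ g f := by
  have hs := Measure.measurePreserving_swap (μ := (volume : Measure V4)) (ν := (volume : Measure V4))
  unfold BB
  have := MeasurePreserving.integral_comp' (f := MeasurableEquiv.prodComm) hs
    (fun p : V4 × V4 => f p.1 * g p.2 * κ (p.1 - p.2))
  refine this.symm.trans ?_
  refine integral_congr_ae (Eventually.of_forall fun p => ?_)
  show f p.2 * g p.1 * κ (p.2 - p.1) = g p.1 * f p.2 * κ (p.1 - p.2)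
  rw [← hκ (p.1 - p.2), neg_sub]; ring

theorem BB_congr {κ f g f' g' : V4 → ℝ} (hf : f =ᵐ[volume] f') (hg : g =ᵐ[volume] g') :
    BB κ f g = BB κ f' g' := by
  unfold BB
  refine integral_congr_ae ?_
  have h1 := (Measure.quasiMeasurePreserving_fst (μ := (volume : Measure V4))
    (ν := (volume : Measure V4))).ae_eq_comp hf
  have h2 := (Measure.quasiMeasurePreserving_snd (μ := (volume : Measure V4))
    (ν := (volume : Measure V4))).ae_eq_comp hg
  filter_upwards [h1, h2] with p h1 h2
  simp only [Function.comp_apply] at h1 h2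
  rw [h1, h2]

theorem BB_eq {κ f g : V4 → ℝ} (hκ : Integrable κ) (hf : MemLp f 2) (hg : MemLp g 2) :
    BB κ f g = ∫ X, f X * ∫ Y, κ (X - Y) * g Y := by
  unfold BB
  rw [show (∫ p : V4 × V4, f p.1 * g p.2 * κ (p.1 - p.2)) =
    ∫ p, f p.1 * g p.2 * κ (p.1 - p.2) ∂(volume.prod volume) from rfl, integral_prod _ (BB_int hκ hf hg)]
  congr 1; ext X
  rw [← integral_const_mul]
  congr 1; ext Y; ring

end

section
structure Gd (w : V4 → ℝ) : Prop where
  pos : ∀ X, 0 ≤ w X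
  i1 : Integrable w
  i2 : MemLp w 2

noncomputable def FF (lam : ℝ) (w : V4 → ℝ) : ℝ := BB kk w w / 2 - qq w / (2 * lam)

noncomputable def ks (d : ℝ) (X : V4) : ℝ := if ‖X‖ < d then kk X else 0
noncomputable def kb (d : ℝ) (X : V4) : ℝ := if ‖X‖ < d then 0 else kk X

theorem ks_add_kb (d : ℝ) (X : V4) : kk X = ks d X + kb d X := by
  unfold ks kb; split_ifs <;> simp

theorem ks_nonneg (d : ℝ) (X : V4) : 0 ≤ ks d X := by
  unfold ks; split_ifs <;> simp [kk_nonneg]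

theorem kb_nonneg (d : ℝ) (X : V4) : 0 ≤ kb d X := by
  unfold kb; split_ifs <;> simp [kk_nonneg]

theorem ks_neg (d : ℝ) (X : V4) : ks d (-X) = ks d X := by simp [ks, kk_neg]
theorem kb_neg (d : ℝ) (X : V4) : kb d (-X) = kb d X := by simp [kb, kk_neg]

theorem ks_le (d : ℝ) (X : V4) : ks d X ≤ kk X := by
  unfold ks; split_ifs <;> simp [kk_nonneg]

theorem kb_le (d : ℝ) (X : V4) : kb d X ≤ kk X := by
  unfold kb; split_ifs <;> simp [kk_nonneg]

theorem kb_le' {d : ℝ} (hd : 0 < d) (X : V4) : kb d X ≤ 2 / d ^ 4 := by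
  unfold kb; split_ifs with h
  · positivity
  · push Not at h
    have hX : 0 < ‖X‖ := by linarith
    refine (kk_le (norm_pos_iff.1 hX)).trans ?_
    gcongr

theorem ks_meas (d : ℝ) : Measurable (ks d) :=
  Measurable.ite (measurableSet_lt measurable_norm measurable_const) kk_meas measurable_const

theorem kb_meas (d : ℝ) : Measurable (kb d) :=
  Measurable.ite (measurableSet_lt measurable_norm measurable_const) measurable_const kk_meas

theorem ks_integrable (d : ℝ) : Integrable (ks d) :=
  kk_integrable.mono' (ks_meas d).aestronglyMeasurable (Eventually.of_forall fun X => by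
    rw [Real.norm_of_nonneg (ks_nonneg _ _)]; exact ks_le _ _)

theorem kb_integrable (d : ℝ) : Integrable (kb d) :=
  kk_integrable.mono' (kb_meas d).aestronglyMeasurable (Eventually.of_forall fun X => by
    rw [Real.norm_of_nonneg (kb_nonneg _ _)]; exact kb_le _ _)

theorem ks_abs (d : ℝ) : ∫ X, |ks d X| = ∫ X, ks d X := by
  congr 1; ext X; exact abs_of_nonneg (ks_nonneg _ _)

theorem kb_abs (d : ℝ) : ∫ X, |kb d X| = ∫ X, kb d X := by
  congr 1; ext X; exact abs_of_nonneg (kb_nonneg _ _)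

theorem kk_abs : ∫ X, |kk X| = 1 := by
  rw [← kk_integral]; congr 1; ext X; exact abs_of_nonneg (kk_nonneg _)

theorem ks_small {η : ℝ} (hη : 0 < η) : ∃ d : ℝ, 0 < d ∧ ∫ X, ks d X ≤ η := by
  have h : Tendsto (fun n : ℕ => ∫ X, ks (1 / ((n : ℝ) + 1)) X) atTop (nhds (∫ _ : V4, (0 : ℝ))) := by
    refine tendsto_integral_of_dominated_convergence kk (fun n => (ks_meas _).aestronglyMeasurable)
      kk_integrable (fun n => Eventually.of_forall fun X => ?_) ?_
    · rw [Real.norm_of_nonneg (ks_nonneg _ _)]; exact ks_le _ _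
    · have h0 : ∀ᵐ X : V4, X ≠ 0 := by
        simp [ae_iff, measure_singleton]
      filter_upwards [h0] with X hX
      have hX' := norm_pos_iff.2 hX
      refine tendsto_const_nhds.congr' ?_
      filter_upwards [tendsto_one_div_add_atTop_nhds_zero_nat.eventually (gt_mem_nhds hX')] with n hn
      simp only [ks]
      rw [if_neg (by linarith)]
  rw [integral_zero] at h
  obtain ⟨n, hn⟩ := (h.eventually (gt_mem_nhds hη)).exists
  exact ⟨_, by positivity, hn.le⟩

theorem kb_small {η : ℝ} (hη : 0 < η) : ∃ d : ℝ, 0 < d ∧ ∫ X, kb d X ≤ η := by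
  have h : Tendsto (fun n : ℕ => ∫ X, kb ((n : ℝ) + 1) X) atTop (nhds (∫ _ : V4, (0 : ℝ))) := by
    refine tendsto_integral_of_dominated_convergence kk (fun n => (kb_meas _).aestronglyMeasurable)
      kk_integrable (fun n => Eventually.of_forall fun X => ?_) ?_
    · rw [Real.norm_of_nonneg (kb_nonneg _ _)]; exact kb_le _ _
    · refine Eventually.of_forall fun X => ?_
      refine tendsto_const_nhds.congr' ?_
      filter_upwards [(tendsto_natCast_atTop_atTop (R := ℝ)).eventually (eventually_gt_atTop ‖X‖)] with n hn
      simp only [kb]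
      rw [if_pos (by linarith)]
  rw [integral_zero] at h
  obtain ⟨n, hn⟩ := (h.eventually (gt_mem_nhds hη)).exists
  exact ⟨_, by positivity, hn.le⟩

theorem BB_bdd {κ f g : V4 → ℝ} {c : ℝ} (hc : ∀ X, |κ X| ≤ c)
    (hf : Integrable f) (hg : Integrable g) :
    |BB κ f g| ≤ c * ((∫ X, |f X|) * ∫ X, |g X|) := by
  have hi : Integrable (fun p : V4 × V4 => |f p.1| * |g p.2|) (volume.prod volume) := hf.abs.mul_prod hg.abs
  rw [← integral_prod_mul (μ := (volume : Measure V4)) (ν := (volume : Measure V4)),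
    ← integral_const_mul]
  refine abs_integral_le_integral_abs.trans ?_
  refine integral_mono_of_nonneg (Eventually.of_forall fun _ => abs_nonneg _) (hi.const_mul c)
    (Eventually.of_forall fun p => ?_)
  simp only
  rw [abs_mul, abs_mul, mul_comm c]
  gcongr
  exact hc _

theorem BB_nonneg {κ f g : V4 → ℝ} (hκ : ∀ X, 0 ≤ κ X) (hf : ∀ X, 0 ≤ f X) (hg : ∀ X, 0 ≤ g X) :
    0 ≤ BB κ f g := integral_nonneg fun p => mul_nonneg (mul_nonneg (hf _) (hg _)) (hκ _)

theorem kk_eq_add (d : ℝ) : kk = fun X => ks d X + kb d X := funext (ks_add_kb d)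

theorem Gd.abs {w : V4 → ℝ} (h : Gd w) : ∫ X, |w X| = ∫ X, w X := by
  congr 1; ext X; exact abs_of_nonneg (h.pos X)

theorem Gd.int_nonneg {w : V4 → ℝ} (h : Gd w) : 0 ≤ ∫ X, w X := integral_nonneg h.pos

theorem FF_le_star {lam : ℝ} (hl : 1 < lam) : ∃ κ : ℝ, 0 < κ ∧ ∀ w, Gd w →
    FF lam w ≤ -qq w / (4 * lam) + κ * (∫ X, w X) ^ 2 := by
  obtain ⟨d, hd, hd'⟩ := ks_small (η := 1 / (2 * lam)) (by positivity)
  refine ⟨(2 / d ^ 4) / 2, by positivity, fun w hw => ?_⟩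
  have h1 : BB kk w w = BB (ks d) w w + BB (kb d) w w := by
    rw [kk_eq_add d, BB_kadd (ks_integrable d) (kb_integrable d) hw.i2 hw.i2]
  have h2 := (le_abs_self _).trans (BB_bound (ks_integrable d) hw.i2 hw.i2)
  have h3 := (le_abs_self _).trans (BB_bdd (κ := kb d) (c := 2 / d ^ 4) (fun X => by
    rw [abs_of_nonneg (kb_nonneg _ _)]; exact kb_le' hd X) hw.i1 hw.i1)
  rw [hw.abs] at h3
  rw [ks_abs, ← sq, nn_sq] at h2
  have h4 : BB (ks d) w w ≤ 1 / (2 * lam) * qq w :=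
    h2.trans (mul_le_mul_of_nonneg_right hd' (qq_nonneg w))
  unfold FF
  rw [h1]
  have : qq w / (2 * lam) = 1 / (2 * lam) * qq w := by ring
  have e2 : -qq w / (4 * lam) = - (1 / (2 * lam) * qq w) / 2 := by field_simp; norm_num
  rw [this, e2]
  linarith

theorem Gd.smul {w : V4 → ℝ} (h : Gd w) {c : ℝ} (hc : 0 ≤ c) : Gd (fun X => c * w X) :=
  ⟨fun X => mul_nonneg hc (h.pos X), h.i1.const_mul c, h.i2.const_mul c⟩

theorem qq_smul (w : V4 → ℝ) (c : ℝ) : qq (fun X => c * w X) = c ^ 2 * qq w := by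
  unfold qq; rw [← integral_const_mul]; congr 1; ext X; ring

theorem FF_smul (lam : ℝ) (w : V4 → ℝ) (c : ℝ) : FF lam (fun X => c * w X) = c ^ 2 * FF lam w := by
  unfold FF; rw [BB_smul_left, BB_smul_right, qq_smul]; ring

theorem BB_comp {κ f g : V4 → ℝ} (T : V4 ≃ᵐ V4) (hT : MeasurePreserving T volume volume)
    (hκ : ∀ X Y, κ (T X - T Y) = κ (X - Y)) :
    BB κ (fun X => f (T X)) (fun X => g (T X)) = BB κ f g := by
  unfold BB
  have := (hT.prod hT).integral_comp (MeasurableEquiv.prodCongr T T).measurableEmbedding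
    (fun p : V4 × V4 => f p.1 * g p.2 * κ (p.1 - p.2))
  refine Eq.trans ?_ this
  refine integral_congr_ae (Eventually.of_forall fun p => ?_)
  show f (T p.1) * g (T p.2) * κ (p.1 - p.2) = f (T p.1) * g (T p.2) * κ (T p.1 - T p.2)
  rw [hκ]

theorem qq_comp {f : V4 → ℝ} (T : V4 ≃ᵐ V4) (hT : MeasurePreserving T volume volume) :
    qq (fun X => f (T X)) = qq f := hT.integral_comp' (g := fun X => f X ^ 2)

theorem FF_comp {lam : ℝ} {f : V4 → ℝ} (T : V4 ≃ᵐ V4) (hT : MeasurePreserving T volume volume)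
    (hi : ∀ X Y, ‖T X - T Y‖ = ‖X - Y‖) : FF lam (fun X => f (T X)) = FF lam f := by
  unfold FF; rw [BB_comp T hT fun X Y => kk_norm (hi X Y), qq_comp T hT]

theorem Gd.comp {w : V4 → ℝ} (h : Gd w) (T : V4 ≃ᵐ V4) (hT : MeasurePreserving T volume volume) :
    Gd (fun X => w (T X)) :=
  ⟨fun X => h.pos _, hT.integrable_comp_of_integrable h.i1, h.i2.comp_measurePreserving hT⟩

noncomputable def trE (z : V4) : V4 ≃ᵐ V4 := MeasurableEquiv.addRight z

theorem trE_mp (z : V4) : MeasurePreserving (trE z) volume volume :=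
  measurePreserving_add_right volume z

theorem Gd.trans {w : V4 → ℝ} (h : Gd w) (z : V4) : Gd (fun X => w (X + z)) := h.comp (trE z) (trE_mp z)

theorem FF_trans {lam : ℝ} {f : V4 → ℝ} (z : V4) : FF lam (fun X => f (X + z)) = FF lam f :=
  FF_comp (trE z) (trE_mp z) fun X Y => by simp [trE]

theorem Gd.ind {w : V4 → ℝ} (h : Gd w) {s : Set V4} (hs : MeasurableSet s) : Gd (s.indicator w) :=
  ⟨fun X => Set.indicator_nonneg (fun _ _ => h.pos _) X, h.i1.indicator hs, h.i2.indicator hs⟩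

theorem Gd.add {w v : V4 → ℝ} (h : Gd w) (h' : Gd v) : Gd (fun X => w X + v X) :=
  ⟨fun X => add_nonneg (h.pos _) (h'.pos _), h.i1.add h'.i1, h.i2.add h'.i2⟩

theorem exists_pos {lam : ℝ} (hl : 1 < lam) : ∃ w, Gd w ∧ 0 < ∫ X, w X ∧ 0 < FF lam w := by
  -- choose L with the integral of kk on the ball of radius L big
  have hη : 0 < (1 - 1 / lam) / 2 := by
    have : 1 / lam < 1 := by rw [div_lt_one (by linarith)]; exact hl
    linarith
  obtain ⟨L, hL, hL'⟩ := kb_small hη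
  set η := (1 - 1 / lam) / 2 with hη'
  have hks : 1 - η ≤ ∫ X, ks L X := by
    have := kk_integral
    rw [kk_eq_add L, integral_add (ks_integrable L) (kb_integrable L)] at this
    linarith
  set v := (volume (Metric.ball (0 : V4) 1)).toReal with hv
  have hv0 : 0 < v := ENNReal.toReal_pos (Metric.measure_ball_pos _ _ one_pos).ne' measure_ball_lt_top.ne
  have hvol : ∀ r : ℝ, 0 ≤ r → (volume (Metric.ball (0 : V4) r)).toReal = r ^ 4 * v := by
    intro r hr
    rw [Measure.addHaar_ball _ _ hr, ENNReal.toReal_mul, ENNReal.toReal_ofReal (by positivity)]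
    simp [hv]
  have key : ∀ R : ℝ, L < R → Gd ((Metric.ball (0 : V4) R).indicator fun _ => 1) ∧
      (∫ X, (Metric.ball (0 : V4) R).indicator (fun _ => (1 : ℝ)) X) = R ^ 4 * v ∧
      qq ((Metric.ball (0 : V4) R).indicator fun _ => 1) = R ^ 4 * v ∧
      (R - L) ^ 4 * v * (1 - η) ≤ BB kk ((Metric.ball (0 : V4) R).indicator fun _ => 1)
        ((Metric.ball (0 : V4) R).indicator fun _ => 1) := by
    intro R hR
    have hG : Gd ((Metric.ball (0 : V4) R).indicator fun _ => 1) :=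
      ⟨fun X => Set.indicator_nonneg (fun _ _ => zero_le_one) X,
        (integrable_indicator_iff measurableSet_ball).2 (by simp [measure_ball_lt_top]),
        memLp_indicator_const 2 measurableSet_ball 1 (Or.inr measure_ball_lt_top.ne)⟩
    have hIntg : (∫ X, (Metric.ball (0 : V4) R).indicator (fun _ => (1 : ℝ)) X) = R ^ 4 * v := by
      rw [integral_indicator measurableSet_ball]
      simp [Measure.real, hvol R (by linarith)]
    refine ⟨hG, hIntg, ?_, ?_⟩
    · rw [← hIntg]; unfold qq; congr 1; ext X
      by_cases h : X ∈ Metric.ball (0 : V4) R <;> simp [h]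
    · rw [BB_eq kk_integrable hG.i2 hG.i2]
      have h1 : (R - L) ^ 4 * v * (1 - η) = ∫ X, (Metric.ball (0 : V4) (R - L)).indicator (fun _ => (1 - η)) X := by
        rw [integral_indicator measurableSet_ball]
        simp [Measure.real, hvol (R - L) (by linarith)]
      rw [h1]
      have h1η : 0 ≤ 1 - η := by
        have : 0 < 1 / lam := by positivity
        rw [hη']; linarith
      have hint2 : Integrable (fun p : V4 × V4 => (Metric.ball (0 : V4) R).indicator (fun _ => (1 : ℝ)) p.1 *
        (Metric.ball (0 : V4) R).indicator (fun _ => (1 : ℝ)) p.2 * kk (p.1 - p.2)) (volume.prod volume) :=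
          BB_int kk_integrable hG.i2 hG.i2
      refine integral_mono_of_nonneg (Eventually.of_forall fun X => Set.indicator_nonneg (fun _ _ => h1η) X)
        ?_ (Eventually.of_forall fun X => ?_)
      · refine hint2.integral_prod_left.congr (Eventually.of_forall fun X => ?_)
        simp only
        rw [← integral_const_mul]; congr 1; ext Y; ring
      · simp only
        by_cases hX : X ∈ Metric.ball (0 : V4) (R - L)
        · have hX2 : X ∈ Metric.ball (0 : V4) R := Metric.ball_subset_ball (by linarith) hX
          rw [Set.indicator_of_mem hX, Set.indicator_of_mem hX2, one_mul]
          refine hks.trans ?_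
          rw [← integral_sub_left_eq_self (ks L) volume X]
          refine integral_mono_of_nonneg (Eventually.of_forall fun Y => ks_nonneg _ _) ?_
            (Eventually.of_forall fun Y => ?_)
          · have := kk_integrable.comp_sub_left X
            refine (this.indicator (measurableSet_ball (x := (0 : V4)) (ε := R))).congr
              (Eventually.of_forall fun Y => ?_)
            by_cases h : Y ∈ Metric.ball (0 : V4) R <;> simp only [h, Set.indicator_of_mem,
              Set.indicator_of_notMem, not_false_iff, mul_one, mul_zero]
          · simp only
            by_cases h : Y ∈ Metric.ball (0 : V4) R
            · rw [Set.indicator_of_mem h, mul_one]; exact ks_le _ _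
            · rw [Set.indicator_of_notMem h, mul_zero]
              unfold ks
              rw [if_neg]
              simp only [Metric.mem_ball, dist_zero_right, not_lt] at *
              have := norm_sub_norm_le Y X
              rw [norm_sub_rev]
              linarith
        · rw [Set.indicator_of_notMem hX]
          refine mul_nonneg (hG.pos X) (integral_nonneg fun Y => mul_nonneg (kk_nonneg _) (hG.pos Y))
  have hlim : Tendsto (fun R : ℝ => ((R - L) / R) ^ 4 * (1 - η)) atTop (nhds ((1 - 0) ^ 4 * (1 - η))) := by
    refine Tendsto.mul_const _ (Tendsto.pow ?_ 4)
    have h1 : Tendsto (fun R : ℝ => 1 - L / R) atTop (nhds (1 - 0)) :=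
      tendsto_const_nhds.sub (tendsto_const_nhds.div_atTop tendsto_id)
    refine h1.congr' ?_
    filter_upwards [eventually_gt_atTop 0] with R hR
    field_simp
  have hlt : 1 / lam < (1 - 0) ^ 4 * (1 - η) := by
    rw [hη']; rw [hη'] at hη; norm_num; norm_num at hη; linarith
  obtain ⟨R, hR1, hR2⟩ := ((hlim.eventually (lt_mem_nhds hlt)).and (eventually_gt_atTop L)).exists
  obtain ⟨k1, k2, k3, k4⟩ := key R hR2
  have hR0 : 0 < R := by linarith
  refine ⟨_, k1, by rw [k2]; positivity, ?_⟩
  unfold FF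
  rw [k3]
  have : R ^ 4 * v * (1 / lam) < (R - L) ^ 4 * v * (1 - η) := by
    calc _ < R ^ 4 * v * (((R - L) / R) ^ 4 * (1 - η)) := by gcongr
      _ = _ := by field_simp
  have e : R ^ 4 * v / (2 * lam) = (R ^ 4 * v * (1 / lam)) / 2 := by field_simp
  rw [e]; linarith

noncomputable def CC (lam : ℝ) : ℝ := sSup {s | ∃ w, Gd w ∧ ∫ X, w X = 1 ∧ s = FF lam w}

theorem CC_bdd {lam : ℝ} (hl : 1 < lam) : BddAbove {s | ∃ w, Gd w ∧ ∫ X, w X = 1 ∧ s = FF lam w} := by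
  obtain ⟨κ, hκ, h⟩ := FF_le_star hl
  refine ⟨κ, ?_⟩
  rintro s ⟨w, hw, h1, rfl⟩
  have := h w hw
  rw [h1] at this
  have : 0 ≤ qq w / (4 * lam) := div_nonneg (qq_nonneg _) (by linarith)
  have e : -qq w / (4 * lam) = - (qq w / (4 * lam)) := by ring
  linarith

theorem CC_pos {lam : ℝ} (hl : 1 < lam) : 0 < CC lam := by
  obtain ⟨w, hw, h1, h2⟩ := exists_pos hl
  refine lt_of_lt_of_le ?_ (le_csSup (CC_bdd hl)
    ⟨fun X => (∫ X, w X)⁻¹ * w X, hw.smul (by positivity), ?_, rfl⟩)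
  · rw [FF_smul]; positivity
  · rw [integral_const_mul, inv_mul_cancel₀ h1.ne']

theorem FF_zero_of_int {lam : ℝ} {w : V4 → ℝ} (hw : Gd w) (h : ∫ X, w X = 0) : FF lam w = 0 := by
  have h0 : w =ᵐ[volume] fun _ => 0 := (integral_eq_zero_iff_of_nonneg hw.pos hw.i1).1 h
  have h1 : BB kk w w = 0 := by rw [BB_congr h0 h0]; simp [BB]
  have h2 : qq w = 0 := by
    unfold qq
    rw [integral_congr_ae (g := fun _ => (0 : ℝ)) (by filter_upwards [h0] with X hX; simp [hX])]
    simp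
  simp [FF, h1, h2]

theorem FF_le_CC {lam : ℝ} (hl : 1 < lam) {w : V4 → ℝ} (hw : Gd w) : FF lam w ≤ CC lam * (∫ X, w X) ^ 2 := by
  rcases hw.int_nonneg.eq_or_lt with h | h
  · rw [FF_zero_of_int hw h.symm, ← h]; simp
  · have := le_csSup (CC_bdd hl)
      ⟨fun X => (∫ X, w X)⁻¹ * w X, hw.smul (by positivity), by
        rw [integral_const_mul, inv_mul_cancel₀ h.ne'], rfl⟩
    rw [FF_smul] at this
    have h2 : ((∫ X, w X)⁻¹ ^ 2 * FF lam w) * (∫ X, w X) ^ 2 ≤ CC lam * (∫ X, w X) ^ 2 := by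
      gcongr; exact this
    calc _ = ((∫ X, w X)⁻¹ ^ 2 * FF lam w) * (∫ X, w X) ^ 2 := by field_simp
      _ ≤ _ := h2

theorem nonvanish {lam : ℝ} (hl : 1 < lam) : ∃ R β : ℝ, 0 < R ∧ 0 < β ∧ ∀ w, Gd w → 0 < ∫ X, w X →
    CC lam / 2 * (∫ X, w X) ^ 2 ≤ FF lam w → ∃ z : V4, β * ∫ X, w X ≤ ∫ X in Metric.ball z R, w X := by
  have hC := CC_pos hl
  obtain ⟨d, hd, hd'⟩ := ks_small (η := 1 / lam) (by positivity)
  set κ := 2 / d ^ 4 with hκ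
  have hκ0 : 0 < κ := by positivity
  have htail : Tendsto (fun R : ℝ => 2 / R ^ 4) atTop (nhds 0) :=
    tendsto_const_nhds.div_atTop (tendsto_pow_atTop (by norm_num))
  obtain ⟨R, hR1, hR2⟩ := ((htail.eventually (gt_mem_nhds (show (0 : ℝ) < CC lam / 4 by positivity))).and
    (eventually_gt_atTop 0)).exists
  refine ⟨R, CC lam / (4 * κ), hR2, by positivity, fun w hw hM hF => ?_⟩
  by_contra hcon
  push Not at hcon
  set M := ∫ X, w X with hMdef
  have h1 : BB kk w w = BB (ks d) w w + BB (kb d) w w := by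
    rw [kk_eq_add d, BB_kadd (ks_integrable d) (kb_integrable d) hw.i2 hw.i2]
  have h2 := (le_abs_self _).trans (BB_bound (ks_integrable d) hw.i2 hw.i2)
  rw [ks_abs, ← sq, nn_sq] at h2
  have h4 : BB (ks d) w w ≤ 1 / lam * qq w := h2.trans (mul_le_mul_of_nonneg_right hd' (qq_nonneg w))
  have h5 : BB (kb d) w w ≤ (κ * (CC lam / (4 * κ) * M) + CC lam / 4 * M) * M := by
    rw [BB_eq (kb_integrable d) hw.i2 hw.i2, hMdef, ← hMdef, ← integral_const_mul]
    refine integral_mono_of_nonneg (Eventually.of_forall fun X => mul_nonneg (hw.pos X)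
      (integral_nonneg fun Y => mul_nonneg (kb_nonneg _ _) (hw.pos Y))) (hw.i1.const_mul _)
      (Eventually.of_forall fun X => ?_)
    simp only
    rw [mul_comm]
    refine mul_le_mul_of_nonneg_right ?_ (hw.pos X)
    have hi1 : Integrable (fun Y => κ * (Metric.ball X R).indicator w Y) :=
      (hw.i1.indicator measurableSet_ball).const_mul κ
    have hi2 : Integrable (fun Y => CC lam / 4 * w Y) := hw.i1.const_mul _
    calc _ ≤ ∫ Y, (κ * (Metric.ball X R).indicator w Y + CC lam / 4 * w Y) := by
          refine integral_mono_of_nonneg (Eventually.of_forall fun Y => mul_nonneg (kb_nonneg _ _) (hw.pos Y))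
            (hi1.add hi2) (Eventually.of_forall fun Y => ?_)
          simp only
          by_cases hY : Y ∈ Metric.ball X R
          · rw [Set.indicator_of_mem hY]
            have a1 := mul_le_mul_of_nonneg_right (kb_le' hd (X - Y)) (hw.pos Y)
            have a2 := mul_nonneg (by positivity : 0 ≤ CC lam / 4) (hw.pos Y)
            linarith
          · rw [Set.indicator_of_notMem hY, mul_zero, zero_add]
            refine mul_le_mul_of_nonneg_right ?_ (hw.pos Y)
            have hXY : R ≤ ‖X - Y‖ := by
              rw [Metric.mem_ball, dist_eq_norm, not_lt, norm_sub_rev] at hY; exact hY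
            have hne : X - Y ≠ 0 := norm_pos_iff.1 (by linarith)
            calc kb d (X - Y) ≤ kk (X - Y) := kb_le _ _
              _ ≤ 2 / ‖X - Y‖ ^ 4 := kk_le hne
              _ ≤ 2 / R ^ 4 := by gcongr
              _ ≤ _ := hR1.le
      _ = κ * (∫ Y in Metric.ball X R, w Y) + CC lam / 4 * M := by
          rw [integral_add hi1 hi2, integral_const_mul, integral_const_mul, integral_indicator measurableSet_ball]
      _ ≤ _ := by
          have := (hcon X).le
          gcongr
  have h6 : κ * (CC lam / (4 * κ) * M) = CC lam / 4 * M := by field_simp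
  rw [h6] at h5
  have h7 : FF lam w ≤ BB (kb d) w w / 2 := by
    unfold FF
    have : qq w / (2 * lam) = (1 / lam * qq w) / 2 := by field_simp
    rw [h1, this]; linarith
  have : 0 < CC lam * M ^ 2 := by positivity
  nlinarith

end

section
theorem toLp_norm_sq {f : V4 → ℝ} (hf : MemLp f 2) : ‖hf.toLp f‖ ^ 2 = qq f := by
  rw [← real_inner_self_eq_norm_sq, MeasureTheory.L2.inner_def]
  unfold qq
  refine integral_congr_ae ?_
  filter_upwards [hf.coeFn_toLp] with X hX
  rw [hX, real_inner_self_eq_norm_sq, Real.norm_eq_abs, sq_abs]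

theorem toLp_inner {f g : V4 → ℝ} (hf : MemLp f 2) (hg : MemLp g 2) :
    inner ℝ (hf.toLp f) (hg.toLp g) = ∫ X, f X * g X := by
  rw [MeasureTheory.L2.inner_def]
  refine integral_congr_ae ?_
  filter_upwards [hf.coeFn_toLp, hg.coeFn_toLp] with X hX hX'
  rw [hX, hX']; simp [mul_comm]

theorem weak_seq {f : ℕ → V4 → ℝ} (hf : ∀ n, MemLp (f n) 2) {K : ℝ} (hK : ∀ n, qq (f n) ≤ K) :
    ∃ φ : ℕ → ℕ, StrictMono φ ∧ ∃ w : V4 → ℝ, MemLp w 2 ∧ ∀ g, MemLp g 2 →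
      Tendsto (fun n => ∫ X, f (φ n) X * g X) atTop (nhds (∫ X, w X * g X)) := by
  have : Fact ((1 : ENNReal) ≤ 2) := ⟨by norm_num⟩
  have : Fact ((2 : ENNReal) ≠ ⊤) := ⟨by norm_num⟩
  let E := Lp ℝ 2 (volume : Measure V4)
  let x : ℕ → WeakDual ℝ E := fun n =>
    StrongDual.toWeakDual (InnerProductSpace.toDual ℝ E ((hf n).toLp (f n)))
  have hx : ∀ n, x n ∈ (WeakDual.toStrongDual ⁻¹' Metric.closedBall (0 : StrongDual ℝ E) (Real.sqrt K)) := by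
    intro n
    simp only [Set.mem_preimage, Metric.mem_closedBall, dist_zero_right]
    have : ‖InnerProductSpace.toDual ℝ E ((hf n).toLp (f n))‖ ≤ Real.sqrt K := by
      rw [LinearIsometryEquiv.norm_map]
      apply Real.le_sqrt_of_sq_le
      rw [toLp_norm_sq]; exact hK n
    exact this
  obtain ⟨l, -, φ, hφ, hl⟩ := WeakDual.isSeqCompact_closedBall ℝ E 0 (Real.sqrt K) hx
  let w : E := (InnerProductSpace.toDual ℝ E).symm (WeakDual.toStrongDual l)
  refine ⟨φ, hφ, w, Lp.memLp w, fun g hg => ?_⟩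
  have h1 : Tendsto (fun n => (x (φ n)) (hg.toLp g)) atTop (nhds (l (hg.toLp g))) :=
    ((WeakDual.eval_continuous (hg.toLp g)).tendsto l).comp hl
  have h2 : ∀ n, x (φ n) (hg.toLp g) = ∫ X, f (φ n) X * g X := by
    intro n
    exact toLp_inner (hf _) hg
  have h3 : l (hg.toLp g) = ∫ X, w X * g X := by
    have : inner ℝ w (hg.toLp g) = l (hg.toLp g) := by
      simp only [w]
      rw [InnerProductSpace.toDual_symm_apply]; rfl
    rw [← this, ← toLp_inner (Lp.memLp w) hg, Lp.toLp_coeFn]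
  rw [← h3]
  exact h1.congr h2

theorem kk_split {η : ℝ} (hη : 0 < η) : ∃ (κ : V4 → ℝ) (R c : ℝ), 0 < R ∧ 0 < c ∧ Measurable κ ∧ (∀ X, |κ X| ≤ c) ∧
    (∀ X, R ≤ ‖X‖ → κ X = 0) ∧ (∀ X, κ (-X) = κ X) ∧ Integrable κ ∧ Integrable (fun X => kk X - κ X) ∧
    ∫ X, |kk X - κ X| ≤ η := by
  obtain ⟨d, hd, hd'⟩ := ks_small (half_pos hη)
  obtain ⟨R, hR, hR'⟩ := kb_small (half_pos hη)
  have hm : Measurable (fun X : V4 => if ‖X‖ < R then kb d X else 0) :=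
    Measurable.ite (measurableSet_lt measurable_norm measurable_const) (kb_meas d) measurable_const
  have hi : Integrable (fun X : V4 => if ‖X‖ < R then kb d X else 0) :=
    (kb_integrable d).mono' hm.aestronglyMeasurable (Eventually.of_forall fun X => by
      split_ifs
      · rw [Real.norm_of_nonneg (kb_nonneg _ _)]
      · simp [kb_nonneg])
  refine ⟨fun X => if ‖X‖ < R then kb d X else 0, R, 2 / d ^ 4, hR, by positivity, hm, fun X => ?_, fun X hX => ?_,
    fun X => by simp [kb_neg], hi, kk_integrable.sub hi, ?_⟩
  · beta_reduce
    split_ifs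
    · rw [abs_of_nonneg (kb_nonneg _ _)]; exact kb_le' hd X
    · rw [abs_zero]; positivity
  · simp [not_lt.2 hX]
  · calc _ ≤ ∫ X, (ks d X + kb R X) := by
          refine integral_mono_of_nonneg (Eventually.of_forall fun _ => abs_nonneg _)
            ((ks_integrable d).add (kb_integrable R)) (Eventually.of_forall fun X => ?_)
          simp only
          have h1 := ks_nonneg d X
          have h2 := kk_nonneg X
          have h3 := ks_add_kb d X
          have h4 : ‖X‖ < R → kb R X = 0 := fun h => by simp [kb, h]
          have h5 : ¬ ‖X‖ < R → kb R X = kk X := fun h => by simp [kb, h]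
          split_ifs with h
          · rw [h4 h, abs_of_nonneg] <;> linarith
          · rw [h5 h, abs_of_nonneg] <;> linarith
      _ ≤ η := by
          rw [integral_add (ks_integrable d) (kb_integrable R)]; linarith

theorem nn_ind_le {f : V4 → ℝ} (hf : MemLp f 2) {s : Set V4} : nn (s.indicator f) ≤ nn f := by
  unfold nn
  refine Real.sqrt_le_sqrt ?_
  unfold qq
  refine integral_mono_of_nonneg (Eventually.of_forall fun _ => sq_nonneg _) hf.integrable_sq
    (Eventually.of_forall fun X => ?_)
  by_cases h : X ∈ s <;> simp [h, sq_nonneg]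

theorem BB_split {κ f g : V4 → ℝ} {η : ℝ} (h1 : Integrable κ) (h2 : Integrable (fun X => kk X - κ X))
    (h3 : ∫ X, |kk X - κ X| ≤ η) (hf : MemLp f 2) (hg : MemLp g 2) :
    |BB kk f g| ≤ |BB κ f g| + η * (nn f * nn g) := by
  have : BB kk f g = BB κ f g + BB (fun X => kk X - κ X) f g := by
    rw [← BB_kadd h1 h2 hf hg]; congr 1; ext X; ring
  rw [this]
  refine (abs_add_le _ _).trans ?_
  gcongr
  refine (BB_bound h2 hf hg).trans ?_
  exact mul_le_mul_of_nonneg_right h3 (mul_nonneg (nn_nonneg _) (nn_nonneg _))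

theorem conv_meas {κ f : V4 → ℝ} (hκ : Measurable κ) (hf : AEStronglyMeasurable f) :
    AEStronglyMeasurable (fun X => ∫ Y, κ (X - Y) * f Y) := by
  have : AEStronglyMeasurable (fun p : V4 × V4 => κ (p.1 - p.2) * f p.2) (volume.prod volume) := by
    refine AEStronglyMeasurable.mul ?_ ?_
    · exact (hκ.comp (measurable_fst.sub measurable_snd)).aestronglyMeasurable
    · exact hf.comp_quasiMeasurePreserving Measure.quasiMeasurePreserving_snd
  exact this.integral_prod_right'

theorem conv_bd {κ f : V4 → ℝ} {c : ℝ} (hc : ∀ X, |κ X| ≤ c) (hf : Integrable f) (X : V4) :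
    |∫ Y, κ (X - Y) * f Y| ≤ c * ∫ Y, |f Y| := by
  rw [← integral_const_mul]
  refine abs_integral_le_integral_abs.trans ?_
  refine integral_mono_of_nonneg (Eventually.of_forall fun _ => abs_nonneg _) (hf.abs.const_mul c)
    (Eventually.of_forall fun Y => ?_)
  simp only
  rw [abs_mul]
  gcongr
  exact hc _

theorem conv_supp {κ f : V4 → ℝ} {R r : ℝ} (h0 : ∀ X, R ≤ ‖X‖ → κ X = 0) (hf : ∀ X, r ≤ ‖X‖ → f X = 0)
    (X : V4) (hX : r + R ≤ ‖X‖) : ∫ Y, κ (X - Y) * f Y = 0 := by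
  rw [← integral_zero V4 ℝ (μ := volume)]
  congr 1; ext Y
  by_cases h : r ≤ ‖Y‖
  · rw [hf Y h, mul_zero]
  · have := norm_sub_norm_le X Y
    rw [h0 _ (by linarith), zero_mul]

theorem bdd_memLp {v : V4 → ℝ} {c r : ℝ} (hm : AEStronglyMeasurable v) (hc : ∀ X, |v X| ≤ c)
    (hs : ∀ X, r ≤ ‖X‖ → v X = 0) : MemLp v 2 := by
  have h1 : MemLp ((Metric.ball (0 : V4) r).indicator fun _ => c) 2 :=
    memLp_indicator_const 2 measurableSet_ball c (Or.inr measure_ball_lt_top.ne)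
  refine h1.mono hm (Eventually.of_forall fun X => ?_)
  by_cases h : X ∈ Metric.ball (0 : V4) r
  · rw [Set.indicator_of_mem h]
    exact (hc X).trans (le_abs_self c)
  · rw [Metric.mem_ball, dist_zero_right, not_lt] at h
    simp [hs X h]

theorem abs_int_le_nn {f : V4 → ℝ} {r : ℝ} (hf : MemLp f 2) :
    ∫ X in Metric.ball (0 : V4) r, |f X| ≤ nn ((Metric.ball (0 : V4) r).indicator fun _ => (1 : ℝ)) * nn f := by
  have h1 : MemLp ((Metric.ball (0 : V4) r).indicator fun _ => (1 : ℝ)) 2 :=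
    memLp_indicator_const 2 measurableSet_ball 1 (Or.inr measure_ball_lt_top.ne)
  have h := (le_abs_self _).trans (cs_int h1 hf.abs)
  have e : nn (fun X => |f X|) = nn f := by unfold nn qq; simp only [sq_abs]
  have e' : nn (|f|) = nn f := e
  rw [e'] at h
  refine le_trans (le_of_eq ?_) h
  rw [← integral_indicator measurableSet_ball]
  congr 1; ext X
  by_cases h : X ∈ Metric.ball (0 : V4) r <;> simp [h]

theorem supp_int {f : V4 → ℝ} {r : ℝ} (hf : MemLp f 2) (hs : ∀ X, r ≤ ‖X‖ → f X = 0) :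
    Integrable f ∧ ∫ X, |f X| ≤ nn ((Metric.ball (0 : V4) r).indicator fun _ => (1 : ℝ)) * nn f := by
  have e : (Metric.ball (0 : V4) r).indicator f = f := by
    refine Set.indicator_eq_self.2 fun X hX => ?_
    by_contra h
    rw [Metric.mem_ball, dist_zero_right, not_lt] at h
    exact hX (hs X h)
  constructor
  · rw [← e, integrable_indicator_iff measurableSet_ball]
    have : IsFiniteMeasure (volume.restrict (Metric.ball (0 : V4) r)) :=
      ⟨by rw [Measure.restrict_apply_univ]; exact measure_ball_lt_top⟩
    exact (hf.restrict _).integrable (by norm_num)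
  · refine le_trans (le_of_eq ?_) (abs_int_le_nn hf)
    rw [← integral_indicator measurableSet_ball]
    congr 1; ext X
    by_cases h : X ∈ Metric.ball (0 : V4) r
    · simp only [h, Set.indicator_of_mem]
    · rw [Set.indicator_of_notMem h]
      rw [Metric.mem_ball, dist_zero_right, not_lt] at h
      rw [hs X h, abs_zero]

theorem cpt_lem {f g : ℕ → V4 → ℝ} {K r : ℝ} (hf : ∀ n, MemLp (f n) 2) (hg : ∀ n, MemLp (g n) 2)
    (hfK : ∀ n, nn (f n) ≤ K) (hgK : ∀ n, nn (g n) ≤ K) (hs : ∀ n X, r ≤ ‖X‖ → f n X = 0)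
    (hw : ∀ v, MemLp v 2 → Tendsto (fun n => ∫ X, f n X * v X) atTop (nhds 0)) :
    Tendsto (fun n => BB kk (f n) (g n)) atTop (nhds 0) := by
  have hK : 0 ≤ K := (nn_nonneg _).trans (hfK 0)
  rw [Metric.tendsto_atTop']
  intro ε hε
  obtain ⟨κ, R, c, hR, hc0, hκm, hκc, hκs, hκn, hκi, hκi', hκη⟩ := kk_split (η := ε / (2 * (K ^ 2 + 1))) (by positivity)
  set v : ℕ → V4 → ℝ := fun n X => ∫ Y, κ (X - Y) * f n Y with hv
  set A := nn ((Metric.ball (0 : V4) r).indicator fun _ => (1 : ℝ)) with hA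
  have hA0 : 0 ≤ A := nn_nonneg _
  have hvb : ∀ n X, |v n X| ≤ c * (A * K) := by
    intro n X
    refine (conv_bd hκc (supp_int (hf n) (hs n)).1 X).trans ?_
    have := (supp_int (hf n) (hs n)).2
    gcongr
    exact this.trans (mul_le_mul_of_nonneg_left (hfK n) hA0)
  have hvs : ∀ n X, r + R ≤ ‖X‖ → v n X = 0 := fun n X hX => conv_supp hκs (hs n) X hX
  have hvm : ∀ n, AEStronglyMeasurable (v n) := fun n => conv_meas hκm (hf n).1
  have hvL : ∀ n, MemLp (v n) 2 := fun n => bdd_memLp (hvm n) (hvb n) (hvs n)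
  have hv0 : ∀ X, Tendsto (fun n => v n X) atTop (nhds 0) := by
    intro X
    have hkX : MemLp (fun Y => κ (X - Y)) 2 := by
      refine bdd_memLp (c := c) (r := ‖X‖ + R) ?_ (fun Y => hκc _) fun Y hY => hκs _ ?_
      · exact (hκm.comp (measurable_const.sub measurable_id)).aestronglyMeasurable
      · have := norm_sub_norm_le Y X
        rw [norm_sub_rev]; linarith
    refine (hw _ hkX).congr fun n => ?_
    simp only [hv]; congr 1; ext Y; ring
  have hq : Tendsto (fun n => qq (v n)) atTop (nhds 0) := by
    have : Tendsto (fun n => ∫ X, v n X ^ 2) atTop (nhds (∫ _ : V4, (0 : ℝ))) := by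
      refine tendsto_integral_of_dominated_convergence
        ((Metric.ball (0 : V4) (r + R)).indicator fun _ => (c * (A * K)) ^ 2) (fun n => (hvm n).pow 2) ?_ ?_ ?_
      · exact (integrable_indicator_iff measurableSet_ball).2 (integrableOn_const (by exact measure_ball_lt_top.ne))
      · intro n
        refine Eventually.of_forall fun X => ?_
        by_cases h : X ∈ Metric.ball (0 : V4) (r + R)
        · rw [Set.indicator_of_mem h, Real.norm_of_nonneg (sq_nonneg _), ← sq_abs]
          have := hvb n X
          gcongr
        · rw [Metric.mem_ball, dist_zero_right, not_lt] at h
          rw [hvs n X h]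
          simp [h]
      · exact Eventually.of_forall fun X => by
          have h2 := (hv0 X).pow 2
          rw [zero_pow two_ne_zero] at h2
          exact h2
    simpa [qq] using this
  have hnv : Tendsto (fun n => nn (v n)) atTop (nhds 0) := by
    have := hq.sqrt
    simpa [nn] using this
  have hpos : 0 < ε / (2 * (K + 1)) := by positivity
  obtain ⟨N, hN⟩ := (eventually_atTop.1 (hnv.eventually (gt_mem_nhds hpos)))
  refine ⟨N, fun n hn => ?_⟩
  rw [dist_zero_right, Real.norm_eq_abs]
  have h1 := BB_split hκi hκi' hκη (hf n) (hg n)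
  have h2 : BB κ (f n) (g n) = ∫ X, g n X * v n X := by
    rw [BB_comm hκn, BB_eq hκi (hg n) (hf n)]
  have h3 : |BB κ (f n) (g n)| ≤ K * (ε / (2 * (K + 1))) := by
    rw [h2]
    refine (cs_int (hg n) (hvL n)).trans ?_
    have := hgK n
    have := (hN n hn.le).le
    have := nn_nonneg (v n)
    gcongr
  have h4 : ε / (2 * (K ^ 2 + 1)) * (nn (f n) * nn (g n)) ≤ ε / (2 * (K ^ 2 + 1)) * (K * K) := by
    have := hgK n
    have := hfK n
    have := nn_nonneg (f n)
    have := nn_nonneg (g n)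
    gcongr
  have h5 : K * (ε / (2 * (K + 1))) < ε / 2 := by
    rw [mul_div_assoc', div_lt_div_iff₀ (by positivity) (by positivity)]; nlinarith
  have h6 : ε / (2 * (K ^ 2 + 1)) * (K * K) < ε / 2 := by
    rw [div_mul_eq_mul_div, div_lt_div_iff₀ (by positivity) (by positivity)]; nlinarith
  linarith

theorem nn_tail {w : V4 → ℝ} (hw : MemLp w 2) :
    Tendsto (fun k : ℕ => nn ((Metric.ball (0 : V4) k)ᶜ.indicator w)) atTop (nhds 0) := by
  have h : Tendsto (fun k : ℕ => ∫ X, ((Metric.ball (0 : V4) k)ᶜ.indicator w X) ^ 2) atTop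
      (nhds (∫ _ : V4, (0 : ℝ))) := by
    refine tendsto_integral_of_dominated_convergence (fun X => w X ^ 2)
      (fun n => (hw.1.indicator measurableSet_ball.compl).pow 2) hw.integrable_sq ?_ ?_
    · intro n
      refine Eventually.of_forall fun X => ?_
      by_cases h : X ∈ Metric.ball (0 : V4) n <;> simp [h, sq_nonneg]
    · refine Eventually.of_forall fun X => tendsto_const_nhds.congr' ?_
      filter_upwards [(tendsto_natCast_atTop_atTop (R := ℝ)).eventually (eventually_gt_atTop ‖X‖)] with n hn
      simp [hn]
  have := h.sqrt
  simpa [nn, qq] using this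

theorem ball_mono_tendsto {w : V4 → ℝ} (hw : Integrable w) :
    Tendsto (fun k : ℕ => ∫ X in Metric.ball (0 : V4) k, w X) atTop (nhds (∫ X, w X)) :=
  (aecover_ball tendsto_natCast_atTop_atTop).integral_tendsto_of_countably_generated hw

theorem wk_lem {w : V4 → ℝ} {h : ℕ → V4 → ℝ} {K : ℝ} (hw : MemLp w 2) (hh : ∀ n, MemLp (h n) 2)
    (hK : ∀ n, nn (h n) ≤ K) (hwk : ∀ v, MemLp v 2 → Tendsto (fun n => ∫ X, h n X * v X) atTop (nhds 0)) :
    Tendsto (fun n => BB kk w (h n)) atTop (nhds 0) := by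
  have hK0 : 0 ≤ K := (nn_nonneg _).trans (hK 0)
  rw [Metric.tendsto_atTop']
  intro ε hε
  obtain ⟨k, hk⟩ := ((nn_tail hw).eventually (gt_mem_nhds (show 0 < ε / (3 * (K + 1)) by positivity))).exists
  set B := Metric.ball (0 : V4) (k : ℝ) with hB
  have hwB : MemLp (B.indicator w) 2 := hw.indicator measurableSet_ball
  have hwC : MemLp (Bᶜ.indicator w) 2 := hw.indicator measurableSet_ball.compl
  obtain ⟨κ, R, c, hR, hc0, hκm, hκc, hκs, hκn, hκi, hκi', hκη⟩ :=
    kk_split (η := ε / (3 * (nn w * K + 1))) (by have := nn_nonneg w; positivity)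
  have hs : ∀ X, (k : ℝ) ≤ ‖X‖ → B.indicator w X = 0 := fun X hX => by simp [hB, hX]
  set v : V4 → ℝ := fun X => ∫ Y, κ (X - Y) * B.indicator w Y with hv
  have hvL : MemLp v 2 := bdd_memLp (conv_meas hκm hwB.1) (conv_bd hκc (supp_int hwB hs).1)
    (conv_supp hκs hs)
  obtain ⟨N, hN⟩ := Metric.tendsto_atTop'.1 (hwk v hvL) (ε / 3) (by positivity)
  refine ⟨N, fun n hn => ?_⟩
  have := hN n hn
  rw [dist_zero_right, Real.norm_eq_abs] at this ⊢
  have e1 : BB kk w (h n) = BB kk (B.indicator w) (h n) + BB kk (Bᶜ.indicator w) (h n) := by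
    rw [← BB_add_left kk_integrable hwB hwC (hh n)]
    congr 1; ext X
    by_cases hX : X ∈ B <;> simp [hX]
  have e2 := BB_split hκi hκi' hκη hwB (hh n)
  have e3 : BB κ (B.indicator w) (h n) = ∫ X, h n X * v X := by
    rw [BB_comm hκn, BB_eq hκi (hh n) hwB]
  have e4 := BB_bound kk_integrable hwC (hh n)
  rw [kk_abs, one_mul] at e4
  rw [e3] at e2
  have e5 : ε / (3 * (nn w * K + 1)) * (nn (B.indicator w) * nn (h n)) ≤
      ε / (3 * (nn w * K + 1)) * (nn w * K) := by
    have := hK n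
    have := nn_ind_le hw (s := B)
    have := nn_nonneg (h n)
    have := nn_nonneg w
    gcongr
  have e6 : ε / (3 * (nn w * K + 1)) * (nn w * K) < ε / 3 := by
    have := mul_nonneg (nn_nonneg w) hK0
    rw [div_mul_eq_mul_div, div_lt_div_iff₀ (by positivity) (by positivity)]; nlinarith
  have e7 : nn (Bᶜ.indicator w) * nn (h n) ≤ ε / (3 * (K + 1)) * K := by
    have := hK n
    have := nn_nonneg (h n)
    gcongr
  have e8 : ε / (3 * (K + 1)) * K < ε / 3 := by
    rw [div_mul_eq_mul_div, div_lt_div_iff₀ (by positivity) (by positivity)]; nlinarith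
  have e9 := abs_add_le (BB kk (B.indicator w) (h n)) (BB kk (Bᶜ.indicator w) (h n))
  rw [e1]
  linarith

end

section
theorem BB_sq_add {f g : V4 → ℝ} (hf : MemLp f 2) (hg : MemLp g 2) :
    BB kk (fun X => f X + g X) (fun X => f X + g X) = BB kk f f + 2 * BB kk f g + BB kk g g := by
  have hfg : MemLp (fun X => f X + g X) 2 := hf.add hg
  rw [BB_add_left kk_integrable hf hg hfg, BB_add_right kk_integrable hf hf hg,
    BB_add_right kk_integrable hg hf hg, BB_comm (f := g) (g := f) kk_neg]
  ring

theorem qq_add {f g : V4 → ℝ} (hf : MemLp f 2) (hg : MemLp g 2) :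
    qq (fun X => f X + g X) = qq f + 2 * (∫ X, f X * g X) + qq g := by
  unfold qq
  have h1 : Integrable (fun X => f X * g X) := hf.integrable_mul hg
  have h2 : Integrable (fun X => f X ^ 2 + 2 * (f X * g X)) := hf.integrable_sq.add (h1.const_mul 2)
  rw [← integral_const_mul, ← integral_add hf.integrable_sq (h1.const_mul 2),
    ← integral_add h2 hg.integrable_sq]
  congr 1; ext X; ring

theorem qq_ind_add {f : V4 → ℝ} (hf : MemLp f 2) {s : Set V4} (hs : MeasurableSet s) :
    qq f = qq (s.indicator f) + qq (sᶜ.indicator f) := by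
  unfold qq
  rw [← integral_add (hf.indicator hs).integrable_sq (hf.indicator hs.compl).integrable_sq]
  congr 1; ext X
  by_cases h : X ∈ s <;> simp [h]

theorem qq_neg1 (f : V4 → ℝ) : qq (fun X => (-1) * f X) = qq f := by rw [qq_smul]; ring

theorem energy_split {lam : ℝ} (hl : 1 < lam) {v w : V4 → ℝ} (hv : Gd v) (hw : Gd w) {s : Set V4}
    (hs : MeasurableSet s) :
    FF lam v ≤ FF lam w + (BB kk w (fun X => v X - w X) - (∫ X, (v X - w X) * w X) / lam) +
      (BB kk (s.indicator fun X => v X - w X) (fun X => v X - w X) +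
        BB kk (s.indicator fun X => v X - w X) (sᶜ.indicator fun X => v X - w X)) / 2
      - qq (s.indicator fun X => v X - w X) / (2 * lam) + FF lam (sᶜ.indicator v)
      + (nn (sᶜ.indicator w) ^ 2 / 2 + nn (sᶜ.indicator v) * nn (sᶜ.indicator w)) := by
  set h : V4 → ℝ := fun X => v X - w X with hh
  have hh2 : MemLp h 2 := hv.i2.sub hw.i2
  set f := s.indicator h with hf
  set p := sᶜ.indicator h with hp
  set b := sᶜ.indicator v with hb
  set c := sᶜ.indicator w with hc
  have hf2 : MemLp f 2 := hh2.indicator hs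
  have hp2 : MemLp p 2 := hh2.indicator hs.compl
  have hbG : Gd b := hv.ind hs.compl
  have hcG : Gd c := hw.ind hs.compl
  have e1 : v = fun X => w X + h X := by ext X; simp [hh]
  have e2 : h = fun X => f X + p X := by
    ext X; by_cases hX : X ∈ s <;> simp [hf, hp, hX]
  have e3 : p = fun X => b X + (-1) * c X := by
    ext X; by_cases hX : X ∈ s <;> simp [hp, hb, hc, hX, hh]; ring
  have hc2 : MemLp (fun X => (-1) * c X) 2 := hcG.i2.const_mul (-1)
  have B1 : BB kk v v = BB kk w w + 2 * BB kk w h + BB kk h h := by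
    rw [e1]; exact BB_sq_add hw.i2 hh2
  have B2 : BB kk h h = BB kk f h + BB kk f p + BB kk p p := by
    have a1 : BB kk h h = BB kk f h + BB kk p h := by
      conv_lhs => arg 2; rw [e2]
      rw [BB_add_left kk_integrable hf2 hp2 hh2]
    have a2 : BB kk p h = BB kk p f + BB kk p p := by
      conv_lhs => arg 3; rw [e2]
      rw [BB_add_right kk_integrable hp2 hf2 hp2]
    rw [a1, a2, BB_comm (f := p) (g := f) kk_neg]; ring
  have B3 : BB kk p p = BB kk b b - 2 * BB kk b c + BB kk c c := by
    conv_lhs => rw [e3]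
    rw [BB_sq_add hbG.i2 hc2, BB_smul_right, BB_smul_left, BB_smul_right]; ring
  have B4 : 0 ≤ BB kk b c := BB_nonneg kk_nonneg hbG.pos hcG.pos
  have B5 : BB kk c c ≤ nn c ^ 2 := by
    have := (le_abs_self _).trans (BB_bound kk_integrable hcG.i2 hcG.i2)
    rw [kk_abs] at this; linarith
  have Q1 : qq v = qq w + 2 * (∫ X, h X * w X) + qq h := by
    conv_lhs => rw [e1]
    rw [qq_add hw.i2 hh2]
    simp only [mul_comm]
  have Q2 : qq h = qq f + qq p := qq_ind_add hh2 hs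
  have Q3 : qq p = qq b - 2 * (∫ X, b X * c X) + qq c := by
    conv_lhs => rw [e3]
    rw [qq_add hbG.i2 hc2, qq_neg1]
    have : (∫ X, b X * ((-1) * c X)) = - ∫ X, b X * c X := by
      rw [← integral_neg]; congr 1; ext X; ring
    rw [this]; ring
  have Q4 := (le_abs_self _).trans (cs_int hbG.i2 hcG.i2)
  have Q5 := qq_nonneg c
  have Q6 : qq b - 2 * (nn b * nn c) ≤ qq p := by linarith
  unfold FF
  rw [B1, B2, B3, Q1, Q2]
  have l0 : 0 < lam := by linarith
  have key : -(qq p / (2 * lam)) ≤ -(qq b / (2 * lam)) + nn b * nn c := by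
    have hbc : 0 ≤ nn b * nn c := mul_nonneg (nn_nonneg _) (nn_nonneg _)
    have : (qq b - 2 * (nn b * nn c)) / (2 * lam) ≤ qq p / (2 * lam) := by gcongr
    have t : (qq b - 2 * (nn b * nn c)) / (2 * lam) = qq b / (2 * lam) - nn b * nn c / lam := by
      field_simp
    have t2 : nn b * nn c / lam ≤ nn b * nn c := div_le_self hbc hl.le
    linarith
  have t3 : (qq w + 2 * (∫ X, h X * w X) + (qq f + qq p)) / (2 * lam) =
    qq w / (2 * lam) + (∫ X, h X * w X) / lam + qq f / (2 * lam) + qq p / (2 * lam) := by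
      field_simp; ring
  rw [t3]
  linarith

theorem L1_lem {α : Type*} [MeasurableSpace α] {μ : Measure α} {f g : α → ℝ} (hf : Integrable f μ)
    (hg : Integrable g μ) (hf0 : ∀ᵐ x ∂μ, 0 ≤ f x) (hg0 : ∀ᵐ x ∂μ, 0 ≤ g x) {s : Set α} (hs : MeasurableSet s) :
    ∫ x, |f x - g x| ∂μ ≤ 2 * (∫ x in s, |f x - g x| ∂μ) + ((∫ x, f x ∂μ) - ∫ x, g x ∂μ) +
      2 * ∫ x in sᶜ, g x ∂μ := by
  have hi : Integrable (fun x => |f x - g x|) μ := (hf.sub hg).abs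
  have j1 : Integrable (fun x => 2 * s.indicator (fun x => |f x - g x|) x) μ := (hi.indicator hs).const_mul 2
  have j2 : Integrable (fun x => f x - g x) μ := hf.sub hg
  have j3 : Integrable (fun x => 2 * sᶜ.indicator g x) μ := (hg.indicator hs.compl).const_mul 2
  have j4 : Integrable (fun x => 2 * s.indicator (fun x => |f x - g x|) x + (f x - g x)) μ := j1.add j2
  rw [← integral_indicator hs, ← integral_indicator hs.compl, ← integral_const_mul, ← integral_const_mul,
    ← integral_sub hf hg, ← integral_add j1 j2, ← integral_add j4 j3]
  refine integral_mono_ae hi (j4.add j3) ?_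
  filter_upwards [hf0, hg0] with x h1 h2
  by_cases hx : x ∈ s
  · simp only [hx, Set.indicator_of_mem, Set.mem_compl_iff, not_true_eq_false, not_false_eq_true,
      Set.indicator_of_notMem, mul_zero, add_zero]
    have := neg_abs_le (f x - g x)
    linarith
  · simp only [hx, Set.indicator_of_mem, Set.mem_compl_iff, not_false_eq_true,
      Set.indicator_of_notMem, mul_zero, zero_add]
    rw [abs_le]; constructor <;> linarith

theorem qq_sub_le {f g : V4 → ℝ} (hf : MemLp f 2) (hg : MemLp g 2) :
    qq (fun X => f X - g X) ≤ 2 * qq f + 2 * qq g := by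
  unfold qq
  rw [← integral_const_mul, ← integral_const_mul, ← integral_add (hf.integrable_sq.const_mul 2)
    (hg.integrable_sq.const_mul 2)]
  refine integral_mono_of_nonneg (Eventually.of_forall fun _ => sq_nonneg _)
    ((hf.integrable_sq.const_mul 2).add (hg.integrable_sq.const_mul 2)) (Eventually.of_forall fun X => ?_)
  simp only
  nlinarith [sq_nonneg (f X + g X)]

theorem weak_limit {v : ℕ → V4 → ℝ} (hv : ∀ n, Gd (v n)) {K M : ℝ} (hK : ∀ n, qq (v n) ≤ K)
    (hM : Tendsto (fun n => ∫ X, v n X) atTop (nhds M)) :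
    ∃ φ : ℕ → ℕ, StrictMono φ ∧ ∃ w, Gd w ∧ (∀ g, MemLp g 2 →
      Tendsto (fun n => ∫ X, v (φ n) X * g X) atTop (nhds (∫ X, w X * g X))) ∧
      (∀ r : ℝ, Tendsto (fun n => ∫ X in Metric.ball (0 : V4) r, v (φ n) X) atTop
        (nhds (∫ X in Metric.ball (0 : V4) r, w X))) ∧ ∫ X, w X ≤ M := by
  obtain ⟨φ, hφ, w0, hw0, hwk⟩ := weak_seq (fun n => (hv n).i2) hK
  have hset : ∀ s : Set V4, MeasurableSet s → volume s < ⊤ → Tendsto (fun n => ∫ X in s, v (φ n) X) atTop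
      (nhds (∫ X in s, w0 X)) := by
    intro s hs hs'
    have h1 : MemLp (s.indicator fun _ => (1 : ℝ)) 2 :=
      memLp_indicator_const 2 hs 1 (Or.inr hs'.ne)
    have e : ∀ f : V4 → ℝ, ∫ X, f X * s.indicator (fun _ => (1 : ℝ)) X = ∫ X in s, f X := by
      intro f
      rw [← integral_indicator hs]; congr 1; ext X
      by_cases h : X ∈ s <;> simp [h]
    have := hwk _ h1
    simp only [e] at this
    exact this
  have hfin : ∀ s : Set V4, MeasurableSet s → volume s < ⊤ → IntegrableOn w0 s := by
    intro s _ hs'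
    have : IsFiniteMeasure (volume.restrict s) := ⟨by rw [Measure.restrict_apply_univ]; exact hs'⟩
    exact (hw0.restrict s).integrable (by norm_num)
  have hpos : 0 ≤ᵐ[volume] w0 := by
    refine ae_nonneg_of_forall_setIntegral_nonneg_of_sigmaFinite hfin fun s hs hs' => ?_
    exact ge_of_tendsto' (hset s hs hs') fun n => integral_nonneg (hv _).pos
  set w : V4 → ℝ := fun X => max (w0 X) 0 with hw
  have hww : w =ᵐ[volume] w0 := by
    filter_upwards [hpos] with X hX
    exact max_eq_left hX
  have hle : ∀ r : ℝ, ∫ X in Metric.ball (0 : V4) r, w0 X ≤ M := by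
    intro r
    refine le_of_tendsto_of_tendsto' (hset _ measurableSet_ball measure_ball_lt_top)
      (hM.comp hφ.tendsto_atTop) fun n => ?_
    exact setIntegral_le_integral (hv _).i1 (Eventually.of_forall (hv _).pos)
  have hint0 : Integrable w0 := by
    refine (aecover_ball (x := (0 : V4)) (r := fun n : ℕ => (n : ℝ))
      tendsto_natCast_atTop_atTop).integrable_of_integral_bounded_of_nonneg_ae M
      (fun n => hfin _ measurableSet_ball measure_ball_lt_top) hpos (Eventually.of_forall fun n => hle n)
  refine ⟨φ, hφ, w, ⟨fun X => le_max_right _ _, hint0.congr hww.symm, (memLp_congr_ae hww).2 hw0⟩, ?_, ?_, ?_⟩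
  · intro g hg
    have : ∫ X, w X * g X = ∫ X, w0 X * g X :=
      integral_congr_ae (by filter_upwards [hww] with X hX; rw [hX])
    rw [this]; exact hwk g hg
  · intro r
    rw [setIntegral_congr_ae₀ (g := w0) measurableSet_ball.nullMeasurableSet
      (by filter_upwards [hww] with X hX _; rw [hX])]
    exact hset _ measurableSet_ball measure_ball_lt_top
  · rw [integral_congr_ae hww]
    exact le_of_tendsto' (ball_mono_tendsto hint0) fun n => hle n

theorem ind_compl_int {v : V4 → ℝ} (hv : Integrable v) (r : ℝ) :
    ∫ X, (Metric.ball (0 : V4) r)ᶜ.indicator v X = (∫ X, v X) - ∫ X in Metric.ball (0 : V4) r, v X := by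
  rw [integral_indicator measurableSet_ball.compl, ← integral_add_compl measurableSet_ball hv]; ring

theorem compactness {lam : ℝ} (hl : 1 < lam) {M β R : ℝ} (hM : 0 < M) (hβ : 0 < β) {u : ℕ → V4 → ℝ}
    (hu : ∀ n, Gd (u n)) (h1 : Tendsto (fun n => ∫ X, u n X) atTop (nhds M))
    (h2 : Tendsto (fun n => FF lam (u n)) atTop (nhds (CC lam * M ^ 2)))
    (h3 : ∀ n, β ≤ ∫ X in Metric.ball (0 : V4) R, u n X) :
    ∃ φ : ℕ → ℕ, StrictMono φ ∧ ∃ w, Gd w ∧ ∫ X, w X = M ∧ FF lam w = CC lam * M ^ 2 ∧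
      Tendsto (fun n => qq (fun X => u (φ n) X - w X)) atTop (nhds 0) ∧
      Tendsto (fun n => ∫ X, |u (φ n) X - w X|) atTop (nhds 0) := by
  have l0 : 0 < lam := by linarith
  have hC := CC_pos hl
  obtain ⟨κ, hκ, hstar⟩ := FF_le_star hl
  have hbd : Tendsto (fun n => 4 * lam * (κ * (∫ X, u n X) ^ 2 - FF lam (u n))) atTop
      (nhds (4 * lam * (κ * M ^ 2 - CC lam * M ^ 2))) :=
    (((h1.pow 2).const_mul κ).sub h2).const_mul _
  obtain ⟨K0, hK0⟩ := hbd.bddAbove_range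
  have hqK : ∀ n, qq (u n) ≤ K0 := by
    intro n
    refine le_trans ?_ (hK0 ⟨n, rfl⟩)
    have := hstar _ (hu n)
    have e : -qq (u n) / (4 * lam) = - (qq (u n) / (4 * lam)) := by ring
    rw [e] at this
    have h4 : qq (u n) / (4 * lam) ≤ κ * (∫ X, u n X) ^ 2 - FF lam (u n) := by linarith
    rw [div_le_iff₀ (by positivity)] at h4
    linarith
  obtain ⟨φ, hφ, w, hw, hwk, hball, hmM⟩ := weak_limit hu hqK h1
  set v : ℕ → V4 → ℝ := fun n => u (φ n) with hvdef
  have hv : ∀ n, Gd (v n) := fun n => hu _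
  have hvM : Tendsto (fun n => ∫ X, v n X) atTop (nhds M) := h1.comp hφ.tendsto_atTop
  have hvF : Tendsto (fun n => FF lam (v n)) atTop (nhds (CC lam * M ^ 2)) := h2.comp hφ.tendsto_atTop
  have hm0 : 0 < ∫ X, w X := by
    refine lt_of_lt_of_le hβ ?_
    refine (ge_of_tendsto' (hball R) fun n => h3 _).trans ?_
    exact setIntegral_le_integral hw.i1 (Eventually.of_forall hw.pos)
  set m := ∫ X, w X with hm
  -- the difference
  set h : ℕ → V4 → ℝ := fun n X => v n X - w X with hh
  have hh2 : ∀ n, MemLp (h n) 2 := fun n => (hv n).i2.sub hw.i2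
  set K := Real.sqrt (2 * K0 + 2 * qq w) with hK
  have hhK : ∀ n, nn (h n) ≤ K := fun n => Real.sqrt_le_sqrt
    ((qq_sub_le (hv n).i2 hw.i2).trans (by have := hqK (φ n); linarith))
  have hvK : ∀ n, nn (v n) ≤ K := fun n => Real.sqrt_le_sqrt (by
    have := hqK (φ n); have := qq_nonneg w; have := qq_nonneg (v n)
    have : qq (v n) ≤ K0 := hqK (φ n)
    linarith)
  have hhw : ∀ g, MemLp g 2 → Tendsto (fun n => ∫ X, h n X * g X) atTop (nhds 0) := by
    intro g hg
    have e : ∀ n, ∫ X, h n X * g X = (∫ X, v n X * g X) - ∫ X, w X * g X := by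
      intro n
      have j1 : Integrable (fun X => v n X * g X) := (hv n).i2.integrable_mul hg
      have j2 : Integrable (fun X => w X * g X) := hw.i2.integrable_mul hg
      rw [← integral_sub j1 j2]
      congr 1; ext X; simp only [hh]; ring
    simp only [e]
    have := (hwk g hg).sub_const (∫ X, w X * g X)
    rwa [sub_self] at this
  let B : ℕ → Set V4 := fun k => Metric.ball (0 : V4) k
  have hBm : ∀ k, MeasurableSet (B k) := fun k => measurableSet_ball
  have hfw : ∀ k g, MemLp g 2 → Tendsto (fun n => ∫ X, (B k).indicator (h n) X * g X) atTop (nhds 0) := by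
    intro k g hg
    refine (hhw _ (hg.indicator (hBm k))).congr fun n => ?_
    congr 1; ext X
    by_cases hX : X ∈ B k <;> simp [hX]
  set E : ℕ → ℕ → ℝ := fun k n => (BB kk w (h n) - (∫ X, h n X * w X) / lam) +
      (BB kk ((B k).indicator (h n)) (h n) + BB kk ((B k).indicator (h n)) ((B k)ᶜ.indicator (h n))) / 2 with hE
  have hE0 : ∀ k, Tendsto (E k) atTop (nhds 0) := by
    intro k
    have a1 := wk_lem hw.i2 hh2 hhK hhw
    have a2 := (hhw w hw.i2).div_const lam
    have hs : ∀ n X, (k : ℝ) ≤ ‖X‖ → (B k).indicator (h n) X = 0 := by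
      intro n X hX; simp [B, hX]
    have a3 := cpt_lem (fun n => (hh2 n).indicator (hBm k)) hh2 (fun n => (nn_ind_le (hh2 n)).trans (hhK n)) hhK
      hs (hfw k)
    have a4 := cpt_lem (fun n => (hh2 n).indicator (hBm k)) (fun n => (hh2 n).indicator (hBm k).compl)
      (fun n => (nn_ind_le (hh2 n)).trans (hhK n)) (fun n => (nn_ind_le (hh2 n)).trans (hhK n))
      hs (hfw k)
    have := (a1.sub a2).add ((a3.add a4).div_const 2)
    simpa [hE] using this
  set c : ℕ → ℝ := fun k => nn ((B k)ᶜ.indicator w) with hc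
  have hc0 : Tendsto c atTop (nhds 0) := nn_tail hw.i2
  have hcn : ∀ k, 0 ≤ c k := fun k => nn_nonneg _
  have hsplit : ∀ k n, FF lam (v n) ≤ FF lam w + E k n - qq ((B k).indicator (h n)) / (2 * lam) +
      FF lam ((B k)ᶜ.indicator (v n)) + (c k ^ 2 / 2 + K * c k) := by
    intro k n
    have a := energy_split hl (hv n) hw (hBm k)
    have b1 : nn ((B k)ᶜ.indicator (v n)) * nn ((B k)ᶜ.indicator w) ≤ K * c k := by
      have := (nn_ind_le (hv n).i2 (s := (B k)ᶜ)).trans (hvK n)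
      have := hcn k
      gcongr
    simp only [hE, hc] at *
    linarith
  set mk : ℕ → ℝ := fun k => ∫ X in B k, w X with hmk
  have hmk : Tendsto mk atTop (nhds m) := ball_mono_tendsto hw.i1
  have hb : ∀ k, Tendsto (fun n => ∫ X, (B k)ᶜ.indicator (v n) X) atTop (nhds (M - mk k)) := by
    intro k
    refine (hvM.sub (hball k)).congr fun n => ?_
    exact (ind_compl_int (hv n).i1 k).symm
  -- first use
  have step1 : ∀ k, CC lam * M ^ 2 ≤ FF lam w + CC lam * (M - mk k) ^ 2 + (c k ^ 2 / 2 + K * c k) := by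
    intro k
    have t : Tendsto (fun n => FF lam w + E k n + CC lam * (∫ X, (B k)ᶜ.indicator (v n) X) ^ 2 +
      (c k ^ 2 / 2 + K * c k)) atTop (nhds (FF lam w + 0 + CC lam * (M - mk k) ^ 2 + (c k ^ 2 / 2 + K * c k))) :=
      (((hE0 k).const_add _).add (((hb k).pow 2).const_mul _)).add_const _
    rw [add_zero] at t
    refine le_of_tendsto_of_tendsto' hvF t fun n => ?_
    have a1 := hsplit k n
    have a2 := FF_le_CC hl ((hv n).ind (hBm k).compl)
    have a3 : 0 ≤ qq ((B k).indicator (h n)) / (2 * lam) := div_nonneg (qq_nonneg _) (by linarith)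
    linarith
  have step2 : CC lam * M ^ 2 ≤ FF lam w + CC lam * (M - m) ^ 2 := by
    have t : Tendsto (fun k => FF lam w + CC lam * (M - mk k) ^ 2 + (c k ^ 2 / 2 + K * c k)) atTop
      (nhds (FF lam w + CC lam * (M - m) ^ 2 + (0 ^ 2 / 2 + K * 0))) :=
      ((((hmk.const_sub M).pow 2).const_mul _).const_add _).add (((hc0.pow 2).div_const 2).add (hc0.const_mul K))
    have := ge_of_tendsto' t step1
    simpa using this
  have step3 := FF_le_CC hl hw
  have hmM' : m = M := by
    refine le_antisymm hmM ?_
    by_contra hlt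
    push Not at hlt
    rw [← hm] at step3
    have a : 0 ≤ CC lam * (m ^ 2 + (M - m) ^ 2 - M ^ 2) := by linarith
    have b : CC lam * (m ^ 2 + (M - m) ^ 2 - M ^ 2) = - (CC lam * (2 * m * (M - m))) := by ring
    have c : 0 < CC lam * (2 * m * (M - m)) := by
      have : 0 < M - m := by linarith
      positivity
    linarith
  have hFw : FF lam w = CC lam * M ^ 2 := by
    rw [hmM'] at step2
    rw [← hm, hmM'] at step3
    refine le_antisymm step3 ?_
    simpa using step2
  have hq0 : Tendsto (fun n => qq (h n)) atTop (nhds 0) := by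
    rw [Metric.tendsto_atTop']
    intro ε hε
    have t : Tendsto (fun k => 8 * lam * (κ * (M - mk k) ^ 2 + (c k ^ 2 / 2 + K * c k)) + 2 * c k ^ 2) atTop
      (nhds (8 * lam * (κ * (M - m) ^ 2 + (0 ^ 2 / 2 + K * 0)) + 2 * 0 ^ 2)) :=
      (((((hmk.const_sub M).pow 2).const_mul κ).add
        (((hc0.pow 2).div_const 2).add (hc0.const_mul K))).const_mul _).add ((hc0.pow 2).const_mul 2)
    rw [hmM'] at t
    have t0 : 8 * lam * (κ * (M - M) ^ 2 + (0 ^ 2 / 2 + K * 0)) + 2 * 0 ^ 2 < ε := by simpa using hε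
    obtain ⟨k, hk⟩ := (t.eventually (gt_mem_nhds t0)).exists
    have t2 : Tendsto (fun n => 8 * lam * (FF lam w - FF lam (v n) + E k n +
        κ * (∫ X, (B k)ᶜ.indicator (v n) X) ^ 2 + (c k ^ 2 / 2 + K * c k)) + 2 * c k ^ 2) atTop
        (nhds (8 * lam * (FF lam w - CC lam * M ^ 2 + 0 + κ * (M - mk k) ^ 2 + (c k ^ 2 / 2 + K * c k)) + 2 * c k ^ 2)) :=
      ((((((hvF.const_sub _).add (hE0 k)).add (((hb k).pow 2).const_mul κ)).add_const _).const_mul _).add_const _)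
    rw [hFw, sub_self, zero_add, zero_add] at t2
    obtain ⟨N, hN⟩ := eventually_atTop.1 (t2.eventually (gt_mem_nhds hk))
    refine ⟨N, fun n hn => ?_⟩
    rw [dist_zero_right, Real.norm_of_nonneg (qq_nonneg _)]
    refine lt_of_le_of_lt ?_ (hN n hn.le)
    have a1 := hsplit k n
    have a2 := hstar _ ((hv n).ind (hBm k).compl)
    have a3 := qq_ind_add (hh2 n) (hBm k)
    have a4 : qq ((B k)ᶜ.indicator (h n)) ≤ 2 * qq ((B k)ᶜ.indicator (v n)) + 2 * c k ^ 2 := by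
      have := qq_sub_le ((hv n).i2.indicator (hBm k).compl) (hw.i2.indicator (hBm k).compl)
      rw [hc]; simp only
      rw [nn_sq]
      refine le_trans (le_of_eq ?_) this
      congr 1; ext X
      by_cases hX : X ∈ B k <;> simp [hX, hh]
    have a5 : qq ((B k).indicator (h n)) / (2 * lam) + qq ((B k)ᶜ.indicator (v n)) / (4 * lam) ≤
      FF lam w - FF lam (v n) + E k n + κ * (∫ X, (B k)ᶜ.indicator (v n) X) ^ 2 + (c k ^ 2 / 2 + K * c k) := by
      have e : -qq ((B k)ᶜ.indicator (v n)) / (4 * lam) = - (qq ((B k)ᶜ.indicator (v n)) / (4 * lam)) := by ring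
      rw [e] at a2
      linarith
    have a6 : 4 * qq ((B k).indicator (h n)) + 2 * qq ((B k)ᶜ.indicator (v n)) ≤ 8 * lam *
      (FF lam w - FF lam (v n) + E k n + κ * (∫ X, (B k)ᶜ.indicator (v n) X) ^ 2 + (c k ^ 2 / 2 + K * c k)) := by
      calc _ = 8 * lam * (qq ((B k).indicator (h n)) / (2 * lam) + qq ((B k)ᶜ.indicator (v n)) / (4 * lam)) := by
            field_simp; ring
        _ ≤ _ := by gcongr
    rw [hFw] at a6
    have a7 := qq_nonneg ((B k).indicator (h n))
    rw [a3]
    linarith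
  refine ⟨φ, hφ, w, hw, hmM', hFw, hq0, ?_⟩
  have hn0 : Tendsto (fun n => nn (h n)) atTop (nhds 0) := by simpa [nn] using hq0.sqrt
  rw [Metric.tendsto_atTop']
  intro ε hε
  have t0 : 2 * (m - m) < ε := by simpa using hε
  obtain ⟨k, hk⟩ := (((hmk.const_sub m).const_mul 2).eventually (gt_mem_nhds t0)).exists
  set A := nn ((Metric.ball (0 : V4) (k : ℝ)).indicator fun _ => (1 : ℝ)) with hA
  have t2 : Tendsto (fun n => 2 * (A * nn (h n)) + ((∫ X, v n X) - m) + 2 * (m - mk k)) atTop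
    (nhds (2 * (A * 0) + (M - m) + 2 * (m - mk k))) :=
    (((hn0.const_mul A).const_mul 2).add (hvM.sub_const m)).add_const _
  rw [hmM', sub_self, mul_zero, mul_zero, zero_add, zero_add] at t2
  rw [hmM'] at hk
  obtain ⟨N, hN⟩ := eventually_atTop.1 (t2.eventually (gt_mem_nhds hk))
  refine ⟨N, fun n hn => ?_⟩
  rw [dist_zero_right, Real.norm_of_nonneg (integral_nonneg fun _ => abs_nonneg _)]
  refine lt_of_le_of_lt ?_ (hN n hn.le)
  have a1 := L1_lem (hv n).i1 hw.i1 (Eventually.of_forall (hv n).pos) (Eventually.of_forall hw.pos) (hBm k)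
  have a2 := abs_int_le_nn (r := k) (hh2 n)
  have a3 : ∫ X in (B k)ᶜ, w X = m - mk k := by
    rw [hm, ← integral_add_compl (hBm k) hw.i1]; simp only [mk]; ring
  rw [a3, ← hm, hmM'] at a1
  have a4 : ∫ X in B k, |v n X - w X| ≤ A * nn (h n) := a2
  linarith

end

section
structure Mx (lam M : ℝ) (w : V4 → ℝ) : Prop where
  gd : Gd w
  mass : ∫ X, w X = M
  mx : FF lam w = CC lam * M ^ 2

theorem exists_Mx {lam : ℝ} (hl : 1 < lam) {M : ℝ} (hM : 0 < M) : ∃ w, Mx lam M w := by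
  have hC := CC_pos hl
  suffices h : ∃ w, Mx lam 1 w by
    obtain ⟨w, hw⟩ := h
    refine ⟨fun X => M * w X, hw.gd.smul hM.le, ?_, ?_⟩
    · rw [integral_const_mul, hw.mass, mul_one]
    · rw [FF_smul, hw.mx]; ring
  have hne : {s | ∃ w, Gd w ∧ ∫ X, w X = 1 ∧ s = FF lam w}.Nonempty := by
    obtain ⟨w, hw, h1, h2⟩ := exists_pos hl
    exact ⟨_, fun X => (∫ X, w X)⁻¹ * w X, hw.smul (by positivity), by
      rw [integral_const_mul, inv_mul_cancel₀ h1.ne'], rfl⟩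
  obtain ⟨s, -, hs, hs'⟩ := exists_seq_tendsto_sSup hne (CC_bdd hl)
  choose w hw hw1 hwF using hs'
  change Tendsto s atTop (nhds (CC lam)) at hs
  obtain ⟨N, hN⟩ := eventually_atTop.1 (hs.eventually (lt_mem_nhds (show CC lam / 2 < CC lam by linarith)))
  obtain ⟨R, β, hR, hβ, hnv⟩ := nonvanish hl
  have hz : ∀ n, ∃ z : V4, β ≤ ∫ X in Metric.ball z R, w (n + N) X := by
    intro n
    obtain ⟨z, hz⟩ := hnv (w (n + N)) (hw _) (by rw [hw1]; norm_num) (by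
      rw [hw1, ← hwF]; have := hN (n + N) (by omega); linarith)
    exact ⟨z, by rw [hw1] at hz; linarith⟩
  choose z hz using hz
  have hsh : ∀ n, ∫ X in Metric.ball (0 : V4) R, w (n + N) (X + z n) = ∫ X in Metric.ball (z n) R, w (n + N) X := by
    intro n
    rw [← integral_indicator measurableSet_ball, ← integral_indicator measurableSet_ball,
      ← integral_add_right_eq_self ((Metric.ball (z n) R).indicator (w (n + N))) (z n)]
    congr 1; ext X
    by_cases h : X ∈ Metric.ball (0 : V4) R
    · have h' : X + z n ∈ Metric.ball (z n) R := by simpa using h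
      rw [Set.indicator_of_mem h, Set.indicator_of_mem h']
    · have h' : X + z n ∉ Metric.ball (z n) R := by simpa using h
      rw [Set.indicator_of_notMem h, Set.indicator_of_notMem h']
  obtain ⟨φ, hφ, w', hw', h1, h2, -, -⟩ := compactness hl one_pos hβ (u := fun n X => w (n + N) (X + z n))
    (fun n => (hw _).trans _)
    (by
      have : ∀ n, ∫ X, w (n + N) (X + z n) = 1 := fun n => by
        rw [integral_add_right_eq_self (w (n + N)) (z n), hw1]
      simp only [this]; exact tendsto_const_nhds)
    (by
      have : ∀ n, FF lam (fun X => w (n + N) (X + z n)) = s (n + N) := fun n => by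
        rw [FF_trans, ← hwF]
      simp only [this, one_pow, mul_one]
      exact hs.comp (tendsto_add_atTop_nat N))
    (fun n => by rw [hsh]; exact hz n)
  exact ⟨w', hw', h1, h2⟩

noncomputable def cv (w : V4 → ℝ) (X : V4) : ℝ := ∫ Y, kk (X - Y) * w Y

theorem cv_congr {w w' : V4 → ℝ} (h : w =ᵐ[volume] w') : cv w = cv w' := by
  ext X; unfold cv; refine integral_congr_ae ?_
  filter_upwards [h] with Y hY; rw [hY]

theorem cv_prodint {κ w : V4 → ℝ} (hκ : Integrable κ) (hw : Integrable w) :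
    Integrable (fun p : V4 × V4 => κ (p.1 - p.2) * w p.2) (volume.prod volume) :=
  ((pint2 hw hκ).1).congr (Eventually.of_forall fun p => by simp only; ring)

theorem cv_integrable {w : V4 → ℝ} (hw : Integrable w) : Integrable (cv w) :=
  (cv_prodint kk_integrable hw).integral_prod_left

theorem cv_integral {w : V4 → ℝ} (hw : Integrable w) : ∫ X, cv w X = ∫ X, w X := by
  have h := (pint2 hw kk_integrable).2
  rw [kk_integral, mul_one] at h
  rw [← h]
  unfold cv
  rw [show (∫ p : V4 × V4, w p.2 * kk (p.1 - p.2)) = ∫ p, w p.2 * kk (p.1 - p.2) ∂(volume.prod volume) from rfl,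
    integral_prod _ (pint2 hw kk_integrable).1]
  congr 1; ext X; congr 1; ext Y; ring

theorem cv_nonneg {w : V4 → ℝ} (hw : ∀ X, 0 ≤ w X) (X : V4) : 0 ≤ cv w X :=
  integral_nonneg fun Y => mul_nonneg (kk_nonneg _) (hw Y)

theorem FF_add {lam : ℝ} (hl : 1 < lam) {f g : V4 → ℝ} (hf : MemLp f 2) (hg : MemLp g 2) :
    FF lam (fun X => f X + g X) = FF lam f + (BB kk f g - (∫ X, f X * g X) / lam) + FF lam g := by
  unfold FF; rw [BB_sq_add hf hg, qq_add hf hg]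
  have : 0 < lam := by linarith
  field_simp; ring

theorem Mx.EL {lam M : ℝ} (hl : 1 < lam) {w : V4 → ℝ} (hw : Mx lam M w) :
    ∀ᵐ X, w X = lam * max (cv w X - 2 * CC lam * M) 0 := by
  have l0 : 0 < lam := by linarith
  have hG := hw.gd
  set W := 2 * CC lam * M with hW
  set g : V4 → ℝ := fun X => W - (cv w X - w X / lam) with hg
  have hcv := cv_integrable hG.i1
  have hgint : ∀ s : Set V4, MeasurableSet s → volume s < ⊤ → IntegrableOn g s := by
    intro s _ hs'
    exact (integrableOn_const hs'.ne).sub ((hcv.sub (hG.i1.div_const lam)).integrableOn)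
  have hg0 : 0 ≤ᵐ[volume] g := by
    refine ae_nonneg_of_forall_setIntegral_nonneg_of_sigmaFinite hgint fun s hs hs' => ?_
    set v : V4 → ℝ := s.indicator fun _ => 1 with hv
    have hvG : Gd v := ⟨fun X => Set.indicator_nonneg (fun _ _ => zero_le_one) X,
        (integrable_indicator_iff hs).2 (integrableOn_const hs'.ne),
        memLp_indicator_const 2 hs 1 (Or.inr hs'.ne)⟩
    set D := BB kk w v - (∫ X, w X * v X) / lam with hD
    set m := ∫ X, v X with hm
    have hq : ∀ t : ℝ, 0 < t → D - W * m ≤ t * (CC lam * m ^ 2 - FF lam v) := by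
      intro t ht
      have h1 := FF_le_CC hl (hG.add (hvG.smul ht.le))
      rw [FF_add hl hG.i2 (hvG.i2.const_mul t), BB_smul_right, FF_smul, hw.mx,
        integral_add hG.i1 (hvG.i1.const_mul t), integral_const_mul, hw.mass, ← hm] at h1
      have e : ∫ X, w X * (t * v X) = t * ∫ X, w X * v X := by
        rw [← integral_const_mul]; congr 1; ext X; ring
      rw [e] at h1
      have e2 : t * (D - W * m) ≤ t * (t * (CC lam * m ^ 2 - FF lam v)) := by
        rw [hD, hW]
        have : t * (BB kk w v - (∫ X, w X * v X) / lam) = t * BB kk w v - t * (∫ X, w X * v X) / lam := by ring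
        rw [mul_sub, this]
        nlinarith
      exact le_of_mul_le_mul_left e2 ht
    have hlim : Tendsto (fun t : ℝ => t * (CC lam * m ^ 2 - FF lam v)) (nhdsWithin 0 (Set.Ioi 0)) (nhds 0) := by
      have : Tendsto (fun t : ℝ => t * (CC lam * m ^ 2 - FF lam v)) (nhds 0) (nhds (0 * (CC lam * m ^ 2 - FF lam v))) :=
        tendsto_id.mul_const _
      rw [zero_mul] at this
      exact this.mono_left nhdsWithin_le_nhds
    have hfin : D - W * m ≤ 0 := by
      refine ge_of_tendsto hlim ?_
      filter_upwards [self_mem_nhdsWithin] with t ht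
      exact hq t ht
    have e1 : BB kk w v = ∫ X in s, cv w X := by
      rw [BB_comm kk_neg, BB_eq kk_integrable hvG.i2 hG.i2, ← integral_indicator hs]
      congr 1; ext X
      by_cases h : X ∈ s <;> simp [hv, h, cv]
    have e2 : ∫ X, w X * v X = ∫ X in s, w X := by
      rw [← integral_indicator hs]
      congr 1; ext X
      by_cases h : X ∈ s <;> simp [hv, h]
    have e3 : m = ∫ X in s, (1 : ℝ) := by rw [hm, hv, integral_indicator hs]
    have e4 : ∫ X in s, g X = W * (∫ X in s, (1 : ℝ)) - ((∫ X in s, cv w X) - (∫ X in s, w X) / lam) := by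
      have j1 : IntegrableOn (fun _ => W) s := integrableOn_const hs'.ne
      have j2 : IntegrableOn (fun X => cv w X - w X / lam) s := (hcv.sub (hG.i1.div_const lam)).integrableOn
      have j3 : IntegrableOn (fun X => w X / lam) s := (hG.i1.div_const lam).integrableOn
      rw [hg, integral_sub j1 j2, integral_sub hcv.integrableOn j3, integral_div]
      congr 1
      rw [← integral_const_mul]; simp
    rw [e4, ← e3, ← e1, ← e2]
    linarith
  have hcvw : Integrable (fun X => w X * cv w X) := by
    have : Integrable (fun p : V4 × V4 => w p.1 * w p.2 * kk (p.1 - p.2)) (volume.prod volume) :=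
      BB_int kk_integrable hG.i2 hG.i2
    refine this.integral_prod_left.congr (Eventually.of_forall fun X => ?_)
    simp only [cv]
    rw [← integral_const_mul]; congr 1; ext Y; ring
  have hwg : Integrable (fun X => w X * g X) := by
    have : Integrable (fun X => W * w X - (w X * cv w X - w X ^ 2 / lam)) :=
      (hG.i1.const_mul W).sub (hcvw.sub (hG.i2.integrable_sq.div_const lam))
    refine this.congr (Eventually.of_forall fun X => ?_)
    simp only [hg]; ring
  have hwg0 : ∫ X, w X * g X = 0 := by
    have j0 : Integrable (fun X => w X * cv w X - w X ^ 2 / lam) :=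
      (hcvw.sub (hG.i2.integrable_sq.div_const lam))
    have : ∫ X, w X * g X = ∫ X, (W * w X - (w X * cv w X - w X ^ 2 / lam)) := by
      congr 1; ext X; simp only [hg]; ring
    rw [this, integral_sub (hG.i1.const_mul W) j0, integral_sub hcvw (hG.i2.integrable_sq.div_const lam),
      integral_const_mul, hw.mass, integral_div]
    have hF := hw.mx
    unfold FF at hF
    rw [BB_eq kk_integrable hG.i2 hG.i2] at hF
    change (∫ X, w X * cv w X) / 2 - qq w / (2 * lam) = _ at hF
    change W * M - ((∫ X, w X * cv w X) - qq w / lam) = 0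
    have : qq w / (2 * lam) = qq w / lam / 2 := by field_simp
    rw [this] at hF
    rw [hW]
    linarith
  have hz : (fun X => w X * g X) =ᵐ[volume] 0 := by
    refine (integral_eq_zero_iff_of_nonneg_ae ?_ hwg).1 hwg0
    filter_upwards [hg0] with X hX
    exact mul_nonneg (hG.pos X) hX
  filter_upwards [hz, hg0] with X h1 h2
  simp only [Pi.zero_apply, hg] at h1 h2
  rcases mul_eq_zero.1 h1 with h | h
  · rw [h, zero_div] at h2
    rw [h, max_eq_right (by linarith), mul_zero]
  · have e : cv w X - W = w X / lam := by linarith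
    rw [e, max_eq_left (div_nonneg (hG.pos X) l0.le)]
    field_simp

theorem Mx.bdd {lam M : ℝ} (hl : 1 < lam) (hM : 0 < M) {w : V4 → ℝ} (hw : Mx lam M w) :
    ∃ c : ℝ, 0 ≤ c ∧ ∀ᵐ X, w X ≤ c := by
  have l0 : 0 < lam := by linarith
  have hG := hw.gd
  have hC := CC_pos hl
  obtain ⟨d, hd, hd'⟩ := ks_small (η := 1 / (2 * lam)) (by positivity)
  set κ := 2 / d ^ 4
  set c0 := lam * (κ * M) with hc0
  have hc0n : 0 ≤ c0 := by positivity
  refine ⟨2 * c0, by linarith, ?_⟩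
  set f : V4 → ℝ := fun X => max (w X - 2 * c0) 0 with hf
  have hfw : ∀ X, f X ≤ w X := fun X => max_le (by linarith) (hG.pos X)
  have hf0 : ∀ X, 0 ≤ f X := fun X => le_max_right _ _
  have hfm : AEStronglyMeasurable f := ((hG.i1.1.sub aestronglyMeasurable_const).sup aestronglyMeasurable_const)
  have hfG : Gd f := ⟨hf0, hG.i1.mono' hfm (Eventually.of_forall fun X => by
      rw [Real.norm_of_nonneg (hf0 X)]; exact hfw X), hG.i2.mono hfm (Eventually.of_forall fun X => by
      rw [Real.norm_of_nonneg (hf0 X), Real.norm_of_nonneg (hG.pos X)]; exact hfw X)⟩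
  have hI1 := (cv_prodint (ks_integrable d) hG.i1).prod_right_ae
  have hI2 := (cv_prodint (kb_integrable d) hG.i1).prod_right_ae
  have hI3 := (cv_prodint (ks_integrable d) hfG.i1).prod_right_ae
  have key : ∀ᵐ X, f X ≤ lam * ∫ Y, ks d (X - Y) * f Y := by
    filter_upwards [hI1, hI2, hI3, hw.EL hl] with X i1 i2 i3 hX
    have hn : 0 ≤ ∫ Y, ks d (X - Y) * f Y := integral_nonneg fun Y => mul_nonneg (ks_nonneg _ _) (hf0 Y)
    have e1 : cv w X = (∫ Y, ks d (X - Y) * w Y) + ∫ Y, kb d (X - Y) * w Y := by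
      rw [← integral_add i1 i2]; unfold cv; congr 1; ext Y; rw [ks_add_kb d]; ring
    have e2 : ∫ Y, kb d (X - Y) * w Y ≤ κ * M := by
      rw [← hw.mass, ← integral_const_mul]
      refine integral_mono i2 (hG.i1.const_mul κ) fun Y => ?_
      exact mul_le_mul_of_nonneg_right (kb_le' hd _) (hG.pos Y)
    have e3 : ∫ Y, ks d (X - Y) * w Y ≤ (∫ Y, ks d (X - Y) * f Y) + 2 * c0 * (1 / (2 * lam)) := by
      have j := ((ks_integrable d).comp_sub_left X).const_mul (2 * c0)
      calc _ ≤ ∫ Y, (ks d (X - Y) * f Y + 2 * c0 * ks d (X - Y)) := by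
            refine integral_mono i1 (i3.add j) fun Y => ?_
            simp only
            have : w Y - 2 * c0 ≤ f Y := le_max_left _ _
            nlinarith [ks_nonneg d (X - Y)]
        _ = (∫ Y, ks d (X - Y) * f Y) + 2 * c0 * ∫ Y, ks d Y := by
            rw [integral_add i3 j, integral_const_mul, integral_sub_left_eq_self (ks d) volume X]
        _ ≤ _ := by gcongr
    have e4 : 2 * c0 * (1 / (2 * lam)) = κ * M := by rw [hc0]; field_simp
    have e5 : w X ≤ lam * cv w X := by
      rw [hX]
      refine mul_le_mul_of_nonneg_left (max_le ?_ (cv_nonneg hG.pos X)) l0.le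
      have : 0 ≤ 2 * CC lam * M := by positivity
      linarith
    have e6 : lam * cv w X ≤ lam * ((∫ Y, ks d (X - Y) * f Y) + 2 * (κ * M)) := by
      refine mul_le_mul_of_nonneg_left ?_ l0.le
      linarith
    refine max_le ?_ (mul_nonneg l0.le hn)
    rw [hc0]; linarith
  have hq : qq f ≤ lam * BB (ks d) f f := by
    rw [BB_eq (ks_integrable d) hfG.i2 hfG.i2, ← integral_const_mul]
    have hIntg : Integrable (fun p : V4 × V4 => f p.1 * f p.2 * ks d (p.1 - p.2)) (volume.prod volume) :=
      BB_int (ks_integrable d) hfG.i2 hfG.i2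
    refine integral_mono_ae hfG.i2.integrable_sq ?_ ?_
    · refine Integrable.const_mul ?_ lam
      refine hIntg.integral_prod_left.congr (Eventually.of_forall fun X => ?_)
      simp only
      rw [← integral_const_mul]; congr 1; ext Y; ring
    · filter_upwards [key] with X hX
      have := mul_le_mul_of_nonneg_left hX (hf0 X)
      nlinarith
  have hq2 := (le_abs_self _).trans (BB_bound (ks_integrable d) hfG.i2 hfG.i2)
  rw [ks_abs, ← sq, nn_sq] at hq2
  have hq3 : lam * BB (ks d) f f ≤ lam * (1 / (2 * lam) * qq f) := by
    have := mul_le_mul_of_nonneg_right hd' (qq_nonneg f)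
    refine mul_le_mul_of_nonneg_left (hq2.trans this) l0.le
  have e : lam * (1 / (2 * lam) * qq f) = qq f / 2 := by field_simp
  have hq4 : qq f = 0 := le_antisymm (by linarith) (qq_nonneg f)
  have hz := (integral_eq_zero_iff_of_nonneg (fun X => sq_nonneg (f X)) hfG.i2.integrable_sq).1 hq4
  filter_upwards [hz] with X hX
  have : f X = 0 := by simpa using hX
  have h2 : w X - 2 * c0 ≤ f X := le_max_left _ _
  linarith

noncomputable def Pt (t : ℝ) (w : V4 → ℝ) (X : V4) : ℝ := ∫ Y, pt t (X - Y) * w Y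

theorem pt_sub_integrable {t : ℝ} (ht : 0 < t) (X : V4) : Integrable (fun Y => pt t (X - Y)) :=
  (pt_integrable ht).comp_sub_left X

theorem Pt_abs_le {t c : ℝ} (ht : 0 < t) {w : V4 → ℝ} (hc : ∀ᵐ X, |w X| ≤ c) (X : V4) : |Pt t w X| ≤ c := by
  unfold Pt
  refine abs_integral_le_integral_abs.trans ?_
  calc _ ≤ ∫ Y, c * pt t (X - Y) := by
        refine integral_mono_of_nonneg (Eventually.of_forall fun _ => abs_nonneg _)
          ((pt_sub_integrable ht X).const_mul c) ?_
        filter_upwards [hc] with Y hY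
        rw [abs_mul, abs_of_nonneg (pt_nonneg _ _), mul_comm]
        exact mul_le_mul_of_nonneg_right hY (pt_nonneg _ _)
    _ = c := by rw [integral_const_mul, integral_sub_left_eq_self (pt t) volume X, pt_integral ht, mul_one]

theorem Pt_cont {t : ℝ} (ht : 0 < t) {w : V4 → ℝ} (hw : Integrable w) : Continuous (Pt t w) := by
  unfold Pt
  refine continuous_of_dominated (bound := fun Y => ((4 * π * t) ^ 2)⁻¹ * |w Y|) ?_ ?_ ?_ ?_
  · intro X
    exact ((pt_continuous t).comp (continuous_const.sub continuous_id)).aestronglyMeasurable.mul hw.1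
  · intro X
    refine Eventually.of_forall fun Y => ?_
    rw [norm_mul, Real.norm_of_nonneg (pt_nonneg _ _)]
    exact mul_le_mul_of_nonneg_right (pt_le t ht _) (abs_nonneg _)
  · exact hw.abs.const_mul _
  · exact Eventually.of_forall fun Y =>
      ((pt_continuous t).comp (continuous_id.sub continuous_const)).mul continuous_const

theorem kkw_prodint {w : V4 → ℝ} {c : ℝ} (hw : AEStronglyMeasurable w) (hc : ∀ᵐ X, |w X| ≤ c) (X : V4) :
    Integrable (fun p : V4 × ℝ => Real.exp (-p.2) * pt p.2 (X - p.1) * w p.1)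
      (volume.prod (volume.restrict (Set.Ioi 0))) := by
  have hm : MeasurePreserving (fun Y : V4 => X - Y) volume volume := Measure.measurePreserving_sub_left volume X
  have h1 := (hm.prod (MeasurePreserving.id (volume.restrict (Set.Ioi (0 : ℝ))))).integrable_comp_of_integrable kkprod_int
  have h2 := h1.norm.const_mul c
  refine h2.mono' ?_ ?_
  · exact (h1.1).mul (hw.comp_quasiMeasurePreserving Measure.quasiMeasurePreserving_fst)
  · have h3 := (Measure.quasiMeasurePreserving_fst (μ := (volume : Measure V4))
      (ν := volume.restrict (Set.Ioi (0 : ℝ)))).ae hc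
    filter_upwards [h3] with p hp
    rw [norm_mul, mul_comm]
    exact mul_le_mul_of_nonneg_right hp (norm_nonneg _)

theorem cv_eq_Pt {w : V4 → ℝ} {c : ℝ} (hw : AEStronglyMeasurable w) (hc : ∀ᵐ X, |w X| ≤ c) (X : V4) :
    cv w X = ∫ t in Set.Ioi (0 : ℝ), Real.exp (-t) * Pt t w X := by
  have h := integral_integral_swap (f := fun (Y : V4) (t : ℝ) => Real.exp (-t) * pt t (X - Y) * w Y) (kkw_prodint hw hc X)
  unfold cv kk Pt
  calc _ = ∫ Y, ∫ t in Set.Ioi (0 : ℝ), Real.exp (-t) * pt t (X - Y) * w Y := by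
        congr 1; ext Y; rw [integral_mul_const]
    _ = _ := h
    _ = _ := by
        congr 1; ext t
        rw [← integral_const_mul]; congr 1; ext Y; ring

theorem Pt_meas_t {w : V4 → ℝ} (hw : AEStronglyMeasurable w) (X : V4) :
    AEStronglyMeasurable (fun t => Pt t w X) (volume.restrict (Set.Ioi 0)) := by
  have : AEStronglyMeasurable (fun p : ℝ × V4 => pt p.1 (X - p.2) * w p.2)
      ((volume.restrict (Set.Ioi 0)).prod volume) := by
    refine AEStronglyMeasurable.mul ?_ ?_
    · exact (pt_measurable2.comp (measurable_fst.prodMk (measurable_const.sub measurable_snd))).aestronglyMeasurable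
    · exact hw.comp_quasiMeasurePreserving Measure.quasiMeasurePreserving_snd
  exact this.integral_prod_right'

theorem cv_cont {w : V4 → ℝ} {c : ℝ} (hw : Integrable w) (hc : ∀ᵐ X, |w X| ≤ c) : Continuous (cv w) := by
  rw [show cv w = fun X => ∫ t in Set.Ioi (0 : ℝ), Real.exp (-t) * Pt t w X from
    funext (cv_eq_Pt hw.1 hc)]
  refine continuous_of_dominated (bound := fun t => c * Real.exp (-t)) ?_ ?_ ?_ ?_
  · intro X
    exact (by fun_prop : Continuous fun t : ℝ => Real.exp (-t)).aestronglyMeasurable.mul (Pt_meas_t hw.1 X)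
  · intro X
    filter_upwards [self_mem_ae_restrict measurableSet_Ioi] with t ht
    rw [norm_mul, Real.norm_of_nonneg (Real.exp_pos _).le, mul_comm]
    exact mul_le_mul_of_nonneg_right (Pt_abs_le ht hc X) (Real.exp_pos _).le
  · exact expneg_int.const_mul c
  · filter_upwards [self_mem_ae_restrict measurableSet_Ioi] with t ht
    exact continuous_const.mul (Pt_cont ht hw)

structure Nx (lam M : ℝ) (w : V4 → ℝ) : Prop where
  mx : Mx lam M w
  el : ∀ X, w X = lam * max (cv w X - 2 * CC lam * M) 0
  bdd : ∃ c : ℝ, 0 ≤ c ∧ ∀ᵐ X, w X ≤ c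
  cont : Continuous (cv w)

theorem Mx_congr {lam M : ℝ} {w w' : V4 → ℝ} (h : w =ᵐ[volume] w') (hp : ∀ X, 0 ≤ w' X) (hw : Mx lam M w) :
    Mx lam M w' := by
  refine ⟨⟨hp, hw.gd.i1.congr h, (memLp_congr_ae h).1 hw.gd.i2⟩, ?_, ?_⟩
  · rw [← integral_congr_ae h, hw.mass]
  · rw [← hw.mx]; unfold FF qq
    rw [BB_congr h h]
    congr 2
    exact integral_congr_ae (by filter_upwards [h] with X hX; rw [hX])

theorem Mx.normal {lam M : ℝ} (hl : 1 < lam) (hM : 0 < M) {w : V4 → ℝ} (hw : Mx lam M w) :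
    ∃ w', w =ᵐ[volume] w' ∧ Nx lam M w' := by
  obtain ⟨c, hc0, hc⟩ := hw.bdd hl hM
  have h := hw.EL hl
  have hcv := cv_congr h
  have habs : ∀ᵐ X, |w X| ≤ c := by
    filter_upwards [hc] with X hX; rwa [abs_of_nonneg (hw.gd.pos X)]
  refine ⟨_, h, Mx_congr h (fun X => mul_nonneg (by linarith) (le_max_right _ _)) hw, ?_, ⟨c, hc0, ?_⟩, ?_⟩
  · intro X; rw [← hcv]
  · filter_upwards [h, hc] with X h1 h2; rw [← h1]; exact h2
  · rw [← hcv]; exact cv_cont hw.gd.i1 habs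

theorem Nx.wcont {lam M : ℝ} {w : V4 → ℝ} (hw : Nx lam M w) : Continuous w := by
  rw [show w = fun X => lam * max (cv w X - 2 * CC lam * M) 0 from funext hw.el]
  exact continuous_const.mul ((hw.cont.sub continuous_const).max continuous_const)

end

section
noncomputable def sg (e : V4) (s : ℝ) (X : V4) : V4 := X - (2 * (inner ℝ e X - s)) • e

theorem sg_inner {e : V4} (he : ‖e‖ = 1) (s : ℝ) (X : V4) : inner ℝ e (sg e s X) - s = -(inner ℝ e X - s) := by
  unfold sg
  rw [inner_sub_right, real_inner_smul_right, real_inner_self_eq_norm_sq, he]; ring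

theorem sg_sg {e : V4} (he : ‖e‖ = 1) (s : ℝ) (X : V4) : sg e s (sg e s X) = X := by
  rw [sg, sg_inner he, sg]
  module

theorem sg_cont (e : V4) (s : ℝ) : Continuous (sg e s) := by unfold sg; fun_prop

theorem sg_iso {e : V4} (he : ‖e‖ = 1) (s : ℝ) (X Y : V4) : ‖sg e s X - sg e s Y‖ = ‖X - Y‖ := by
  have h : ‖sg e s X - sg e s Y‖ ^ 2 = ‖X - Y‖ ^ 2 := by
    have : sg e s X - sg e s Y = (X - Y) - (2 * inner ℝ e (X - Y)) • e := by
      unfold sg; rw [inner_sub_right]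
      module
    rw [this, norm_sub_sq_real, norm_smul, he, real_inner_smul_right, real_inner_comm]
    simp only [Real.norm_eq_abs, mul_one, sq_abs]; ring
  exact (sq_eq_sq₀ (norm_nonneg _) (norm_nonneg _)).1 h

theorem sg_dist {e : V4} (he : ‖e‖ = 1) (s : ℝ) (X Y : V4) :
    ‖X - sg e s Y‖ ^ 2 = ‖X - Y‖ ^ 2 + 4 * (inner ℝ e X - s) * (inner ℝ e Y - s) := by
  have : X - sg e s Y = (X - Y) + (2 * (inner ℝ e Y - s)) • e := by unfold sg; module
  rw [this, norm_add_sq_real, norm_smul, he, real_inner_smul_right, real_inner_comm e (X - Y), inner_sub_right]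
  simp only [Real.norm_eq_abs, mul_one, sq_abs]; ring

noncomputable def sgE {e : V4} (he : ‖e‖ = 1) (s : ℝ) : V4 ≃ᵐ V4 where
  toFun := sg e s
  invFun := sg e s
  left_inv := sg_sg he s
  right_inv := sg_sg he s
  measurable_toFun := (sg_cont e s).measurable
  measurable_invFun := (sg_cont e s).measurable

theorem sg_mp {e : V4} (he : ‖e‖ = 1) (s : ℝ) : MeasurePreserving (sg e s) volume volume := by
  have h1 : MeasurePreserving ((ℝ ∙ e)ᗮ.reflection) (volume : Measure V4) volume :=
    LinearIsometryEquiv.measurePreserving _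
  have h2 : MeasurePreserving (fun X : V4 => X + (2 * s) • e) volume volume :=
    measurePreserving_add_right volume _
  have h3 := h2.comp h1
  convert h3 using 1
  ext1 X
  simp only [Function.comp, Submodule.reflection_orthogonal_apply, Submodule.reflection_singleton_apply, he]
  unfold sg
  simp only [RCLike.ofReal_real_eq_id, id, one_pow, div_one]
  module

theorem kk_le_of_norm {X Y : V4} (hX : X ≠ 0) (h : ‖X‖ ≤ ‖Y‖) : kk Y ≤ kk X := by
  rcases h.lt_or_eq with h | h
  · exact (kk_anti hX h).le
  · exact (kk_norm h).ge

/-- polarization dichotomy -/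
theorem Nx.polar {lam M : ℝ} (hl : 1 < lam) {w : V4 → ℝ} (hw : Nx lam M w) {e : V4} (he : ‖e‖ = 1) (s : ℝ) :
    (∀ X, 0 < inner ℝ e X - s → w (sg e s X) ≤ w X) ∨ (∀ X, 0 < inner ℝ e X - s → w X ≤ w (sg e s X)) := by
  have hG := hw.mx.gd
  have l0 : 0 < lam := by linarith
  set σ := sg e s with hσ
  set l : V4 → ℝ := fun X => inner ℝ e X - s with hlq
  have hlc : Continuous l := by simp only [hlq]; fun_prop
  have hσG : Gd (fun X => w (σ X)) := hG.comp (sgE he s) (sg_mp he s)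
  set d : V4 → ℝ := fun X => w X - w (σ X) with hd
  set d' : V4 → ℝ := fun X => if 0 < l X then |d X| else -|d X| with hd'
  have hdσ : ∀ X, d (σ X) = - d X := fun X => by
    simp only [hd, hσ, sg_sg he]; ring
  have hlσ : ∀ X, l (σ X) = - l X := fun X => sg_inner he s X
  have hd0 : ∀ X, l X = 0 → d X = 0 := fun X h => by
    have : σ X = X := by simp only [hσ, sg]; simp only [hlq] at h; rw [h]; simp
    simp only [hd, this, sub_self]
  have hd'σ : ∀ X, d' (σ X) = - d' X := fun X => by
    simp only [hd', hlσ, hdσ, abs_neg]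
    rcases lt_trichotomy (l X) 0 with h | h | h
    · rw [if_pos (by linarith), if_neg (by linarith), neg_neg]
    · rw [hd0 X h]; simp
    · rw [if_neg (by linarith), if_pos h]
  have hwc := hw.wcont
  have hdc : Continuous d := hwc.sub (hwc.comp (sg_cont e s))
  have hd2 : MemLp d 2 := hG.i2.sub hσG.i2
  have hd1 : Integrable d := hG.i1.sub hσG.i1
  have hd'm : Measurable d' := Measurable.ite (measurableSet_lt measurable_const hlc.measurable)
    hdc.abs.measurable hdc.abs.measurable.neg
  have hd'a : ∀ X, |d' X| = |d X| := fun X => by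
    simp only [hd']; split_ifs <;> simp
  have hd'2 : MemLp d' 2 := hd2.mono hd'm.aestronglyMeasurable (Eventually.of_forall fun X => by
    rw [Real.norm_eq_abs, Real.norm_eq_abs, hd'a])
  have hd'1 : Integrable d' := hd1.mono hd'm.aestronglyMeasurable (Eventually.of_forall fun X => by
    rw [Real.norm_eq_abs, Real.norm_eq_abs, hd'a])
  set m : V4 → ℝ := fun X => (1 / 2) * (w X + w (σ X)) with hm
  have hm2 : MemLp m 2 := (hG.i2.add hσG.i2).const_mul _
  have hm1 : Integrable m := (hG.i1.add hσG.i1).const_mul _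
  have hmσ : ∀ X, m (σ X) = m X := fun X => by simp only [hm, hσ, sg_sg he]; ring
  have hiso : ∀ X Y, kk (σ X - σ Y) = kk (X - Y) := fun X Y => kk_norm (sg_iso he s X Y)
  -- odd parts
  have odd_int : ∀ g : V4 → ℝ, (∀ X, g (σ X) = - g X) → ∫ X, g X = 0 := by
    intro g hg
    have := (sg_mp he s).integral_comp (sgE he s).measurableEmbedding g
    have h2 : ∫ X, g (σ X) = ∫ X, g X := this
    simp only [hg, integral_neg] at h2
    linarith
  have cross : ∀ g : V4 → ℝ, (∀ X, g (σ X) = - g X) → BB kk m g = 0 := by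
    intro g hg
    have h := BB_comp (κ := kk) (f := m) (g := g) (sgE he s) (sg_mp he s) hiso
    have h2 : BB kk (fun X => m (σ X)) (fun X => g (σ X)) = BB kk m g := h
    have e1 : (fun X => m (σ X)) = fun X => (1 : ℝ) * m X := by ext X; rw [hmσ]; ring
    have e2 : (fun X => g (σ X)) = fun X => (-1 : ℝ) * g X := by ext X; rw [hg]; ring
    rw [e1, e2, BB_smul_left, BB_smul_right] at h2
    linarith
  have dec : ∀ g : V4 → ℝ, MemLp g 2 → (∀ X, g (σ X) = - g X) →
      FF lam (fun X => m X + (1 / 2) * g X) = FF lam m + FF lam g / 4 := by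
    intro g hg2 hg
    have hg2' : MemLp (fun X => (1 / 2 : ℝ) * g X) 2 := hg2.const_mul _
    have hs : FF lam (fun X => (1 / 2 : ℝ) * g X) = (1 / 2) ^ 2 * FF lam g := FF_smul _ _ _
    rw [FF_add hl hm2 hg2', BB_smul_right, cross g hg, hs]
    have : ∫ X, m X * (1 / 2 * g X) = 0 := odd_int _ fun X => by rw [hmσ, hg]; ring
    rw [this]; ring
  set pw : V4 → ℝ := fun X => m X + (1 / 2) * d' X with hpw
  have hpG : Gd pw := by
    refine ⟨fun X => ?_, hm1.add (hd'1.const_mul _), hm2.add (hd'2.const_mul _)⟩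
    have h1 : -|d X| ≤ d' X := by rw [← hd'a]; exact neg_abs_le _
    have h2 : |d X| ≤ w X + w (σ X) := by
      have a1 := hG.pos X
      have a2 := hG.pos (σ X)
      simp only [hd]; rw [abs_le]; constructor <;> linarith
    simp only [hpw, hm]; linarith
  have hpm : ∫ X, pw X = M := by
    have e1 : ∫ X, pw X = (∫ X, m X) + (1 / 2) * ∫ X, d' X := by
      rw [← integral_const_mul]; exact integral_add hm1 (hd'1.const_mul _)
    have e2 : ∫ X, w X = (∫ X, m X) + (1 / 2) * ∫ X, d X := by
      rw [← integral_const_mul, ← integral_add hm1 (hd1.const_mul _)]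
      congr 1; ext X; simp only [hm, hd]; ring
    rw [e1, odd_int d' hd'σ, ← hw.mx.mass, e2, odd_int d hdσ]
  have hle := FF_le_CC hl hpG
  rw [hpm, ← hw.mx.mx] at hle
  have ew : w = fun X => m X + (1 / 2) * d X := by ext X; simp only [hm, hd]; ring
  have hle2 : FF lam d' ≤ FF lam d := by
    have a1 := dec d hd2 hdσ
    have a2 := dec d' hd'2 hd'σ
    rw [← ew] at a1
    change FF lam pw = _ at a2
    linarith
  have hqd : qq d' = qq d := by
    unfold qq; congr 1; ext X; rw [← sq_abs, hd'a, sq_abs]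
  have hBle : BB kk d' d' ≤ BB kk d d := by
    unfold FF at hle2; rw [hqd] at hle2; linarith
  -- kernel
  have two : ∀ g : V4 → ℝ, MemLp g 2 → (∀ X, g (σ X) = - g X) →
      Integrable (fun p : V4 × V4 => g p.1 * g p.2 * (kk (p.1 - p.2) - kk (p.1 - σ p.2))) ∧
      ∫ p : V4 × V4, g p.1 * g p.2 * (kk (p.1 - p.2) - kk (p.1 - σ p.2)) = 2 * BB kk g g := by
    intro g hg2 hg
    have i1 := BB_int kk_integrable hg2 hg2
    have hmp : MeasurePreserving (fun p : V4 × V4 => (p.1, σ p.2)) volume volume :=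
      (MeasurePreserving.id volume).prod (sg_mp he s)
    have hme : MeasurableEmbedding (fun p : V4 × V4 => (p.1, σ p.2)) :=
      MeasurableEmbedding.id.prodMap (sgE he s).measurableEmbedding
    have i2 := hmp.integrable_comp_of_integrable i1
    have e2 := hmp.integral_comp hme (fun p : V4 × V4 => g p.1 * g p.2 * kk (p.1 - p.2))
    have i2' : Integrable (fun p : V4 × V4 => g p.1 * g p.2 * kk (p.1 - σ p.2)) := by
      refine i2.neg.congr (Eventually.of_forall fun p => ?_)
      simp only [Pi.neg_apply, Function.comp, hg]; ring
    have e2' : ∫ p : V4 × V4, g p.1 * g p.2 * kk (p.1 - σ p.2) = - BB kk g g := by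
      unfold BB; rw [← e2, ← integral_neg]; congr 1; ext p; simp only [hg]; ring
    constructor
    · exact (i1.sub i2').congr (Eventually.of_forall fun p => by simp only [Pi.sub_apply]; ring)
    · calc _ = ∫ p : V4 × V4, (g p.1 * g p.2 * kk (p.1 - p.2) - g p.1 * g p.2 * kk (p.1 - σ p.2)) := by
            congr 1; ext p; ring
        _ = BB kk g g - - BB kk g g := by rw [integral_sub i1 i2', e2']; rfl
        _ = _ := by ring
  have hne1 : ∀ᵐ p : V4 × V4, p.1 - p.2 ≠ 0 := by
    have h0 : ∀ᵐ Z : V4, Z ≠ 0 := by simp [ae_iff]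
    exact (quasiMeasurePreserving_sub (volume : Measure V4) volume).ae h0
  have hne2 : ∀ᵐ p : V4 × V4, p.1 - σ p.2 ≠ 0 := by
    have hmp : MeasurePreserving (fun p : V4 × V4 => (p.1, σ p.2)) volume volume :=
      (MeasurePreserving.id volume).prod (sg_mp he s)
    exact hmp.quasiMeasurePreserving.ae hne1
  have hsgn : ∀ᵐ p : V4 × V4, d' p.1 * d' p.2 * (kk (p.1 - p.2) - kk (p.1 - σ p.2)) =
      |d p.1 * d p.2 * (kk (p.1 - p.2) - kk (p.1 - σ p.2))| := by
    filter_upwards [hne1, hne2] with p h1 h2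
    have hds := sg_dist he s p.1 p.2
    change ‖p.1 - σ p.2‖ ^ 2 = ‖p.1 - p.2‖ ^ 2 + 4 * l p.1 * l p.2 at hds
    have up : 0 ≤ l p.1 * l p.2 → 0 ≤ kk (p.1 - p.2) - kk (p.1 - σ p.2) := fun h =>
      sub_nonneg.2 (kk_le_of_norm h1 (by
        refine (sq_le_sq₀ (norm_nonneg _) (norm_nonneg _)).1 ?_; rw [hds]; nlinarith))
    have dn : l p.1 * l p.2 ≤ 0 → kk (p.1 - p.2) - kk (p.1 - σ p.2) ≤ 0 := fun h =>
      sub_nonpos.2 (kk_le_of_norm h2 (by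
        refine (sq_le_sq₀ (norm_nonneg _) (norm_nonneg _)).1 ?_; rw [hds]; nlinarith))
    rw [abs_mul, abs_mul]
    simp only [hd']
    by_cases a1 : 0 < l p.1 <;> by_cases a2 : 0 < l p.2 <;> simp only [a1, a2, if_true, if_false]
    · rw [abs_of_nonneg (up (by positivity))]
    · rw [abs_of_nonpos (dn (by nlinarith))]; ring
    · rw [abs_of_nonpos (dn (by nlinarith))]; ring
    · rw [abs_of_nonneg (up (by nlinarith))]; ring
  obtain ⟨i1, e1⟩ := two d hd2 hdσ
  obtain ⟨i2, e2⟩ := two d' hd'2 hd'σ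
  have hnn : ∀ᵐ p : V4 × V4, 0 ≤ d p.1 * d p.2 * (kk (p.1 - p.2) - kk (p.1 - σ p.2)) := by
    have hz : ∫ p : V4 × V4, (|d p.1 * d p.2 * (kk (p.1 - p.2) - kk (p.1 - σ p.2))| -
        d p.1 * d p.2 * (kk (p.1 - p.2) - kk (p.1 - σ p.2))) ≤ 0 := by
      rw [integral_sub i1.abs i1, e1, ← integral_congr_ae hsgn, e2]; linarith
    have hz' := le_antisymm hz (integral_nonneg fun p => sub_nonneg.2 (le_abs_self _))
    have := (integral_eq_zero_iff_of_nonneg (fun p => sub_nonneg.2 (le_abs_self _)) (i1.abs.sub i1)).1 hz'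
    filter_upwards [this] with p hp
    have hp' : |d p.1 * d p.2 * (kk (p.1 - p.2) - kk (p.1 - σ p.2))| -
        d p.1 * d p.2 * (kk (p.1 - p.2) - kk (p.1 - σ p.2)) = 0 := hp
    rw [← sub_eq_zero.1 hp']; exact abs_nonneg _
  have hall : ∀ X Y, 0 < l X → 0 < l Y → 0 ≤ d X * d Y := by
    set U : Set (V4 × V4) := {p | 0 < l p.1 ∧ 0 < l p.2 ∧ d p.1 * d p.2 < 0} with hU
    have hUo : IsOpen U :=
      (isOpen_lt continuous_const (hlc.comp continuous_fst)).inter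
        ((isOpen_lt continuous_const (hlc.comp continuous_snd)).inter
          (isOpen_lt ((hdc.comp continuous_fst).mul (hdc.comp continuous_snd)) continuous_const))
    have hU0 : volume U = 0 := by
      refine measure_mono_null ?_ (ae_iff.1 (hnn.and hne1))
      rintro p ⟨h1, h2, h3⟩ ⟨h4, h5⟩
      have hds := sg_dist he s p.1 p.2
      change ‖p.1 - σ p.2‖ ^ 2 = ‖p.1 - p.2‖ ^ 2 + 4 * l p.1 * l p.2 at hds
      have hlt : ‖p.1 - p.2‖ < ‖p.1 - σ p.2‖ := by
        refine (sq_lt_sq₀ (norm_nonneg _) (norm_nonneg _)).1 ?_; rw [hds]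
        have := mul_pos h1 h2
        linarith
      have := kk_anti h5 hlt
      nlinarith
    have hUe := (hUo.measure_eq_zero_iff volume).1 hU0
    intro X Y hX hY
    by_contra h
    have : (X, Y) ∈ U := ⟨hX, hY, not_le.1 h⟩
    rw [hUe] at this; exact this
  by_cases h : ∃ X, 0 < l X ∧ d X < 0
  · obtain ⟨X, hX, hdX⟩ := h
    right
    intro Y hY
    have := hall X Y hX hY
    have h2 : d Y ≤ 0 := by nlinarith
    simp only [hd] at h2; linarith
  · left
    intro X hX
    have h2 : 0 ≤ d X := by
      by_contra h'; exact h ⟨X, hX, not_le.1 h'⟩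
    simp only [hd] at h2; linarith

end

section
theorem no_mono {w : V4 → ℝ} (hp : ∀ X, 0 ≤ w X) (hi : Integrable w) (hc : Continuous w) {v : V4} (hv : v ≠ 0)
    {U : Set V4} (hU : IsOpen U) (h : ∀ X ∈ U, ∀ n : ℕ, w X ≤ w (X + (n : ℝ) • v)) : ∀ X ∈ U, w X = 0 := by
  intro X0 hX0
  by_contra hne
  have hpos : 0 < w X0 := lt_of_le_of_ne (hp X0) (Ne.symm hne)
  set b := w X0 / 2 with hb
  have hb0 : 0 < b := by positivity
  have hO : IsOpen (U ∩ {X | b < w X}) := hU.inter (isOpen_lt continuous_const hc)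
  obtain ⟨r, hr, hsub⟩ := Metric.isOpen_iff.1 hO X0 ⟨hX0, by simp only [Set.mem_setOf_eq]; linarith⟩
  set V := (volume (Metric.ball X0 r)).toReal with hV
  have hV0 : 0 < V := ENNReal.toReal_pos (Metric.measure_ball_pos volume X0 hr).ne' measure_ball_lt_top.ne
  have hev := (ball_mono_tendsto hi).eventually (lt_mem_nhds (show (∫ X, w X) - b * V < ∫ X, w X by
    have := mul_pos hb0 hV0; linarith))
  obtain ⟨k, hk⟩ := hev.exists
  have hvn : 0 < ‖v‖ := norm_pos_iff.2 hv
  obtain ⟨n, hn⟩ := exists_nat_gt ((k + r + ‖X0‖) / ‖v‖)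
  rw [div_lt_iff₀ hvn] at hn
  set Z0 := X0 + (n : ℝ) • v with hZ0
  have hdis : Disjoint (Metric.ball (0 : V4) k) (Metric.ball Z0 r) := by
    rw [Set.disjoint_left]
    intro Z h1 h2
    rw [mem_ball_zero_iff] at h1
    rw [mem_ball_iff_norm] at h2
    have e : (n : ℝ) • v = Z - X0 - (Z - Z0) := by rw [hZ0]; abel
    have : ‖(n : ℝ) • v‖ ≤ ‖Z‖ + ‖X0‖ + ‖Z - Z0‖ := by
      rw [e]; exact (norm_sub_le _ _).trans (by gcongr; exact norm_sub_le _ _)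
    rw [norm_smul, Real.norm_of_nonneg (Nat.cast_nonneg n)] at this
    linarith
  have hlow : b * V ≤ ∫ X in Metric.ball Z0 r, w X := by
    have : b * V = ∫ X in Metric.ball Z0 r, b := by
      rw [setIntegral_const, smul_eq_mul, mul_comm]
      congr 1
      rw [hV, measureReal_def, Measure.addHaar_ball_center, Measure.addHaar_ball_center volume Z0]
    rw [this]
    refine setIntegral_mono_on (integrableOn_const measure_ball_lt_top.ne) hi.integrableOn measurableSet_ball ?_
    intro Z hZ
    have hZ' : Z - (n : ℝ) • v ∈ Metric.ball X0 r := by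
      rw [mem_ball_iff_norm] at hZ ⊢
      rwa [show Z - (n : ℝ) • v - X0 = Z - Z0 by rw [hZ0]; abel]
    obtain ⟨h1, h2⟩ := hsub hZ'
    have h3 := h _ h1 n
    rw [sub_add_cancel] at h3
    exact (le_of_lt h2).trans h3
  have hun : (∫ X in Metric.ball (0 : V4) k, w X) + ∫ X in Metric.ball Z0 r, w X ≤ ∫ X, w X := by
    rw [← setIntegral_union hdis measurableSet_ball hi.integrableOn hi.integrableOn]
    exact setIntegral_le_integral hi (Eventually.of_forall hp)
  linarith

theorem sg_comp (e : V4) (he : ‖e‖ = 1) (s t : ℝ) (X : V4) : sg e s (sg e t X) = X + (2 * (s - t)) • e := by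
  have h : inner ℝ e (sg e t X) = -(inner ℝ e X - t) + t := by have := sg_inner he t X; linarith
  rw [sg, h, sg]; module

theorem Nx.exists_pos {lam M : ℝ} (hM : 0 < M) {w : V4 → ℝ} (hw : Nx lam M w) : ∃ X, w X ≠ 0 := by
  by_contra h
  push Not at h
  have := hw.mx.mass
  simp only [h, integral_zero] at this
  linarith

theorem Nx.refl_dir {lam M : ℝ} (hl : 1 < lam) (hM : 0 < M) {w : V4 → ℝ} (hw : Nx lam M w) {e : V4} (he : ‖e‖ = 1) :
    ∃ s, ∀ X, w (sg e s X) = w X := by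
  have hG := hw.mx.gd
  have hwc := hw.wcont
  set A : Set ℝ := {s | ∀ X : V4, ∀ t : ℝ, inner ℝ e X = 0 → 0 ≤ t → w (X + (s + t) • e) ≤ w (X + (s - t) • e)} with hA
  set B : Set ℝ := {s | ∀ X : V4, ∀ t : ℝ, inner ℝ e X = 0 → 0 ≤ t → w (X + (s - t) • e) ≤ w (X + (s + t) • e)} with hB
  have hAc : IsClosed A := by
    have : A = ⋂ X : V4, ⋂ t : ℝ, ⋂ _ : inner ℝ e X = 0, ⋂ _ : 0 ≤ t, {s | w (X + (s + t) • e) ≤ w (X + (s - t) • e)} := by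
      ext s; simp [hA]
    rw [this]
    refine isClosed_iInter fun X => isClosed_iInter fun t => isClosed_iInter fun _ => isClosed_iInter fun _ => ?_
    exact isClosed_le (hwc.comp (by fun_prop)) (hwc.comp (by fun_prop))
  have hBc : IsClosed B := by
    have : B = ⋂ X : V4, ⋂ t : ℝ, ⋂ _ : inner ℝ e X = 0, ⋂ _ : 0 ≤ t, {s | w (X + (s - t) • e) ≤ w (X + (s + t) • e)} := by
      ext s; simp [hB]
    rw [this]
    refine isClosed_iInter fun X => isClosed_iInter fun t => isClosed_iInter fun _ => isClosed_iInter fun _ => ?_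
    exact isClosed_le (hwc.comp (by fun_prop)) (hwc.comp (by fun_prop))
  have hee : inner ℝ e e = (1 : ℝ) := by rw [real_inner_self_eq_norm_sq, he]; norm_num
  have hsgv : ∀ (X : V4) (s t : ℝ), inner ℝ e X = 0 → sg e s (X + (s + t) • e) = X + (s - t) • e := by
    intro X s t hX
    rw [sg, inner_add_right, hX, real_inner_smul_right, hee]; module
  have hin : ∀ (X : V4) (s t : ℝ), inner ℝ e X = 0 → inner ℝ e (X + (s + t) • e) - s = t := by
    intro X s t hX
    rw [inner_add_right, hX, real_inner_smul_right, hee]; ring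
  have hAB : ∀ s, s ∈ A ∨ s ∈ B := by
    intro s
    rcases hw.polar hl he s with h | h
    · right
      intro X t hX ht
      rcases ht.lt_or_eq with ht | rfl
      · have := h (X + (s + t) • e) (by rw [hin X s t hX]; exact ht)
        rwa [hsgv X s t hX] at this
      · simp
    · left
      intro X t hX ht
      rcases ht.lt_or_eq with ht | rfl
      · have := h (X + (s + t) • e) (by rw [hin X s t hX]; exact ht)
        rwa [hsgv X s t hX] at this
      · simp
  have he0 : e ≠ 0 := by intro h; rw [h, norm_zero] at he; norm_num at he
  have hperp : ∀ X : V4, inner ℝ e (X - (inner ℝ e X) • e) = (0 : ℝ) := by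
    intro X; rw [inner_sub_right, real_inner_smul_right, hee]; ring
  obtain ⟨X1, hX1⟩ := hw.exists_pos hM
  have hAne : A.Nonempty := by
    by_contra hne
    have hall : ∀ s, s ∈ B := fun s => (hAB s).resolve_left fun h => hne ⟨s, h⟩
    refine hX1 (no_mono hG.pos hG.i1 hwc he0 isOpen_univ ?_ X1 trivial)
    intro X _ n
    have := hall (inner ℝ e X + n / 2) (X - (inner ℝ e X) • e) (n / 2) (hperp X) (by positivity)
    convert this using 2 <;> module
  have hBne : B.Nonempty := by
    by_contra hne
    have hall : ∀ s, s ∈ A := fun s => (hAB s).resolve_right fun h => hne ⟨s, h⟩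
    refine hX1 (no_mono hG.pos hG.i1 hwc (neg_ne_zero.2 he0) isOpen_univ ?_ X1 trivial)
    intro X _ n
    have := hall (inner ℝ e X - n / 2) (X - (inner ℝ e X) • e) (n / 2) (hperp X) (by positivity)
    convert this using 2 <;> module
  obtain ⟨s, -, hsA, hsB⟩ := isPreconnected_closed_iff.1 (isPreconnected_univ (α := ℝ)) A B hAc hBc
    (fun s _ => hAB s) (by simpa using hAne) (by simpa using hBne)
  refine ⟨s, fun X => ?_⟩
  have key : ∀ X, 0 ≤ inner ℝ e X - s → w (sg e s X) = w X := by
    intro X hX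
    have e1 : X = (X - (inner ℝ e X) • e) + (s + (inner ℝ e X - s)) • e := by module
    have e2 : sg e s X = (X - (inner ℝ e X) • e) + (s - (inner ℝ e X - s)) • e := by rw [sg]; module
    rw [e2]
    conv_rhs => rw [e1]
    exact le_antisymm (hsB _ _ (hperp X) hX) (hsA _ _ (hperp X) hX)
  rcases le_total 0 (inner ℝ e X - s) with h | h
  · exact key X h
  · have := key (sg e s X) (by rw [sg_inner he]; linarith)
    rw [sg_sg he] at this; exact this.symm

theorem Nx.center {lam M : ℝ} (hl : 1 < lam) (hM : 0 < M) {w : V4 → ℝ} (hw : Nx lam M w) :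
    ∃ c : V4, ∀ X, w (c - X) = w (c + X) := by
  have hb : ∀ i : Fin 4, ‖(EuclideanSpace.single i (1 : ℝ) : V4)‖ = 1 := fun i => by simp
  choose s hs using fun i => hw.refl_dir hl hM (hb i)
  refine ⟨WithLp.toLp 2 s, fun X => ?_⟩
  set c : V4 := WithLp.toLp 2 s with hc
  have h4 : w (sg (EuclideanSpace.single 3 1) (s 3) (sg (EuclideanSpace.single 2 1) (s 2)
      (sg (EuclideanSpace.single 1 1) (s 1) (sg (EuclideanSpace.single 0 1) (s 0) (c + X))))) = w (c + X) := by
    rw [hs, hs, hs, hs]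
  rw [← h4]
  congr 1
  ext i
  fin_cases i <;> simp [sg, hc, EuclideanSpace.inner_single_left] <;> ring

theorem cv_trans (w : V4 → ℝ) (z X : V4) : cv (fun Y => w (Y + z)) X = cv w (X + z) := by
  unfold cv
  rw [← integral_add_right_eq_self (fun Y => kk (X + z - Y) * w Y) z]
  congr 1; ext Y; rw [add_sub_add_right_eq_sub]

theorem Mx.trans {lam M : ℝ} {w : V4 → ℝ} (hw : Mx lam M w) (z : V4) : Mx lam M (fun X => w (X + z)) :=
  ⟨hw.gd.trans z, by rw [integral_add_right_eq_self w z, hw.mass], by rw [FF_trans, hw.mx]⟩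

theorem Nx.trans {lam M : ℝ} {w : V4 → ℝ} (hw : Nx lam M w) (z : V4) : Nx lam M (fun X => w (X + z)) := by
  obtain ⟨c, hc0, hc⟩ := hw.bdd
  refine ⟨hw.mx.trans z, fun X => ?_, ⟨c, hc0, ?_⟩, ?_⟩
  · rw [cv_trans, hw.el]
  · exact (trE_mp z).quasiMeasurePreserving.ae hc
  · rw [show cv (fun X => w (X + z)) = fun X => cv w (X + z) from funext (cv_trans w z)]
    exact hw.cont.comp (continuous_id.add continuous_const)

structure Cx (lam M : ℝ) (w : V4 → ℝ) : Prop where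
  nx : Nx lam M w
  even : ∀ X, w (-X) = w X

theorem Nx.exists_Cx {lam M : ℝ} (hl : 1 < lam) (hM : 0 < M) {w : V4 → ℝ} (hw : Nx lam M w) :
    ∃ c : V4, Cx lam M (fun X => w (X + c)) := by
  obtain ⟨c, hc⟩ := hw.center hl hM
  refine ⟨c, hw.trans c, fun X => ?_⟩
  have := hc X
  beta_reduce
  rw [show -X + c = c - X by abel, this, add_comm]

theorem Cx.refl0 {lam M : ℝ} (hl : 1 < lam) {w : V4 → ℝ} (hw : Cx lam M w) {e : V4} (he : ‖e‖ = 1) (X : V4) :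
    w (sg e 0 X) = w X := by
  have hneg : ∀ X : V4, sg e 0 (-X) = - sg e 0 X := fun X => by
    rw [sg, sg, inner_neg_right]; module
  have hpos : ∀ X : V4, 0 < inner ℝ e X - 0 → 0 < inner ℝ e (-(sg e 0 X)) - (0 : ℝ) := fun X h => by
    rw [inner_neg_right]; have := sg_inner he 0 X; linarith
  have key : ∀ X : V4, 0 < inner ℝ e X - (0 : ℝ) → w (sg e 0 X) = w X := by
    intro X hX
    rcases hw.nx.polar hl he 0 with h | h
    · refine le_antisymm (h X hX) ?_
      have := h _ (hpos X hX)
      rwa [hneg, sg_sg he, hw.even, hw.even] at this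
    · refine le_antisymm ?_ (h X hX)
      have := h _ (hpos X hX)
      rwa [hneg, sg_sg he, hw.even, hw.even] at this
  rcases lt_trichotomy (inner ℝ e X - (0 : ℝ)) 0 with h | h | h
  · have := key (sg e 0 X) (by rw [sg_inner he]; linarith)
    rw [sg_sg he] at this; exact this.symm
  · rw [sg, h]; simp
  · exact key X h

theorem Cx.radial {lam M : ℝ} (hl : 1 < lam) {w : V4 → ℝ} (hw : Cx lam M w) {X Y : V4} (h : ‖X‖ = ‖Y‖) :
    w X = w Y := by
  by_cases hXY : X = Y
  · rw [hXY]
  have hn : ‖X - Y‖ ≠ 0 := norm_ne_zero_iff.2 (sub_ne_zero.2 hXY)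
  have he : ‖(‖X - Y‖⁻¹ : ℝ) • (X - Y)‖ = 1 := by
    rw [norm_smul, norm_inv, norm_norm, inv_mul_cancel₀ hn]
  rw [← hw.refl0 hl he X]
  congr 1
  have h2 : 2 * inner ℝ (X - Y) X = ‖X - Y‖ ^ 2 := by
    rw [norm_sub_sq_real, inner_sub_left, real_inner_self_eq_norm_sq, h, real_inner_comm]; ring
  rw [sg, real_inner_smul_left, sub_zero, smul_smul]
  have : 2 * (‖X - Y‖⁻¹ * inner ℝ (X - Y) X) * ‖X - Y‖⁻¹ = 1 := by
    field_simp; linarith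
  rw [this]; module

theorem Cx.anti {lam M : ℝ} (hl : 1 < lam) (hM : 0 < M) {w : V4 → ℝ} (hw : Cx lam M w) {X Y : V4} (h : ‖X‖ < ‖Y‖) :
    w Y ≤ w X := by
  have hG := hw.nx.mx.gd
  have hwc := hw.nx.wcont
  have hXY : Y ≠ X := by rintro rfl; exact lt_irrefl _ h
  have hn : ‖Y - X‖ ≠ 0 := norm_ne_zero_iff.2 (sub_ne_zero.2 hXY)
  have hn0 : 0 < ‖Y - X‖ := norm_pos_iff.2 (sub_ne_zero.2 hXY)
  set e : V4 := (‖Y - X‖⁻¹ : ℝ) • (Y - X) with hedef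
  have he : ‖e‖ = 1 := by
    rw [norm_smul, norm_inv, norm_norm, inv_mul_cancel₀ hn]
  have he0 : e ≠ 0 := by intro h; rw [h, norm_zero] at he; norm_num at he
  set s : ℝ := ‖Y - X‖⁻¹ * ((‖Y‖ ^ 2 - ‖X‖ ^ 2) / 2) with hs
  have hs0 : 0 < s := by
    have : ‖X‖ ^ 2 < ‖Y‖ ^ 2 := by gcongr
    have : 0 < ‖Y‖ ^ 2 - ‖X‖ ^ 2 := by linarith
    positivity
  have hYs : inner ℝ e Y - s = ‖Y - X‖ / 2 := by
    rw [hedef, hs, real_inner_smul_left, inner_sub_left, real_inner_self_eq_norm_sq]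
    have : ‖Y - X‖ ^ 2 = ‖Y‖ ^ 2 - 2 * inner ℝ X Y + ‖X‖ ^ 2 := by
      rw [norm_sub_sq_real, real_inner_comm]
    field_simp; linarith
  have hsg : sg e s Y = X := by
    rw [sg, hYs, hedef, smul_smul, mul_div_cancel₀ _ two_ne_zero, mul_inv_cancel₀ hn]; module
  rcases hw.nx.polar hl he s with hp | hp
  · exfalso
    obtain ⟨X1, hX1⟩ := hw.nx.exists_pos hM
    have step : ∀ Z : V4, -s < inner ℝ e Z → w Z ≤ w (Z + (2 * s) • e) := by
      intro Z hZ
      have hee : inner ℝ e e = (1 : ℝ) := by rw [real_inner_self_eq_norm_sq, he]; norm_num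
      have h1 := hp (Z + (2 * s) • e) (by rw [inner_add_right, real_inner_smul_right, hee]; linarith)
      have h2 : sg e s (Z + (2 * s) • e) = sg e 0 Z := by
        rw [sg, sg, inner_add_right, real_inner_smul_right, hee]; module
      rw [h2, hw.refl0 hl he] at h1
      exact h1
    have hz : ∀ Z ∈ {Z : V4 | -s < inner ℝ e Z}, w Z = 0 := by
      refine no_mono hG.pos hG.i1 hwc (v := (2 * s) • e) (smul_ne_zero (by positivity) he0)
        (isOpen_lt continuous_const (by fun_prop)) ?_
      intro Z hZ n
      induction n with
      | zero => simp
      | succ n ih =>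
        refine ih.trans ?_
        have := step (Z + (n : ℝ) • (2 * s) • e) (by
          have hee : inner ℝ e e = (1 : ℝ) := by rw [real_inner_self_eq_norm_sq, he]; norm_num
          rw [inner_add_right, real_inner_smul_right, real_inner_smul_right, hee]
          have hZ' : -s < inner ℝ e Z := hZ
          have : 0 ≤ (n : ℝ) * (2 * s * 1) := by positivity
          linarith)
        have e2 : Z + ((n + 1 : ℕ) : ℝ) • (2 * s) • e = Z + (n : ℝ) • (2 * s) • e + (2 * s) • e := by
          push_cast; module
        rw [e2]; exact this
    rcases le_total 0 (inner ℝ e X1) with h1 | h1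
    · exact hX1 (hz X1 (by simp only [Set.mem_setOf_eq]; linarith))
    · refine hX1 ?_
      rw [← hw.even]
      exact hz _ (by simp only [Set.mem_setOf_eq, inner_neg_right]; linarith)
  · have := hp Y (by rw [hYs]; positivity)
    rwa [hsg] at this

end

section
theorem Pt_Pt {s t : ℝ} (hs : 0 < s) (ht : 0 < t) {h : V4 → ℝ} (hi : Integrable h) (X : V4) :
    Pt s (Pt t h) X = Pt (s + t) h X := by
  have i0 : Integrable (fun p : V4 × V4 => pt s (X - p.1) * (pt t (p.1 - p.2) * h p.2)) (volume.prod volume) := by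
    refine Integrable.bdd_mul (cv_prodint (pt_integrable ht) hi) (c := ((4 * π * s) ^ 2)⁻¹) ?_ ?_
    · exact ((pt_continuous s).comp (continuous_const.sub continuous_fst)).aestronglyMeasurable
    · exact Eventually.of_forall fun p => by
        rw [Real.norm_of_nonneg (pt_nonneg _ _)]; exact pt_le s hs _
  unfold Pt
  calc _ = ∫ Y, ∫ Z, pt s (X - Y) * (pt t (Y - Z) * h Z) := by
        congr 1; ext Y; rw [integral_const_mul]
    _ = ∫ Z, ∫ Y, pt s (X - Y) * (pt t (Y - Z) * h Z) :=
        integral_integral_swap (f := fun Y Z => pt s (X - Y) * (pt t (Y - Z) * h Z)) i0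
    _ = _ := by
        congr 1; ext Z
        rw [← pt_conv hs ht (X - Z), ← integral_mul_const,
          ← integral_add_right_eq_self (fun Y => pt s (X - Y) * (pt t (Y - Z) * h Z)) Z]
        congr 1; ext Y
        rw [add_sub_cancel_right, show X - (Y + Z) = X - Z - Y by abel]; ring

theorem Pt_joint {h : V4 → ℝ} (hm : Measurable h) : Measurable (fun p : V4 × ℝ => Pt p.2 h p.1) := by
  have : StronglyMeasurable (fun q : (V4 × ℝ) × V4 => pt q.1.2 (q.1.1 - q.2) * h q.2) := by
    refine Measurable.stronglyMeasurable ?_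
    refine Measurable.mul ?_ (hm.comp measurable_snd)
    exact pt_measurable2.comp ((measurable_snd.comp measurable_fst).prodMk
      ((measurable_fst.comp measurable_fst).sub measurable_snd))
  exact this.integral_prod_right'.measurable

theorem Pt_cv {s : ℝ} (hs : 0 < s) {h : V4 → ℝ} {c : ℝ} (hm : Measurable h) (hi : Integrable h)
    (hc : ∀ X, |h X| ≤ c) (X : V4) :
    Pt s (cv h) X = ∫ t in Set.Ioi (0 : ℝ), Real.exp (-t) * Pt (s + t) h X := by
  have hc' : ∀ᵐ X, |h X| ≤ c := Eventually.of_forall hc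
  have i0 : Integrable (fun p : V4 × ℝ => pt s (X - p.1) * (Real.exp (-p.2) * Pt p.2 h p.1))
      (volume.prod (volume.restrict (Set.Ioi 0))) := by
    have hd : Integrable (fun p : V4 × ℝ => pt s (X - p.1) * (c * Real.exp (-p.2)))
        (volume.prod (volume.restrict (Set.Ioi 0))) :=
      (pt_sub_integrable hs X).mul_prod (expneg_int.const_mul c)
    refine hd.mono' ?_ ?_
    · refine (Measurable.mul ?_ (Measurable.mul ?_ (Pt_joint hm))).aestronglyMeasurable
      · exact (pt_continuous s).measurable.comp (measurable_const.sub measurable_fst)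
      · exact (Real.continuous_exp.measurable).comp measurable_snd.neg
    · have h3 := (Measure.quasiMeasurePreserving_snd (μ := (volume : Measure V4))
        (ν := volume.restrict (Set.Ioi (0 : ℝ)))).ae (self_mem_ae_restrict measurableSet_Ioi)
      filter_upwards [h3] with p hp
      rw [norm_mul, norm_mul, Real.norm_of_nonneg (pt_nonneg _ _), Real.norm_of_nonneg (Real.exp_pos _).le,
        mul_comm c]
      refine mul_le_mul_of_nonneg_left (mul_le_mul_of_nonneg_left ?_ (Real.exp_pos _).le) (pt_nonneg _ _)
      exact Pt_abs_le hp hc' p.1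
  calc Pt s (cv h) X = ∫ Y, ∫ t in Set.Ioi (0 : ℝ), pt s (X - Y) * (Real.exp (-t) * Pt t h Y) := by
        rw [Pt]; congr 1; ext Y; rw [integral_const_mul, cv_eq_Pt hi.1 hc']
    _ = ∫ t in Set.Ioi (0 : ℝ), ∫ Y, pt s (X - Y) * (Real.exp (-t) * Pt t h Y) :=
        integral_integral_swap (f := fun Y t => pt s (X - Y) * (Real.exp (-t) * Pt t h Y)) i0
    _ = _ := by
        refine setIntegral_congr_fun measurableSet_Ioi fun t ht => ?_
        beta_reduce
        rw [← Pt_Pt hs ht hi X, Pt, ← integral_const_mul]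
        congr 1; ext Y; ring

theorem cv_split {s : ℝ} (hs : 0 < s) {h : V4 → ℝ} {c : ℝ} (hm : Measurable h) (hi : Integrable h)
    (hc : ∀ X, |h X| ≤ c) (X : V4) :
    cv h X = Real.exp (-s) * Pt s (cv h) X + ∫ t in Set.Ioc 0 s, Real.exp (-t) * Pt t h X := by
  have hc' : ∀ᵐ X, |h X| ≤ c := Eventually.of_forall hc
  have hIntg : IntegrableOn (fun t => Real.exp (-t) * Pt t h X) (Set.Ioi 0) := by
    refine (expneg_int.mul_const c).mono' ?_ ?_
    · exact (by fun_prop : Continuous fun t : ℝ => Real.exp (-t)).aestronglyMeasurable.mul (Pt_meas_t hi.1 X)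
    · filter_upwards [self_mem_ae_restrict measurableSet_Ioi] with t ht
      rw [norm_mul, Real.norm_of_nonneg (Real.exp_pos _).le]
      exact mul_le_mul_of_nonneg_left (Pt_abs_le ht hc' X) (Real.exp_pos _).le
  rw [cv_eq_Pt hi.1 hc', ← Set.Ioc_union_Ioi_eq_Ioi hs.le,
    setIntegral_union (Set.Ioc_disjoint_Ioi le_rfl) measurableSet_Ioi
      (hIntg.mono_set Set.Ioc_subset_Ioi_self) (hIntg.mono_set (Set.Ioi_subset_Ioi hs.le)), add_comm]
  congr 1
  rw [Pt_cv hs hm hi hc, ← integral_const_mul, ← integral_indicator measurableSet_Ioi,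
    ← integral_indicator measurableSet_Ioi,
    ← integral_add_right_eq_self ((Set.Ioi s).indicator fun t => Real.exp (-t) * Pt t h X) s]
  congr 1; ext t
  by_cases ht : 0 < t
  · rw [Set.indicator_of_mem (show t + s ∈ Set.Ioi s by simpa using ht),
      Set.indicator_of_mem (show t ∈ Set.Ioi 0 from ht), neg_add, Real.exp_add, add_comm s t]; ring
  · rw [Set.indicator_of_notMem (show t + s ∉ Set.Ioi s by simpa using ht),
      Set.indicator_of_notMem (show t ∉ Set.Ioi 0 from ht)]

theorem ext_le {h : V4 → ℝ} {c a : ℝ} (ha : 0 < a) (hhc : Continuous h) (hi : Integrable h)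
    (hc : ∀ X, |h X| ≤ c) (h0 : ∀ X, a ≤ ‖X‖ → h X = 0) (hsp : ∀ X, ‖X‖ = a → cv h X ≤ 0) :
    ∀ X, a ≤ ‖X‖ → cv h X ≤ 0 := by
  have hc' : ∀ᵐ X, |h X| ≤ c := Eventually.of_forall hc
  have hm := hhc.measurable
  set u := cv h with hu
  have huc : Continuous u := cv_cont hi hc'
  have hc0 : 0 ≤ c := (abs_nonneg _).trans (hc 0)
  have hub : ∀ X, |u X| ≤ c := by
    intro X
    rw [hu, cv_eq_Pt hi.1 hc', ← Real.norm_eq_abs]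
    refine (norm_integral_le_integral_norm _).trans ?_
    calc _ ≤ ∫ t in Set.Ioi (0 : ℝ), c * Real.exp (-t) := by
          refine integral_mono_of_nonneg (Eventually.of_forall fun _ => norm_nonneg _) (expneg_int.const_mul c) ?_
          filter_upwards [self_mem_ae_restrict measurableSet_Ioi] with t ht
          rw [norm_mul, Real.norm_of_nonneg (Real.exp_pos _).le, mul_comm]
          exact mul_le_mul_of_nonneg_right (Pt_abs_le ht hc' X) (Real.exp_pos _).le
      _ = c := by rw [integral_const_mul, expneg_integral, mul_one]
  by_contra hcon
  push Not at hcon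
  obtain ⟨X0, hX0, hpos⟩ := hcon
  set S : Set ℝ := u '' {X | a ≤ ‖X‖} with hS
  have hSb : BddAbove S := ⟨c, by rintro _ ⟨X, -, rfl⟩; exact (le_abs_self _).trans (hub X)⟩
  set m := sSup S with hmdef
  have hmle : ∀ X, a ≤ ‖X‖ → u X ≤ m := fun X hX => le_csSup hSb ⟨X, hX, rfl⟩
  have hm0 : 0 < m := lt_of_lt_of_le hpos (hmle X0 hX0)
  -- boundary layer
  obtain ⟨d, hd, hlay⟩ : ∃ d > 0, ∀ X, a ≤ ‖X‖ → ‖X‖ ≤ a + d → u X ≤ m / 2 := by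
    have huc' := (isCompact_closedBall (0 : V4) (a + 1)).uniformContinuousOn_of_continuous huc.continuousOn
    obtain ⟨δ, hδ, hδ'⟩ := Metric.uniformContinuousOn_iff.1 huc' (m / 2) (by positivity)
    refine ⟨min (δ / 2) 1, by positivity, fun X hX hX' => ?_⟩
    have hXp : 0 < ‖X‖ := by linarith
    set Z : V4 := (a / ‖X‖) • X with hZ
    have hZn : ‖Z‖ = a := by
      rw [hZ, norm_smul, Real.norm_of_nonneg (by positivity)]; field_simp
    have hXZ : dist X Z < δ := by
      have e : X - Z = (1 - a / ‖X‖) • X := by rw [hZ]; module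
      have h1 : a / ‖X‖ ≤ 1 := (div_le_one hXp).2 hX
      rw [dist_eq_norm, e, norm_smul, Real.norm_of_nonneg (by linarith), sub_mul, one_mul,
        div_mul_cancel₀ _ hXp.ne']
      have := min_le_left (δ / 2) 1
      linarith
    have := hδ' X (by
      rw [mem_closedBall_zero_iff]; have := min_le_right (δ / 2) 1; linarith) Z (by
      rw [mem_closedBall_zero_iff]; linarith) hXZ
    rw [Real.dist_eq] at this
    have h2 := (abs_lt.1 this).2
    have h3 := hsp Z hZn
    linarith
  set V := (volume (Metric.ball (0 : V4) a)).toReal with hV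
  have hV0 : 0 ≤ V := ENNReal.toReal_nonneg
  set K := c * ((4 ^ 2 * 24 / d ^ 8) * V) with hK
  have hK0 : 0 ≤ K := by positivity
  -- estimate of gaussian averages away from the ball
  have est : ∀ X, a + d ≤ ‖X‖ → ∀ t, 0 < t → ∀ g : V4 → ℝ, Integrable g → ∀ b : ℝ, 0 ≤ b → (∀ Y, |g Y| ≤ c) →
      (∀ Y, a ≤ ‖Y‖ → g Y ≤ b) → Pt t g X ≤ b + K * t ^ 2 := by
    intro X hX t ht g hg b hb hgc hgb
    set B := Metric.ball (0 : V4) a with hB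
    have jp := pt_sub_integrable ht X
    have j2 : Integrable (B.indicator fun _ : V4 => c * ((4 ^ 2 * 24 / d ^ 8) * t ^ 2)) :=
      (integrable_indicator_iff measurableSet_ball).2 (integrableOn_const measure_ball_lt_top.ne)
    have j1 : Integrable (fun Y => b * pt t (X - Y)) := jp.const_mul b
    have j3 : Integrable (fun Y => pt t (X - Y) * g Y) := by
      refine Integrable.bdd_mul hg (c := ((4 * π * t) ^ 2)⁻¹) jp.1 ?_
      exact Eventually.of_forall fun p => by
        rw [Real.norm_of_nonneg (pt_nonneg _ _)]; exact pt_le t ht _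
    calc Pt t g X ≤ ∫ Y, (b * pt t (X - Y) + B.indicator (fun _ => c * ((4 ^ 2 * 24 / d ^ 8) * t ^ 2)) Y) := by
          refine integral_mono j3 (j1.add j2) fun Y => ?_
          beta_reduce
          by_cases hY : Y ∈ B
          · rw [Set.indicator_of_mem hY]
            rw [hB, mem_ball_zero_iff] at hY
            have hdist : d ≤ ‖X - Y‖ := by
              have := norm_sub_norm_le X Y; linarith
            have h1 := pt_le4 ht hd hdist
            have h2 : g Y ≤ c := (le_abs_self _).trans (hgc Y)
            have h3 : pt t (X - Y) * g Y ≤ pt t (X - Y) * c := mul_le_mul_of_nonneg_left h2 (pt_nonneg _ _)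
            have h4 : c * pt t (X - Y) ≤ c * ((4 ^ 2 * 24 / d ^ 8) * t ^ 2) := mul_le_mul_of_nonneg_left h1 hc0
            have h5 := mul_nonneg hb (pt_nonneg t (X - Y))
            linarith
          · rw [Set.indicator_of_notMem hY, add_zero, mul_comm]
            rw [hB, mem_ball_zero_iff, not_lt] at hY
            exact mul_le_mul_of_nonneg_right (hgb Y hY) (pt_nonneg _ _)
      _ = b + K * t ^ 2 := by
          rw [integral_add j1 j2, integral_const_mul, integral_sub_left_eq_self (pt t) volume X, pt_integral ht,
            integral_indicator measurableSet_ball, setIntegral_const, smul_eq_mul, measureReal_def, ← hV, hK]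
          ring
  have hui : Integrable u := cv_integrable hi
  have main : ∀ s, 0 < s → s ≤ 1 / 2 → m ≤ Real.exp (-s) * (m + K * s ^ 2) + K * s ^ 3 := by
    intro s hs hs1
    set rhs := Real.exp (-s) * (m + K * s ^ 2) + K * s ^ 3 with hr
    have hhalf : m / 2 ≤ rhs := by
      have h2 : 1 / 2 ≤ Real.exp (-s) := by
        have := Real.add_one_le_exp (-s); linarith
      have h4 : 0 ≤ K * s ^ 3 := by positivity
      have h5 : 0 ≤ K * s ^ 2 := by positivity
      nlinarith [Real.exp_pos (-s)]
    refine csSup_le ⟨_, X0, hX0, rfl⟩ ?_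
    rintro _ ⟨X, hX, rfl⟩
    by_cases hXd : ‖X‖ ≤ a + d
    · exact (hlay X hX hXd).trans hhalf
    · push Not at hXd
      rw [hu, cv_split hs hm hi hc, ← hu]
      refine add_le_add (mul_le_mul_of_nonneg_left (est X hXd.le s hs u hui m hm0.le hub hmle) (Real.exp_pos _).le) ?_
      calc _ ≤ ∫ t in Set.Ioc 0 s, K * s ^ 2 := by
            have hle : ∀ t ∈ Set.Ioc 0 s, Real.exp (-t) * Pt t h X ≤ K * s ^ 2 := by
              intro t ht
              have h1 := est X hXd.le t ht.1 h hi 0 le_rfl hc (fun Y hY => (h0 Y hY).le)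
              have h2 : K * t ^ 2 ≤ K * s ^ 2 := by
                have := ht.1; have := ht.2; gcongr
              have h3 : Real.exp (-t) ≤ 1 := Real.exp_le_one_iff.2 (by linarith [ht.1])
              have h4 : 0 ≤ K * s ^ 2 := by positivity
              have h5 : Pt t h X ≤ K * s ^ 2 := by linarith
              nlinarith [Real.exp_pos (-t)]
            refine setIntegral_mono_on ?_ (integrableOn_const (by simp)) measurableSet_Ioc hle
            refine Integrable.mono' (integrableOn_const (C := c) (by simp)) ?_ ?_
            · exact ((by fun_prop : Continuous fun t : ℝ => Real.exp (-t)).aestronglyMeasurable.mul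
                ((Pt_meas_t hi.1 X).mono_measure (Measure.restrict_mono Set.Ioc_subset_Ioi_self le_rfl)))
            · filter_upwards [self_mem_ae_restrict measurableSet_Ioc] with t ht
              rw [norm_mul, Real.norm_of_nonneg (Real.exp_pos _).le]
              have h3 : Real.exp (-t) ≤ 1 := Real.exp_le_one_iff.2 (by linarith [ht.1])
              have h4 := Pt_abs_le ht.1 hc' X
              rw [← Real.norm_eq_abs] at h4
              nlinarith [Real.exp_pos (-t), norm_nonneg (Pt t h X)]
        _ = K * s ^ 3 := by
            rw [setIntegral_const, smul_eq_mul, measureReal_def, Real.volume_Ioc, sub_zero,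
              ENNReal.toReal_ofReal hs.le]; ring
  -- conclusion
  have fin : ∀ s, 0 < s → s ≤ 1 / 2 → m / 2 ≤ 2 * K * s := by
    intro s hs hs1
    have h1 := main s hs hs1
    have h2 : Real.exp (-s) ≤ 1 - s / 2 := by
      have := Real.abs_exp_sub_one_sub_id_le (x := -s) (by rw [abs_neg, abs_of_pos hs]; linarith)
      have := (abs_le.1 this).2
      nlinarith
    have h3 : Real.exp (-s) ≤ 1 := by linarith
    have h4 : 0 ≤ K * s ^ 2 := by positivity
    have h5 : Real.exp (-s) * (K * s ^ 2) ≤ K * s ^ 2 := by nlinarith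
    have h6 : Real.exp (-s) * m ≤ (1 - s / 2) * m := mul_le_mul_of_nonneg_right h2 hm0.le
    have h7 : K * s ^ 3 ≤ K * s ^ 2 := by
      have : s ^ 3 ≤ s ^ 2 := pow_le_pow_of_le_one hs.le (by linarith) (by norm_num)
      gcongr
    have h8 : s * (m / 2) ≤ s * (2 * K * s) := by nlinarith
    exact le_of_mul_le_mul_left h8 hs
  have := fin (min (1 / 2) (m / (8 * (K + 1)))) (by positivity) (min_le_left _ _)
  have h2 : min (1 / 2) (m / (8 * (K + 1))) ≤ m / (8 * (K + 1)) := min_le_right _ _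
  have h3 : 2 * K * min (1 / 2) (m / (8 * (K + 1))) ≤ 2 * (K + 1) * (m / (8 * (K + 1))) := by
    have : 0 ≤ min (1 / 2) (m / (8 * (K + 1))) := by positivity
    gcongr; linarith
  have h4 : 2 * (K + 1) * (m / (8 * (K + 1))) = m / 4 := by field_simp; norm_num
  linarith

end

section
open FourierTransform in
theorem pt_fourier {t : ℝ} (ht : 0 < t) (ξ : V4) :
    𝓕 (fun X : V4 => ((pt t X : ℝ) : ℂ)) ξ = ((Real.exp (-(4 * π ^ 2 * ‖ξ‖ ^ 2) * t) : ℝ) : ℂ) := by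
  have hb : 0 < (((1 / (4 * t) : ℝ)) : ℂ).re := by rw [Complex.ofReal_re]; positivity
  have key := fourier_gaussian_innerProductSpace hb ξ
  have e : (fun X : V4 => ((pt t X : ℝ) : ℂ)) =
      fun X => ((((4 * π * t) ^ 2)⁻¹ : ℝ) : ℂ) • Complex.exp (-(((1 / (4 * t) : ℝ)) : ℂ) * ‖X‖ ^ 2) := by
    ext X
    unfold pt
    rw [Complex.ofReal_mul, Complex.ofReal_exp, smul_eq_mul]
    congr 2
    push_cast
    field_simp
  rw [e, Real.fourier_eq]
  have : ∀ v : V4, Real.fourierChar (-inner ℝ v ξ) • ((((4 * π * t) ^ 2)⁻¹ : ℝ) : ℂ) •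
      Complex.exp (-(((1 / (4 * t) : ℝ)) : ℂ) * ‖v‖ ^ 2) = ((((4 * π * t) ^ 2)⁻¹ : ℝ) : ℂ) •
      Real.fourierChar (-inner ℝ v ξ) • Complex.exp (-(((1 / (4 * t) : ℝ)) : ℂ) * ‖v‖ ^ 2) := by
    intro v; rw [smul_comm]
  simp_rw [this]
  rw [integral_smul, ← Real.fourier_eq, key]
  have hfr : ((Module.finrank ℝ V4 : ℕ) : ℂ) / 2 = ((2 : ℕ) : ℂ) := by
    simp [V4]; norm_num
  rw [hfr, Complex.cpow_natCast, smul_eq_mul, ← mul_assoc]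
  have ht' : (t : ℂ) ≠ 0 := by exact_mod_cast ht.ne'
  have hpi : (π : ℂ) ≠ 0 := by exact_mod_cast Real.pi_ne_zero
  have h1 : ((((4 * π * t) ^ 2)⁻¹ : ℝ) : ℂ) * ((π : ℂ) / ((1 / (4 * t) : ℝ) : ℂ)) ^ 2 = 1 := by
    push_cast; field_simp
  rw [h1, one_mul, Complex.ofReal_exp]
  congr 1
  push_cast
  field_simp

open FourierTransform in
theorem kk_fourier (ξ : V4) :
    𝓕 (fun X : V4 => ((kk X : ℝ) : ℂ)) ξ = ((1 / (1 + 4 * π ^ 2 * ‖ξ‖ ^ 2) : ℝ) : ℂ) := by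
  rw [Real.fourier_eq]
  have e : ∀ v : V4, Real.fourierChar (-inner ℝ v ξ) • ((kk v : ℝ) : ℂ) =
      ∫ t in Set.Ioi (0 : ℝ), Real.fourierChar (-inner ℝ v ξ) • ((Real.exp (-t) * pt t v : ℝ) : ℂ) := by
    intro v
    unfold kk
    simp only [Circle.smul_def]
    rw [integral_smul, integral_complex_ofReal]
  simp_rw [e]
  rw [integral_integral_swap (f := fun (v : V4) (t : ℝ) =>
    Real.fourierChar (-inner ℝ v ξ) • ((Real.exp (-t) * pt t v : ℝ) : ℂ))]
  · have : ∀ t ∈ Set.Ioi (0 : ℝ), ∫ v : V4, Real.fourierChar (-inner ℝ v ξ) • ((Real.exp (-t) * pt t v : ℝ) : ℂ) =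
        ((Real.exp (-(1 + 4 * π ^ 2 * ‖ξ‖ ^ 2) * t) : ℝ) : ℂ) := by
      intro t ht
      have h1 : ∀ v : V4, Real.fourierChar (-inner ℝ v ξ) • ((Real.exp (-t) * pt t v : ℝ) : ℂ) =
        ((Real.exp (-t) : ℝ) : ℂ) • Real.fourierChar (-inner ℝ v ξ) • ((pt t v : ℝ) : ℂ) := by
        intro v; rw [Complex.ofReal_mul, smul_comm, smul_eq_mul]
      simp_rw [h1]
      rw [integral_smul, ← Real.fourier_eq (fun v : V4 => ((pt t v : ℝ) : ℂ)), pt_fourier ht, smul_eq_mul,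
        ← Complex.ofReal_mul, ← Real.exp_add]
      congr 2; ring
    rw [setIntegral_congr_fun measurableSet_Ioi this, integral_complex_ofReal, integral_exp_mul_Ioi (by
      have : 0 ≤ 4 * π ^ 2 * ‖ξ‖ ^ 2 := by positivity
      linarith)]
    congr 1
    have : 0 < 1 + 4 * π ^ 2 * ‖ξ‖ ^ 2 := by positivity
    simp
    rw [← neg_add_rev, neg_div_neg_eq, one_div, add_comm]
  · have := kkprod_int.ofReal (𝕜 := ℂ)
    refine this.mono ?_ ?_
    · have hc : Continuous fun p : V4 × ℝ => (Real.fourierChar (-inner ℝ p.1 ξ) : Circle) :=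
        Real.continuous_fourierChar.comp (by fun_prop)
      exact hc.aestronglyMeasurable.smul this.1
    · exact Eventually.of_forall fun p => by
        simp only [Function.uncurry]; rw [Circle.norm_smul]; rfl

open FourierTransform in
theorem zero_of_eigen {lam : ℝ} (hl : 0 < lam) {h : V4 → ℝ} (hc : Continuous h) (hi : Integrable h)
    (he : ∀ X, h X = lam * cv h X) : ∀ X, h X = 0 := by
  set H : V4 → ℂ := fun X => ((h X : ℝ) : ℂ) with hH
  set k : V4 → ℂ := fun X => ((kk X : ℝ) : ℂ) with hk
  have hHi : Integrable H := hi.ofReal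
  have hki : Integrable k := kk_integrable.ofReal
  have hHc : Continuous H := Complex.continuous_ofReal.comp hc
  have e1 : H = fun X => (lam : ℂ) • (convolution k H (ContinuousLinearMap.mul ℂ ℂ) volume) X := by
    ext X
    rw [convolution_eq_swap, hH]
    simp only [ContinuousLinearMap.mul_apply']
    rw [he X, cv, smul_eq_mul, Complex.ofReal_mul, ← integral_complex_ofReal]
    congr 2
    ext Y
    rw [hk]; push_cast; rfl
  have e2 : ∀ ξ, 𝓕 H ξ = (lam : ℂ) * (((1 / (1 + 4 * π ^ 2 * ‖ξ‖ ^ 2) : ℝ) : ℂ) * 𝓕 H ξ) := by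
    intro ξ
    conv_lhs => rw [e1]
    rw [← kk_fourier ξ, ← Real.fourier_mul_convolution_eq hki hHi ξ, Real.fourier_eq, Real.fourier_eq,
      ← smul_eq_mul, ← integral_smul]
    congr 1
    ext v
    rw [smul_comm]
  have e3 : ∀ ξ, ‖ξ‖ ≠ Real.sqrt ((lam - 1) / (4 * π ^ 2)) → 𝓕 H ξ = 0 := by
    intro ξ hξ
    by_contra hne
    have h1 := e2 ξ
    rw [← mul_assoc] at h1
    have h2 : (lam : ℂ) * ((1 / (1 + 4 * π ^ 2 * ‖ξ‖ ^ 2) : ℝ) : ℂ) = 1 :=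
      mul_right_cancel₀ hne (by rw [one_mul]; exact h1.symm)
    have h3 : lam * (1 / (1 + 4 * π ^ 2 * ‖ξ‖ ^ 2)) = 1 := by exact_mod_cast h2
    have h4 : 0 < 1 + 4 * π ^ 2 * ‖ξ‖ ^ 2 := by positivity
    field_simp at h3
    apply hξ
    rw [h3, show (1 + 4 * π ^ 2 * ‖ξ‖ ^ 2 - 1) / (4 * π ^ 2) = ‖ξ‖ ^ 2 by field_simp; ring,
      Real.sqrt_sq (norm_nonneg _)]
  have e4 : 𝓕 H =ᵐ[volume] 0 := by
    have hs := Measure.addHaar_sphere (volume : Measure V4) 0 (Real.sqrt ((lam - 1) / (4 * π ^ 2)))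
    rw [measure_eq_zero_iff_ae_notMem] at hs
    filter_upwards [hs] with ξ hξ
    exact e3 ξ (by simpa using hξ)
  have e5 := hHc.fourierInv_fourier_eq hHi ((integrable_zero _ _ _).congr e4.symm)
  intro X
  have e6 : 𝓕⁻ (𝓕 H) X = 0 := by
    rw [Real.fourierInv_eq]
    rw [integral_congr_ae (g := fun _ => (0 : ℂ))]
    · simp
    · filter_upwards [e4] with v hv
      rw [hv]; simp
  rw [e5, hH] at e6
  exact Complex.ofReal_eq_zero.1 e6

end

section
theorem Nx.le_all {lam M : ℝ} {w : V4 → ℝ} (hw : Nx lam M w) : ∃ c : ℝ, 0 ≤ c ∧ ∀ X, |w X| ≤ c := by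
  obtain ⟨c, hc0, hc⟩ := hw.bdd
  refine ⟨c, hc0, ?_⟩
  have h1 : (fun X => max (w X) c) = fun _ => c :=
    ((hw.wcont.max continuous_const).ae_eq_iff_eq volume continuous_const).1 (by
      filter_upwards [hc] with X hX; exact max_eq_right hX)
  intro X
  rw [abs_of_nonneg (hw.mx.gd.pos X)]
  have := congrFun h1 X
  rw [← this]; exact le_max_left _ _

theorem Cx.supp {lam M : ℝ} (hl : 1 < lam) (hM : 0 < M) {w : V4 → ℝ} (hw : Cx lam M w) :
    ∃ a : ℝ, 0 < a ∧ (∀ X, ‖X‖ < a → 0 < w X) ∧ ∀ X, a ≤ ‖X‖ → w X = 0 := by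
  have hG := hw.nx.mx.gd
  have hwc := hw.nx.wcont
  have l0 : 0 < lam := by linarith
  have hW : 0 < 2 * CC lam * M := by have := CC_pos hl; positivity
  have hcl : IsClosed {X | w X = 0} := isClosed_eq hwc continuous_const
  have hne : {X | w X = 0}.Nonempty := by
    by_contra hemp
    rw [Set.not_nonempty_iff_eq_empty] at hemp
    have hge : ∀ X, 2 * CC lam * M ≤ cv w X := by
      intro X
      by_contra hlt
      push Not at hlt
      have : X ∈ {X | w X = 0} := by
        show w X = 0
        rw [hw.nx.el, max_eq_right (by linarith), mul_zero]
      rw [hemp] at this; exact this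
    have hic := cv_integrable hG.i1
    have : Integrable (fun _ : V4 => 2 * CC lam * M) := hic.mono' (by fun_prop) (Eventually.of_forall fun X => by
      rw [Real.norm_of_nonneg hW.le]; exact hge X)
    rw [integrable_const_iff] at this
    rcases this with h | h
    · exact hW.ne' h
    · have := h.measure_univ_lt_top
      simp at this
  obtain ⟨Z, hZ, hd⟩ := hcl.exists_infDist_eq_dist hne 0
  have hZ0 : w Z = 0 := hZ
  have hout : ∀ X, ‖Z‖ ≤ ‖X‖ → w X = 0 := by
    intro X hX
    rcases hX.lt_or_eq with h | h
    · have := hw.anti hl hM h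
      rw [hZ0] at this
      exact le_antisymm this (hG.pos X)
    · rw [hw.radial hl h.symm, hZ0]
  refine ⟨‖Z‖, ?_, ?_, hout⟩
  · by_contra hn
    have : ‖Z‖ = 0 := le_antisymm (not_lt.1 hn) (norm_nonneg _)
    obtain ⟨X, hX⟩ := hw.nx.exists_pos hM
    exact hX (hout X (by rw [this]; exact norm_nonneg _))
  · intro X hX
    refine lt_of_le_of_ne (hG.pos X) fun h => ?_
    have h1 := Metric.infDist_le_dist_of_mem (x := (0 : V4)) (s := {X | w X = 0}) (y := X) h.symm
    rw [hd, dist_zero_left, dist_zero_left] at h1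
    linarith

theorem kkw_int {w : V4 → ℝ} (hw : Continuous w) {c : ℝ} (hc : ∀ X, |w X| ≤ c) (X : V4) :
    Integrable (fun Y => kk (X - Y) * w Y) := by
  have h1 : Integrable (fun Y => kk (X - Y)) := kk_integrable.comp_sub_left X
  exact Integrable.mul_bdd h1 (c := c) hw.aestronglyMeasurable (Eventually.of_forall fun Y => hc Y)

theorem Nx.ell {lam M : ℝ} (hl : 1 < lam) {w : V4 → ℝ} (hw : Nx lam M w) (X : V4) :
    cv w X - w X / lam ≤ 2 * CC lam * M ∧ (0 < w X → cv w X - w X / lam = 2 * CC lam * M) := by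
  have l0 : 0 < lam := by linarith
  have h := hw.el X
  rcases le_total (cv w X - 2 * CC lam * M) 0 with h1 | h1
  · rw [max_eq_right h1, mul_zero] at h
    rw [h]; refine ⟨by simp; linarith, fun h => absurd h (lt_irrefl _)⟩
  · rw [max_eq_left h1] at h
    have : w X / lam = cv w X - 2 * CC lam * M := by rw [h]; field_simp
    rw [this]; exact ⟨by linarith, fun _ => by ring⟩

theorem Cx.unique_aux {lam M : ℝ} (hl : 1 < lam) {w1 w2 : V4 → ℝ} (h1 : Cx lam M w1) (h2 : Cx lam M w2)
    {a1 a2 : ℝ} (ha1 : 0 < a1) (hle : a1 ≤ a2)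
    (p1 : ∀ X, ‖X‖ < a1 → 0 < w1 X) (z1 : ∀ X, a1 ≤ ‖X‖ → w1 X = 0)
    (p2 : ∀ X, ‖X‖ < a2 → 0 < w2 X) (z2 : ∀ X, a2 ≤ ‖X‖ → w2 X = 0) : w1 = w2 := by
  have l0 : 0 < lam := by linarith
  have ha : 0 < a2 := by linarith
  set W := 2 * CC lam * M with hW
  have c1 := h1.nx.wcont
  have c2 := h2.nx.wcont
  have G1 := h1.nx.mx.gd
  have G2 := h2.nx.mx.gd
  have k1 := h1.nx.cont
  have k2 := h2.nx.cont
  obtain ⟨b1, hb1, B1⟩ := h1.nx.le_all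
  obtain ⟨b2, hb2, B2⟩ := h2.nx.le_all
  have hi12 : Integrable (fun X => w1 X * w2 X) :=
    Integrable.mul_bdd G1.i1 (c := b2) c2.aestronglyMeasurable (Eventually.of_forall fun Y => B2 Y)
  have hBB : BB kk w1 w2 = BB kk w2 w1 := BB_comm kk_neg
  have e12 := BB_eq kk_integrable G1.i2 G2.i2
  have e21 := BB_eq kk_integrable G2.i2 G1.i2
  have i1cv2 : Integrable (fun X => w1 X * cv w2 X) :=
    Integrable.bdd_mul (cv_integrable G2.i1) (c := b1) c1.aestronglyMeasurable (Eventually.of_forall fun Y => B1 Y)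
  have i2cv1 : Integrable (fun X => w2 X * cv w1 X) :=
    Integrable.bdd_mul (cv_integrable G1.i1) (c := b2) c2.aestronglyMeasurable (Eventually.of_forall fun Y => B2 Y)
  have m1 : ∫ X, w1 X * cv w2 X = (∫ X, w1 X * w2 X) / lam + W * M := by
    have : ∀ X, w1 X * cv w2 X = w1 X * w2 X / lam + W * w1 X := by
      intro X
      by_cases hX : ‖X‖ < a1
      · have := (h2.nx.ell hl X).2 (p2 X (by linarith))
        rw [← hW] at this
        have : cv w2 X = W + w2 X / lam := by linarith
        rw [this]; ring
      · rw [z1 X (not_lt.1 hX)]; simp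
    simp_rw [this]
    have jj : Integrable (fun X => w1 X * w2 X / lam) := hi12.div_const lam
    rw [integral_add jj (G1.i1.const_mul W), integral_div, integral_const_mul, h1.nx.mx.mass]
  have m2 : ∫ X, w2 X * cv w1 X = (∫ X, w1 X * w2 X) / lam + W * M := by
    rw [← m1]
    exact (e21.symm.trans hBB.symm).trans e12
  have hnn : ∀ X, 0 ≤ w2 X * (W - (cv w1 X - w1 X / lam)) := fun X =>
    mul_nonneg (G2.pos X) (by have := (h1.nx.ell hl X).1; rw [← hW] at this; linarith)
  have hz : ∫ X, w2 X * (W - (cv w1 X - w1 X / lam)) = 0 := by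
    have : ∀ X, w2 X * (W - (cv w1 X - w1 X / lam)) = (W * w2 X - w2 X * cv w1 X) + w1 X * w2 X / lam := by
      intro X; ring
    simp_rw [this]
    have j1 : Integrable (fun X => W * w2 X - w2 X * cv w1 X) := (G2.i1.const_mul W).sub i2cv1
    have jj : Integrable (fun X => w1 X * w2 X / lam) := hi12.div_const lam
    rw [integral_add j1 jj, integral_sub (G2.i1.const_mul W) i2cv1, integral_div, integral_const_mul,
      h2.nx.mx.mass, m2]; ring
  have hcz : Continuous fun X => w2 X * (W - (cv w1 X - w1 X / lam)) := by fun_prop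
  have hiz : Integrable fun X => w2 X * (W - (cv w1 X - w1 X / lam)) := by
    have : ∀ X, w2 X * (W - (cv w1 X - w1 X / lam)) = (W * w2 X - w2 X * cv w1 X) + w1 X * w2 X / lam := by
      intro X; ring
    simp_rw [this]
    exact ((G2.i1.const_mul W).sub i2cv1).add (hi12.div_const lam)
  have hz' : ∀ X, w2 X * (W - (cv w1 X - w1 X / lam)) = 0 := by
    have h := (integral_eq_zero_iff_of_nonneg hnn hiz).1 hz
    have := (hcz.ae_eq_iff_eq volume continuous_zero).1 h
    exact fun X => congrFun this X
  set h : V4 → ℝ := fun X => w1 X - w2 X with hh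
  have hhc : Continuous h := c1.sub c2
  have hhi : Integrable h := G1.i1.sub G2.i1
  have hcvh : ∀ X, cv h X = cv w1 X - cv w2 X := by
    intro X
    unfold cv
    rw [← integral_sub (kkw_int c1 B1 X) (kkw_int c2 B2 X)]
    congr 1; ext Y; rw [hh]; ring
  have hin : ∀ X, ‖X‖ < a2 → cv h X = h X / lam := by
    intro X hX
    have q1 := hz' X
    have q2 := p2 X hX
    have q3 : W - (cv w1 X - w1 X / lam) = 0 := by
      rcases mul_eq_zero.1 q1 with q | q
      · exact absurd q q2.ne'
      · exact q
    have q4 := (h2.nx.ell hl X).2 q2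
    rw [← hW] at q4
    rw [hcvh, hh]; simp only; rw [sub_div]; linarith
  have hcvc : Continuous (cv h) := by
    rw [show cv h = fun X => cv w1 X - cv w2 X from funext hcvh]; exact k1.sub k2
  have hcb : ∀ X, ‖X‖ ≤ a2 → cv h X = h X / lam := by
    have hcls : IsClosed {X | cv h X = h X / lam} := isClosed_eq hcvc (hhc.div_const lam)
    have hsub : Metric.ball (0 : V4) a2 ⊆ {X | cv h X = h X / lam} := fun X hX => hin X (by simpa using hX)
    have := closure_minimal hsub hcls
    rw [closure_ball _ ha.ne'] at this
    exact fun X hX => this (by simpa using hX)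
  have h0 : ∀ X, a2 ≤ ‖X‖ → h X = 0 := fun X hX => by
    rw [hh]; simp only; rw [z1 X (by linarith), z2 X hX, sub_zero]
  have hhb : ∀ X, |h X| ≤ b1 + b2 := fun X => by
    rw [hh]; exact (abs_sub _ _).trans (add_le_add (B1 X) (B2 X))
  have hsp : ∀ X, ‖X‖ = a2 → cv h X = 0 := fun X hX => by rw [hcb X hX.le, h0 X hX.ge, zero_div]
  have hle0 := ext_le ha hhc hhi hhb h0 (fun X hX => (hsp X hX).le)
  have hcvn : ∀ X, cv (fun Y => - h Y) X = - cv h X := by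
    intro X; unfold cv; rw [← integral_neg]; congr 1; ext Y; ring
  have hge0 := ext_le (h := fun X => - h X) (c := b1 + b2) ha hhc.neg hhi.neg (fun X => by rw [abs_neg]; exact hhb X)
    (fun X hX => by rw [h0 X hX, neg_zero]) (fun X hX => by rw [hcvn, hsp X hX, neg_zero])
  have hall : ∀ X, h X = lam * cv h X := by
    intro X
    rcases le_total ‖X‖ a2 with hX | hX
    · rw [hcb X hX]; field_simp
    · have q1 := hle0 X hX
      have q2 := hge0 X hX
      rw [hcvn] at q2
      rw [h0 X hX, show cv h X = 0 by linarith, mul_zero]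
  have hfin := zero_of_eigen l0 hhc hhi hall
  ext X
  have := hfin X
  rw [hh] at this; simp only at this; linarith

theorem Cx.unique {lam M : ℝ} (hl : 1 < lam) (hM : 0 < M) {w1 w2 : V4 → ℝ} (h1 : Cx lam M w1) (h2 : Cx lam M w2) :
    w1 = w2 := by
  obtain ⟨a1, ha1, p1, z1⟩ := h1.supp hl hM
  obtain ⟨a2, ha2, p2, z2⟩ := h2.supp hl hM
  rcases le_total a1 a2 with h | h
  · exact h1.unique_aux hl h2 ha1 h p1 z1 p2 z2
  · exact (h2.unique_aux hl h1 ha2 h p2 z2 p1 z1).symm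

/-- any maximizer is a.e. a translate of the centred one -/
theorem Mx.translate {lam M : ℝ} (hl : 1 < lam) (hM : 0 < M) {ws w : V4 → ℝ} (hs : Cx lam M ws) (hw : Mx lam M w) :
    ∃ c : V4, w =ᵐ[volume] fun X => ws (X - c) := by
  obtain ⟨w', h1, h2⟩ := hw.normal hl hM
  obtain ⟨c, hc⟩ := h2.exists_Cx hl hM
  have := hc.unique hl hM hs
  refine ⟨c, h1.trans (Eventually.of_forall fun X => ?_)⟩
  rw [← this]; simp

theorem exists_Cx {lam M : ℝ} (hl : 1 < lam) (hM : 0 < M) : ∃ w, Cx lam M w := by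
  obtain ⟨w, hw⟩ := exists_Mx hl hM
  obtain ⟨w', -, h2⟩ := hw.normal hl hM
  obtain ⟨c, hc⟩ := h2.exists_Cx hl hM
  exact ⟨_, hc⟩

end

section
/-- squared distance in the plane -/
noncomputable def d2 (x y : ℝ × ℝ) : ℝ := (x.1 - y.1) ^ 2 + (x.2 - y.2) ^ 2

noncomputable def hk2 (t d : ℝ) : ℝ := (4 * π * t)⁻¹ * Real.exp (-d / (4 * t))

theorem hk2_int {d : ℝ} (hd : 0 < d) : IntegrableOn (fun t => Real.exp (-t) * hk2 t d) (Set.Ioi 0) := by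
  have h1 : IntegrableOn (fun t : ℝ => Real.exp (-t) * (1 / (π * d))) (Set.Ioi 0) := expneg_int.mul_const _
  refine Integrable.mono' h1 ?_ ?_
  · unfold hk2
    exact (by fun_prop : Measurable _).aestronglyMeasurable
  · filter_upwards [self_mem_ae_restrict measurableSet_Ioi] with t ht
    have ht' : 0 < t := ht
    rw [Real.norm_of_nonneg (by unfold hk2; positivity)]
    refine mul_le_mul_of_nonneg_left ?_ (Real.exp_pos _).le
    unfold hk2
    have h2 : d / (4 * t) * Real.exp (-d / (4 * t)) ≤ 1 := by
      have h3 := Real.add_one_le_exp (d / (4 * t))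
      rw [neg_div, Real.exp_neg, ← div_eq_mul_inv, div_le_one (Real.exp_pos _)]
      linarith
    calc (4 * π * t)⁻¹ * Real.exp (-d / (4 * t)) = (d / (4 * t) * Real.exp (-d / (4 * t))) * (1 / (π * d)) := by
          field_simp
      _ ≤ 1 * (1 / (π * d)) := mul_le_mul_of_nonneg_right h2 (by positivity)
      _ = _ := one_mul _

theorem K0_rep {r : ℝ} (hr : 0 < r) :
    (1 / (2 * π)) * K0 r = ∫ t in Set.Ioi (0 : ℝ), Real.exp (-t) * hk2 t (r ^ 2) := by
  have himg : (fun s : ℝ => r / 2 * Real.exp s) '' Set.univ = Set.Ioi 0 := by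
    ext t
    simp only [Set.image_univ, Set.mem_range, Set.mem_Ioi]
    constructor
    · rintro ⟨s, rfl⟩; positivity
    · intro ht
      exact ⟨Real.log (2 * t / r), by rw [Real.exp_log (by positivity)]; field_simp⟩
  have hder : ∀ s ∈ (Set.univ : Set ℝ), HasDerivWithinAt (fun s : ℝ => r / 2 * Real.exp s) (r / 2 * Real.exp s) Set.univ s :=
    fun s _ => ((Real.hasDerivAt_exp s).const_mul (r / 2)).hasDerivWithinAt
  have hinj : Set.InjOn (fun s : ℝ => r / 2 * Real.exp s) Set.univ := by
    intro a _ b _ hab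
    exact Real.exp_injective (mul_left_cancel₀ (by positivity) hab)
  rw [← himg, integral_image_eq_integral_abs_deriv_smul MeasurableSet.univ hder hinj, setIntegral_univ]
  have e1 : ∀ s : ℝ, |r / 2 * Real.exp s| • (Real.exp (-(r / 2 * Real.exp s)) * hk2 (r / 2 * Real.exp s) (r ^ 2)) =
      (1 / (4 * π)) * Real.exp (-(r * Real.cosh |s|)) := by
    intro s
    rw [abs_of_pos (by positivity), smul_eq_mul, Real.cosh_abs, Real.cosh_eq]
    unfold hk2
    rw [show -(r * ((Real.exp s + Real.exp (-s)) / 2)) = -(r / 2 * Real.exp s) + -r ^ 2 / (4 * (r / 2 * Real.exp s)) by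
      rw [Real.exp_neg]; field_simp; ring, Real.exp_add]
    field_simp
  simp_rw [e1]
  rw [integral_const_mul, integral_comp_abs (f := fun s => Real.exp (-(r * Real.cosh s)))]
  unfold K0
  field_simp
  ring

theorem rad_sq (x : ℝ × ℝ) : rad x ^ 2 = x.1 ^ 2 + x.2 ^ 2 := by
  unfold rad; rw [Real.sq_sqrt (by positivity)]

theorem Gker_rep {x y : ℝ × ℝ} (h : x ≠ y) :
    Gker x y = ∫ t in Set.Ioi (0 : ℝ), Real.exp (-t) * hk2 t (d2 x y) := by
  have h1 : 0 < rad (x - y) := by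
    unfold rad
    apply Real.sqrt_pos.2
    by_contra hn
    have a1 := sq_nonneg (x - y).1
    have a2 := sq_nonneg (x - y).2
    have b1 : (x - y).1 ^ 2 = 0 := by linarith
    have b2 : (x - y).2 ^ 2 = 0 := by linarith
    apply h
    rw [pow_eq_zero_iff two_ne_zero] at b1 b2
    simp at b1 b2
    exact Prod.ext (by linarith) (by linarith)
  unfold Gker
  rw [K0_rep h1, rad_sq]; rfl

theorem d2_pos {x y : ℝ × ℝ} (h : x ≠ y) : 0 < d2 x y := by
  unfold d2
  by_contra hn
  have a1 := sq_nonneg (x.1 - y.1)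
  have a2 := sq_nonneg (x.2 - y.2)
  have b1 : (x.1 - y.1) ^ 2 = 0 := by linarith
  have b2 : (x.2 - y.2) ^ 2 = 0 := by linarith
  apply h
  rw [pow_eq_zero_iff two_ne_zero] at b1 b2
  exact Prod.ext (by linarith) (by linarith)

/-- half plane heat kernel -/
noncomputable def qt (t : ℝ) (x y : ℝ × ℝ) : ℝ := hk2 t (d2 x y) - hk2 t (d2 (reflPt x) y)

theorem qt_nonneg {t : ℝ} (ht : 0 < t) {x y : ℝ × ℝ} (hx : 0 < x.2) (hy : 0 < y.2) : 0 ≤ qt t x y := by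
  unfold qt hk2 d2 reflPt
  rw [sub_nonneg]
  refine mul_le_mul_of_nonneg_left (Real.exp_le_exp.2 ?_) (by positivity)
  rw [div_le_div_iff_of_pos_right (by positivity)]
  have := mul_pos hx hy
  simp only
  nlinarith

theorem GUHP_rep {x y : ℝ × ℝ} (hx : 0 < x.2) (hy : 0 < y.2) (h : x ≠ y) :
    IntegrableOn (fun t => Real.exp (-t) * qt t x y) (Set.Ioi 0) ∧
    GUHP x y = ∫ t in Set.Ioi (0 : ℝ), Real.exp (-t) * qt t x y := by
  have h' : reflPt x ≠ y := by
    intro he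
    have := congrArg Prod.snd he
    simp [reflPt] at this; linarith
  have i1 := hk2_int (d2_pos h)
  have i2 := hk2_int (d2_pos h')
  unfold GUHP qt
  simp_rw [mul_sub]
  refine ⟨i1.sub i2, ?_⟩
  rw [Gker_rep h, Gker_rep h', integral_sub i1 i2]

theorem GUHP_lint {x y : ℝ × ℝ} (hx : 0 < x.2) (hy : 0 < y.2) (h : x ≠ y) :
    ENNReal.ofReal (GUHP x y) = ∫⁻ t in Set.Ioi (0 : ℝ), ENNReal.ofReal (Real.exp (-t) * qt t x y) := by
  obtain ⟨h1, h2⟩ := GUHP_rep hx hy h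
  rw [h2, ofReal_integral_eq_lintegral_ofReal h1]
  filter_upwards [self_mem_ae_restrict measurableSet_Ioi] with t ht
  exact mul_nonneg (Real.exp_pos _).le (qt_nonneg ht hx hy)

theorem GUHP_nonneg {x y : ℝ × ℝ} (hx : 0 < x.2) (hy : 0 < y.2) (h : x ≠ y) : 0 ≤ GUHP x y := by
  rw [(GUHP_rep hx hy h).2]
  exact setIntegral_nonneg measurableSet_Ioi fun t ht => mul_nonneg (Real.exp_pos _).le (qt_nonneg ht hx hy)

theorem kk_lint {X : V4} (h : X ≠ 0) :
    ENNReal.ofReal (kk X) = ∫⁻ t in Set.Ioi (0 : ℝ), ENNReal.ofReal (Real.exp (-t) * pt t X) := by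
  unfold kk
  rw [ofReal_integral_eq_lintegral_ofReal (kk_intOn h)]
  exact Eventually.of_forall fun t => mul_nonneg (Real.exp_pos _).le (pt_nonneg _ _)

theorem K0_meas : Measurable K0 := by
  unfold K0
  have : StronglyMeasurable (fun p : ℝ × ℝ => Real.exp (-(p.1 * Real.cosh p.2))) :=
    (by fun_prop : Measurable (fun p : ℝ × ℝ => Real.exp (-(p.1 * Real.cosh p.2)))).stronglyMeasurable
  exact (this.integral_prod_right' (ν := volume.restrict (Set.Ioi 0))).measurable

theorem GUHP_meas : Measurable (fun p : (ℝ × ℝ) × (ℝ × ℝ) => GUHP p.1 p.2) := by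
  have hr : Measurable rad := by unfold rad; fun_prop
  have hk := K0_meas
  unfold GUHP Gker reflPt
  have h1 : Measurable fun p : (ℝ × ℝ) × (ℝ × ℝ) => K0 (rad (p.1 - p.2)) := hk.comp (hr.comp (by fun_prop))
  have h2 : Measurable fun p : (ℝ × ℝ) × (ℝ × ℝ) => K0 (rad ((p.1.1, -p.1.2) - p.2)) := hk.comp (hr.comp (by fun_prop))
  exact (h1.const_mul _).sub (h2.const_mul _)

end

section
open scoped ENNReal

theorem polar2 {f : ℝ → ℝ≥0∞} (hf : Measurable f) :
    ∫⁻ p : ℝ × ℝ, f (Real.sqrt (p.1 ^ 2 + p.2 ^ 2)) = ∫⁻ s in Set.Ioi (0 : ℝ), ENNReal.ofReal (2 * π * s) * f s := by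
  rw [← lintegral_comp_polarCoord_symm, polarCoord_target]
  have e : ∀ p ∈ Set.Ioi (0 : ℝ) ×ˢ Set.Ioo (-π) π, ENNReal.ofReal p.1 •
      f (Real.sqrt ((polarCoord.symm p).1 ^ 2 + (polarCoord.symm p).2 ^ 2)) = ENNReal.ofReal p.1 * f p.1 := by
    intro p hp
    have hp1 : 0 < p.1 := hp.1
    rw [polarCoord_symm_apply, smul_eq_mul]
    simp only
    rw [show (p.1 * Real.cos p.2) ^ 2 + (p.1 * Real.sin p.2) ^ 2 = p.1 ^ 2 by
      have := Real.sin_sq_add_cos_sq p.2; nlinarith [this], Real.sqrt_sq hp1.le]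
  rw [setLIntegral_congr_fun (measurableSet_Ioi.prod measurableSet_Ioo) e, Measure.volume_eq_prod,
    ← Measure.prod_restrict, lintegral_prod _ (by fun_prop)]
  simp only [lintegral_const, Measure.restrict_apply_univ, Real.volume_Ioo]
  refine setLIntegral_congr_fun measurableSet_Ioi fun s hs => ?_
  have hs' : 0 < s := hs
  rw [show 2 * π * s = s * (π - -π) by ring, ENNReal.ofReal_mul hs'.le]
  ring

theorem subst_r (z : ℝ) (g : ℝ → ℝ≥0∞) :
    ∫⁻ s in Set.Ioi (0 : ℝ), ENNReal.ofReal (2 * π * s) * g (Real.sqrt (z ^ 2 + s ^ 2)) =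
    ∫⁻ r in Set.Ioi |z|, ENNReal.ofReal (2 * π * r) * g r := by
  have himg : (fun s : ℝ => Real.sqrt (z ^ 2 + s ^ 2)) '' Set.Ioi 0 = Set.Ioi |z| := by
    ext r
    constructor
    · rintro ⟨s, hs, rfl⟩
      have hs' : 0 < s := hs
      show |z| < _
      rw [← Real.sqrt_sq_eq_abs]
      exact Real.sqrt_lt_sqrt (sq_nonneg _) (by nlinarith)
    · intro hr
      have hr' : |z| < r := hr
      have h0 : 0 < r := lt_of_le_of_lt (abs_nonneg _) hr'
      have h1 : z ^ 2 < r ^ 2 := sq_lt_sq' (by linarith [neg_abs_le z]) (lt_of_le_of_lt (le_abs_self _) hr')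
      refine ⟨Real.sqrt (r ^ 2 - z ^ 2), Real.sqrt_pos.2 (by linarith), ?_⟩
      simp only
      rw [Real.sq_sqrt (by linarith), show z ^ 2 + (r ^ 2 - z ^ 2) = r ^ 2 by ring, Real.sqrt_sq h0.le]
  have hder : ∀ s ∈ Set.Ioi (0 : ℝ), HasDerivWithinAt (fun s : ℝ => Real.sqrt (z ^ 2 + s ^ 2))
      (s / Real.sqrt (z ^ 2 + s ^ 2)) (Set.Ioi 0) s := by
    intro s hs
    have hs' : 0 < s := hs
    have h1 : HasDerivAt (fun s : ℝ => z ^ 2 + s ^ 2) (2 * s) s := by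
      simpa using (hasDerivAt_pow 2 s).const_add (z ^ 2)
    have := (h1.sqrt (by positivity)).hasDerivWithinAt (s := Set.Ioi 0)
    rw [mul_div_mul_left _ _ (two_ne_zero (α := ℝ))] at this; exact this
  have hinj : Set.InjOn (fun s : ℝ => Real.sqrt (z ^ 2 + s ^ 2)) (Set.Ioi 0) := by
    intro a ha b hb hab
    have ha' : 0 < a := ha
    have hb' : 0 < b := hb
    simp only at hab
    rw [Real.sqrt_inj (by positivity) (by positivity)] at hab
    have : a ^ 2 = b ^ 2 := by linarith
    exact (sq_eq_sq₀ ha'.le hb'.le).1 this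
  rw [← himg, lintegral_image_eq_lintegral_abs_deriv_mul measurableSet_Ioi hder hinj]
  refine setLIntegral_congr_fun measurableSet_Ioi fun s hs => ?_
  have hs' : 0 < s := hs
  have hq : 0 < Real.sqrt (z ^ 2 + s ^ 2) := Real.sqrt_pos.2 (by positivity)
  rw [← mul_assoc, ← ENNReal.ofReal_mul (abs_nonneg _), abs_of_pos (by positivity)]
  congr 2
  field_simp

/-- splitting of the four dimensional volume -/
theorem lint_split {F : ℝ × ℝ × ℝ × ℝ → ℝ≥0∞} :
    ∫⁻ Y : V4, F (Y 0, Y 1, Y 2, Y 3) = ∫⁻ p : ℝ × ℝ × ℝ × ℝ, F p := by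
  let e1 : V4 ≃ᵐ (Fin 4 → ℝ) := (MeasurableEquiv.toLp 2 (Fin 4 → ℝ)).symm
  have h1 : MeasurePreserving e1 := PiLp.volume_preserving_ofLp (Fin 4)
  let e2 := MeasurableEquiv.piFinSuccAbove (fun _ : Fin 4 => ℝ) 0
  have h2 : MeasurePreserving e2 := volume_preserving_piFinSuccAbove (fun _ : Fin 4 => ℝ) 0
  let e3 := MeasurableEquiv.piFinSuccAbove (fun _ : Fin 3 => ℝ) 0
  have h3 : MeasurePreserving e3 := volume_preserving_piFinSuccAbove (fun _ : Fin 3 => ℝ) 0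
  let e4 := MeasurableEquiv.finTwoArrow (α := ℝ)
  have h4 : MeasurePreserving e4 := volume_preserving_finTwoArrow ℝ
  let E : V4 ≃ᵐ ℝ × ℝ × ℝ × ℝ := (e1.trans e2).trans ((MeasurableEquiv.refl ℝ).prodCongr
    (e3.trans ((MeasurableEquiv.refl ℝ).prodCongr e4)))
  have hE : MeasurePreserving E := (h2.comp h1).trans
    ((MeasurePreserving.id volume).prod (h3.trans ((MeasurePreserving.id volume).prod h4)))
  rw [← hE.lintegral_comp_emb E.measurableEmbedding]
  rfl

noncomputable def Ph (X : V4) : ℝ × ℝ := (X 0, Real.sqrt (X 1 ^ 2 + X 2 ^ 2 + X 3 ^ 2))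

theorem UHP_meas : MeasurableSet UHP := measurableSet_lt measurable_const measurable_snd

theorem UHP_eq : UHP = Set.univ ×ˢ Set.Ioi (0 : ℝ) := by ext x; simp [UHP]

theorem slice {F : ℝ × ℝ × ℝ → ℝ≥0∞} (hF : Measurable F) :
    ∫⁻ Y : V4, F (Y 0, Y 1, (Ph Y).2) =
    ∫⁻ p in UHP, ∫⁻ z in Set.Ioo (-p.2) p.2, ENNReal.ofReal (2 * π * p.2) * F (p.1, z, p.2) := by
  have e0 : ∀ Y : V4, F (Y 0, Y 1, (Ph Y).2) = (fun q : ℝ × ℝ × ℝ × ℝ =>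
      F (q.1, q.2.1, Real.sqrt (q.2.1 ^ 2 + (Real.sqrt (q.2.2.1 ^ 2 + q.2.2.2 ^ 2)) ^ 2))) (Y 0, Y 1, Y 2, Y 3) := by
    intro Y
    simp only [Ph]
    rw [Real.sq_sqrt (by positivity), add_assoc]
  rw [lintegral_congr e0, lint_split (F := fun q : ℝ × ℝ × ℝ × ℝ =>
      F (q.1, q.2.1, Real.sqrt (q.2.1 ^ 2 + (Real.sqrt (q.2.2.1 ^ 2 + q.2.2.2 ^ 2)) ^ 2))), Measure.volume_eq_prod, lintegral_prod _ (by fun_prop), UHP_eq,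
    Measure.volume_eq_prod ℝ ℝ, ← Measure.prod_restrict, Measure.restrict_univ]
  rw [lintegral_prod]
  swap
  · have hm : Measurable (fun q : (ℝ × ℝ) × ℝ => (Set.Ioo (-q.1.2) q.1.2).indicator
        (fun z => ENNReal.ofReal (2 * π * q.1.2) * F (q.1.1, z, q.1.2)) q.2) := by
      have hs : MeasurableSet {q : (ℝ × ℝ) × ℝ | -q.1.2 < q.2 ∧ q.2 < q.1.2} :=
        (measurableSet_lt (f := fun q : (ℝ × ℝ) × ℝ => -q.1.2) (g := fun q => q.2) (by fun_prop) (by fun_prop)).inter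
          (measurableSet_lt (f := fun q : (ℝ × ℝ) × ℝ => q.2) (g := fun q => q.1.2) (by fun_prop) (by fun_prop))
      have : (fun q : (ℝ × ℝ) × ℝ => (Set.Ioo (-q.1.2) q.1.2).indicator
        (fun z => ENNReal.ofReal (2 * π * q.1.2) * F (q.1.1, z, q.1.2)) q.2) =
        {q : (ℝ × ℝ) × ℝ | -q.1.2 < q.2 ∧ q.2 < q.1.2}.indicator
          (fun q => ENNReal.ofReal (2 * π * q.1.2) * F (q.1.1, q.2, q.1.2)) := by
        ext q; simp [Set.indicator_apply]
      rw [this]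
      exact Measurable.indicator (by fun_prop) hs
    have h2 := hm.lintegral_prod_right' (ν := volume)
    simp_rw [lintegral_indicator measurableSet_Ioo] at h2
    exact h2.aemeasurable
  refine lintegral_congr fun y0 => ?_
  rw [Measure.volume_eq_prod ℝ (ℝ × ℝ), lintegral_prod _ (by fun_prop)]
  have e1 : ∀ z : ℝ, ∫⁻ p : ℝ × ℝ, F (y0, z, Real.sqrt (z ^ 2 + (Real.sqrt (p.1 ^ 2 + p.2 ^ 2)) ^ 2)) =
      ∫⁻ r, (Set.Ioi |z|).indicator (fun r => ENNReal.ofReal (2 * π * r) * F (y0, z, r)) r := by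
    intro z
    rw [polar2 (f := fun s => F (y0, z, Real.sqrt (z ^ 2 + s ^ 2))) (by fun_prop),
      subst_r z (fun r => F (y0, z, r)), lintegral_indicator measurableSet_Ioi]
  simp only
  simp_rw [e1]
  rw [lintegral_lintegral_swap]
  swap
  · have : (Function.uncurry fun (z r : ℝ) => (Set.Ioi |z|).indicator (fun r => ENNReal.ofReal (2 * π * r) * F (y0, z, r)) r)
      = {p : ℝ × ℝ | |p.1| < p.2}.indicator (fun p => ENNReal.ofReal (2 * π * p.2) * F (y0, p.1, p.2)) := by
      ext p; simp [Function.uncurry, Set.indicator_apply]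
    rw [this]
    exact (Measurable.indicator (by fun_prop) (measurableSet_lt (by fun_prop) (by fun_prop))).aemeasurable
  rw [← lintegral_indicator measurableSet_Ioi]
  refine lintegral_congr fun r => ?_
  by_cases hr : 0 < r
  · rw [Set.indicator_of_mem (show r ∈ Set.Ioi (0 : ℝ) from hr), ← lintegral_indicator measurableSet_Ioo]
    refine lintegral_congr fun z => ?_
    simp only [Set.indicator_apply, Set.mem_Ioi, Set.mem_Ioo, abs_lt]
  · rw [Set.indicator_of_notMem (show r ∉ Set.Ioi (0 : ℝ) from hr)]
    rw [show (0 : ℝ≥0∞) = ∫⁻ _ : ℝ, 0 by simp]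
    refine lintegral_congr fun z => ?_
    rw [Set.indicator_of_notMem]
    intro h
    exact hr (lt_of_le_of_lt (abs_nonneg z) h)

theorem Ph_cont : Continuous Ph := by unfold Ph; fun_prop

theorem push_lint {f : ℝ × ℝ → ℝ≥0∞} (hf : Measurable f) :
    ∫⁻ X : V4, f (Ph X) = ∫⁻ x in UHP, ENNReal.ofReal (4 * π * x.2 ^ 2) * f x := by
  have := slice (F := fun q => f (q.1, q.2.2)) (by fun_prop)
  refine (Eq.trans ?_ this).trans ?_
  · rfl
  · refine setLIntegral_congr_fun UHP_meas fun p hp => ?_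
    have hp' : 0 < p.2 := hp
    simp only [lintegral_const, Measure.restrict_apply_univ, Real.volume_Ioo]
    rw [mul_right_comm, ← ENNReal.ofReal_mul (by positivity)]
    congr 2; ring

noncomputable def mP : Measure (ℝ × ℝ) := (volume.restrict UHP).withDensity fun x => ENNReal.ofReal (4 * π * x.2 ^ 2)

theorem push_map : Measure.map Ph volume = mP := by
  ext s hs
  rw [Measure.map_apply Ph_cont.measurable hs, mP, withDensity_apply _ hs,
    ← lintegral_indicator_one (Ph_cont.measurable hs)]
  have := push_lint (f := s.indicator 1) (measurable_one.indicator hs)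
  refine (Eq.trans ?_ this).trans ?_
  · rfl
  · rw [← lintegral_indicator hs]
    refine lintegral_congr fun x => ?_
    by_cases hx : x ∈ s <;> simp [hx]

end

section
open scoped ENNReal

theorem V4_norm_sq (X : V4) : ‖X‖ ^ 2 = X 0 ^ 2 + X 1 ^ 2 + X 2 ^ 2 + X 3 ^ 2 := by
  rw [EuclideanSpace.norm_sq_eq, Fin.sum_univ_four]
  simp only [Real.norm_eq_abs, sq_abs]

theorem V4_inner (X Y : V4) : inner ℝ X Y = X 0 * Y 0 + X 1 * Y 1 + X 2 * Y 2 + X 3 * Y 3 := by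
  rw [PiLp.inner_apply, Fin.sum_univ_four]
  simp only [RCLike.inner_apply, conj_trivial]; ring

theorem Ph_sq (X : V4) : (Ph X).2 ^ 2 = X 1 ^ 2 + X 2 ^ 2 + X 3 ^ 2 := by
  unfold Ph; simp only; rw [Real.sq_sqrt (by positivity)]

theorem Ph_nonneg (X : V4) : 0 ≤ (Ph X).2 := Real.sqrt_nonneg _

noncomputable def std4 (x : ℝ × ℝ) : V4 := !₂[x.1, x.2, 0, 0]

theorem Ph_ext {X Y : V4} (h0 : X 0 = Y 0) (h : ‖X‖ = ‖Y‖) : Ph X = Ph Y := by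
  have h1 := V4_norm_sq X
  have h2 := V4_norm_sq Y
  rw [h, h2, h0] at h1
  unfold Ph
  rw [h0]
  congr 2
  linarith

theorem exp_int (b r : ℝ) (hb : b ≠ 0) :
    ∫ z in (-r)..r, Real.exp (b * z) = (Real.exp (b * r) - Real.exp (-(b * r))) / b := by
  have : ∀ z ∈ Set.uIcc (-r) r, HasDerivAt (fun z => Real.exp (b * z) / b) (Real.exp (b * z)) z := by
    intro z _
    have h1 : HasDerivAt (fun z => b * z) b z := by simpa using (hasDerivAt_id z).const_mul b
    have := h1.exp.div_const b
    rwa [mul_div_assoc, div_self hb, mul_one] at this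
  rw [intervalIntegral.integral_eq_sub_of_hasDerivAt this (Continuous.intervalIntegrable (by fun_prop) _ _)]
  rw [show b * -r = -(b * r) by ring]; ring

theorem heat_slice {x : ℝ × ℝ} (hx : 0 < x.2) {t : ℝ} (ht : 0 < t) {g : ℝ × ℝ → ℝ≥0∞} (hg : Measurable g) :
    ∫⁻ Y : V4, ENNReal.ofReal (pt t (std4 x - Y)) * g (Ph Y) =
    ∫⁻ y in UHP, ENNReal.ofReal (y.2 / x.2 * qt t x y) * g y := by
  have e0 : ∀ Y : V4, ENNReal.ofReal (pt t (std4 x - Y)) * g (Ph Y) = (fun q : ℝ × ℝ × ℝ =>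
      ENNReal.ofReal (((4 * π * t) ^ 2)⁻¹ * Real.exp (-((x.1 - q.1) ^ 2 + x.2 ^ 2 + q.2.2 ^ 2 - 2 * x.2 * q.2.1) / (4 * t))) *
        g (q.1, q.2.2)) (Y 0, Y 1, (Ph Y).2) := by
    intro Y
    have : ‖std4 x - Y‖ ^ 2 = (x.1 - Y 0) ^ 2 + x.2 ^ 2 + (Ph Y).2 ^ 2 - 2 * x.2 * Y 1 := by
      rw [V4_norm_sq, Ph_sq]
      simp [std4]; ring
    unfold pt
    rw [this]; rfl
  rw [lintegral_congr e0, slice (F := fun q : ℝ × ℝ × ℝ =>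
      ENNReal.ofReal (((4 * π * t) ^ 2)⁻¹ * Real.exp (-((x.1 - q.1) ^ 2 + x.2 ^ 2 + q.2.2 ^ 2 - 2 * x.2 * q.2.1) / (4 * t))) *
        g (q.1, q.2.2)) (by fun_prop)]
  refine setLIntegral_congr_fun UHP_meas fun p hp => ?_
  have hp' : 0 < p.2 := hp
  simp only
  simp_rw [← mul_assoc]
  rw [lintegral_mul_const _ (by fun_prop)]
  congr 1
  rw [lintegral_const_mul _ (by fun_prop)]
  set A := ((4 * π * t) ^ 2)⁻¹ * Real.exp (-((x.1 - p.1) ^ 2 + x.2 ^ 2 + p.2 ^ 2) / (4 * t)) with hA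
  set b := x.2 / (2 * t) with hb
  have hb0 : 0 < b := by positivity
  have hA0 : 0 ≤ A := by positivity
  have e1 : ∀ z : ℝ, ((4 * π * t) ^ 2)⁻¹ * Real.exp (-((x.1 - p.1) ^ 2 + x.2 ^ 2 + p.2 ^ 2 - 2 * x.2 * z) / (4 * t)) =
      A * Real.exp (b * z) := by
    intro z
    rw [hA, mul_assoc (((4 * π * t) ^ 2)⁻¹), ← Real.exp_add]
    congr 2
    rw [hb]; field_simp; ring
  simp_rw [e1]
  have hii : IntervalIntegrable (fun z => A * Real.exp (b * z)) volume (-p.2) p.2 :=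
    Continuous.intervalIntegrable (by fun_prop) _ _
  rw [setLIntegral_congr Ioo_ae_eq_Ioc, ← ofReal_integral_eq_lintegral_ofReal
    ((intervalIntegrable_iff_integrableOn_Ioc_of_le (by linarith)).1 hii)
    (Eventually.of_forall fun z => by positivity), ← intervalIntegral.integral_of_le (by linarith),
    intervalIntegral.integral_const_mul, exp_int b p.2 hb0.ne', ← ENNReal.ofReal_mul (by positivity)]
  congr 1
  unfold qt hk2 d2 reflPt
  simp only
  have q1 : Real.exp (-((x.1 - p.1) ^ 2 + (x.2 - p.2) ^ 2) / (4 * t)) =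
      Real.exp (-((x.1 - p.1) ^ 2 + x.2 ^ 2 + p.2 ^ 2) / (4 * t)) * Real.exp (b * p.2) := by
    rw [← Real.exp_add]; congr 1; rw [hb]; field_simp; ring
  have q2 : Real.exp (-((x.1 - p.1) ^ 2 + (-x.2 - p.2) ^ 2) / (4 * t)) =
      Real.exp (-((x.1 - p.1) ^ 2 + x.2 ^ 2 + p.2 ^ 2) / (4 * t)) * Real.exp (-(b * p.2)) := by
    rw [← Real.exp_add]; congr 1; rw [hb]; field_simp; ring
  rw [q1, q2, hA, hb]
  field_simp
  ring

theorem rot_lint {κ : V4 → ℝ≥0∞} (hκ : ∀ A B, ‖A‖ = ‖B‖ → κ A = κ B) (g : ℝ × ℝ → ℝ≥0∞) (X : V4) :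
    ∫⁻ Y, κ (X - Y) * g (Ph Y) = ∫⁻ Y, κ (std4 (Ph X) - Y) * g (Ph Y) := by
  by_cases hXY : X = std4 (Ph X)
  · rw [← hXY]
  set Z := std4 (Ph X) with hZ
  have hn : ‖X - Z‖ ≠ 0 := norm_ne_zero_iff.2 (sub_ne_zero.2 hXY)
  have he : ‖(‖X - Z‖⁻¹ : ℝ) • (X - Z)‖ = 1 := by
    rw [norm_smul, norm_inv, norm_norm, inv_mul_cancel₀ hn]
  have hnorm : ‖X‖ ^ 2 = ‖Z‖ ^ 2 := by
    rw [V4_norm_sq, V4_norm_sq, hZ]; simp [std4]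
    have := Ph_sq X; simp only [Ph] at this ⊢; linarith
  have hs : sg ((‖X - Z‖⁻¹ : ℝ) • (X - Z)) 0 X = Z := by
    unfold sg
    rw [real_inner_smul_left, sub_zero, smul_smul]
    have h1 : inner ℝ (X - Z) X = ‖X - Z‖ ^ 2 / 2 := by
      rw [norm_sub_sq_real, inner_sub_left, real_inner_self_eq_norm_sq, real_inner_comm]; linarith
    rw [h1]
    have : 2 * (‖X - Z‖⁻¹ * (‖X - Z‖ ^ 2 / 2)) * ‖X - Z‖⁻¹ = 1 := by field_simp
    rw [this, one_smul, sub_sub_cancel]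
  set e := (‖X - Z‖⁻¹ : ℝ) • (X - Z) with hee
  have he0 : e 0 = 0 := by
    rw [hee]; simp [hZ, std4, Ph]
  have hPh : ∀ Y, Ph (sg e 0 Y) = Ph Y := by
    intro Y
    refine Ph_ext ?_ ?_
    · unfold sg; simp [he0]
    · have := sg_iso he 0 Y 0
      have h0 : sg e 0 0 = 0 := by unfold sg; simp
      rwa [h0, sub_zero, sub_zero] at this
  rw [← (sg_mp he 0).lintegral_comp_emb (sgE he 0).measurableEmbedding]
  refine lintegral_congr fun Y => ?_
  rw [hPh]
  congr 1
  refine hκ _ _ ?_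
  have := sg_iso he 0 X (sg e 0 Y)
  rw [sg_sg he, hs] at this
  exact this.symm

/-- the kernel identity -/
theorem kern_lint {X : V4} (hX : 0 < (Ph X).2) {g : ℝ × ℝ → ℝ≥0∞} (hg : Measurable g) :
    ∫⁻ Y, ENNReal.ofReal (kk (X - Y)) * g (Ph Y) =
    ∫⁻ y in UHP, ENNReal.ofReal (y.2 / (Ph X).2 * GUHP (Ph X) y) * g y := by
  rw [rot_lint (κ := fun A => ENNReal.ofReal (kk A)) (fun A B h => by rw [kk_norm h])]
  set x := Ph X with hx
  have hne : ∀ᵐ Y : V4, Y ≠ std4 x := by simp [ae_iff]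
  have hne2 : ∀ᵐ y : ℝ × ℝ, y ≠ x := by simp [ae_iff]
  have hptm : Measurable fun p : V4 × ℝ => ENNReal.ofReal (Real.exp (-p.2) * pt p.2 (std4 x - p.1)) :=
    (kkprod_meas.comp (by fun_prop : Measurable fun p : V4 × ℝ => (std4 x - p.1, p.2))).ennreal_ofReal
  have hgm : Measurable fun p : V4 × ℝ => g (Ph p.1) := hg.comp (Ph_cont.measurable.comp measurable_fst)
  have hqm : Measurable fun p : ℝ × (ℝ × ℝ) => ENNReal.ofReal (p.2.2 / x.2 * (Real.exp (-p.1) * qt p.1 x p.2)) := by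
    unfold qt hk2 d2; fun_prop
  calc ∫⁻ Y, ENNReal.ofReal (kk (std4 x - Y)) * g (Ph Y)
      = ∫⁻ Y : V4, ∫⁻ t in Set.Ioi (0 : ℝ), ENNReal.ofReal (Real.exp (-t) * pt t (std4 x - Y)) * g (Ph Y) := by
        refine lintegral_congr_ae ?_
        filter_upwards [hne] with Y hY
        rw [kk_lint (sub_ne_zero.2 hY.symm), lintegral_mul_const]
        exact hptm.comp (by fun_prop : Measurable fun t : ℝ => (Y, t))
    _ = ∫⁻ t in Set.Ioi (0 : ℝ), ∫⁻ Y : V4, ENNReal.ofReal (Real.exp (-t) * pt t (std4 x - Y)) * g (Ph Y) :=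
        lintegral_lintegral_swap (hptm.mul hgm).aemeasurable
    _ = ∫⁻ t in Set.Ioi (0 : ℝ), ∫⁻ y in UHP, ENNReal.ofReal (y.2 / x.2 * (Real.exp (-t) * qt t x y)) * g y := by
        refine setLIntegral_congr_fun measurableSet_Ioi fun t ht => ?_
        have ht' : 0 < t := ht
        simp_rw [ENNReal.ofReal_mul (Real.exp_pos (-t)).le, mul_assoc]
        have hmm : Measurable fun Y : V4 => ENNReal.ofReal (pt t (std4 x - Y)) * g (Ph Y) :=
          ((pt_continuous t).measurable.comp (measurable_const.sub measurable_id)).ennreal_ofReal.mul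
          (hg.comp Ph_cont.measurable)
        rw [lintegral_const_mul _ hmm, heat_slice hX ht' hg, ← lintegral_const_mul]
        · refine setLIntegral_congr_fun UHP_meas fun y hy => ?_
          rw [← mul_assoc, ← ENNReal.ofReal_mul (Real.exp_pos _).le]
          congr 2; ring
        · unfold qt hk2 d2; fun_prop
    _ = ∫⁻ y in UHP, ∫⁻ t in Set.Ioi (0 : ℝ), ENNReal.ofReal (y.2 / x.2 * (Real.exp (-t) * qt t x y)) * g y :=
        lintegral_lintegral_swap (hqm.mul (hg.comp measurable_snd)).aemeasurable
    _ = _ := by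
        refine setLIntegral_congr_fun_ae UHP_meas ?_
        filter_upwards [hne2] with y hy hyU
        have hy' : 0 < y.2 := hyU
        rw [lintegral_mul_const, ENNReal.ofReal_mul (by positivity), GUHP_lint hX hyU hy.symm,
          ← lintegral_const_mul]
        · congr 1
          refine setLIntegral_congr_fun measurableSet_Ioi fun t ht => ?_
          rw [ENNReal.ofReal_mul (by positivity)]
        · unfold qt hk2 d2; fun_prop
        · exact hqm.comp (by fun_prop : Measurable fun t : ℝ => (t, y))

end

section
open scoped ENNReal

noncomputable def lft (ω : ℝ × ℝ → ℝ) (X : V4) : ℝ := ω (Ph X) / (Ph X).2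

theorem mP_ac : mP ≪ volume.restrict UHP := withDensity_absolutelyContinuous _ _

theorem Ph_qmp : Measure.QuasiMeasurePreserving Ph volume (volume.restrict UHP) :=
  ⟨Ph_cont.measurable, by rw [push_map]; exact mP_ac⟩

theorem Ph_pos : ∀ᵐ X : V4, 0 < (Ph X).2 :=
  Ph_qmp.ae (ae_restrict_mem UHP_meas)

theorem dens_meas : Measurable fun x : ℝ × ℝ => ENNReal.ofReal (4 * π * x.2 ^ 2) := by fun_prop

theorem int_push {f : ℝ × ℝ → ℝ} (hf : AEStronglyMeasurable f (volume.restrict UHP)) :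
    ∫ X : V4, f (Ph X) = ∫ x in UHP, (4 * π * x.2 ^ 2) * f x := by
  have h : AEStronglyMeasurable f (Measure.map Ph volume) := by
    rw [push_map]; exact hf.mono_ac mP_ac
  rw [← integral_map Ph_cont.measurable.aemeasurable h, push_map, mP,
    integral_withDensity_eq_integral_toReal_smul dens_meas (Eventually.of_forall fun _ => ENNReal.ofReal_lt_top)]
  refine integral_congr_ae (Eventually.of_forall fun x => ?_)
  simp only [smul_eq_mul]
  rw [ENNReal.toReal_ofReal (by positivity)]

theorem integrable_push {f : ℝ × ℝ → ℝ} (hf : AEStronglyMeasurable f (volume.restrict UHP)) :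
    Integrable (fun X : V4 => f (Ph X)) ↔ IntegrableOn (fun x => (4 * π * x.2 ^ 2) * f x) UHP := by
  have h : AEStronglyMeasurable f (Measure.map Ph volume) := by
    rw [push_map]; exact hf.mono_ac mP_ac
  have h2 := integrable_map_measure h Ph_cont.measurable.aemeasurable
  rw [push_map, mP, integrable_withDensity_iff_integrable_smul' dens_meas
    (Eventually.of_forall fun _ => ENNReal.ofReal_lt_top)] at h2
  refine h2.symm.trans ?_
  unfold IntegrableOn
  refine integrable_congr (Eventually.of_forall fun x => ?_)
  simp only [smul_eq_mul]
  rw [ENNReal.toReal_ofReal (by positivity)]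

theorem lft_aesm {f : ℝ × ℝ → ℝ} (hf : AEStronglyMeasurable f (volume.restrict UHP)) :
    AEStronglyMeasurable (fun x : ℝ × ℝ => f x / x.2) (volume.restrict UHP) :=
  (hf.aemeasurable.div measurable_snd.aemeasurable).aestronglyMeasurable

theorem lft_int {f : ℝ × ℝ → ℝ} (hf : AEStronglyMeasurable f (volume.restrict UHP)) :
    ∫ X, lft f X = 4 * π * ∫ x in UHP, x.2 * f x := by
  unfold lft
  rw [int_push (f := fun x => f x / x.2) (lft_aesm hf), ← integral_const_mul]
  refine setIntegral_congr_fun UHP_meas fun x hx => ?_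
  have : 0 < x.2 := hx
  field_simp

theorem lft_abs {f : ℝ × ℝ → ℝ} (hf : AEStronglyMeasurable f (volume.restrict UHP)) :
    ∫ X, |lft f X| = 4 * π * normL1 (fun x => x.2 * f x) := by
  unfold lft normL1
  rw [int_push (f := fun x => |f x / x.2|) (lft_aesm hf).norm, ← integral_const_mul]
  refine setIntegral_congr_fun UHP_meas fun x hx => ?_
  have : 0 < x.2 := hx
  simp only [abs_div, abs_mul, abs_of_pos this]
  field_simp

theorem lft_qq {f : ℝ × ℝ → ℝ} (hf : AEStronglyMeasurable f (volume.restrict UHP)) :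
    qq (lft f) = 4 * π * ∫ x in UHP, f x ^ 2 := by
  unfold lft qq
  have : AEStronglyMeasurable (fun x : ℝ × ℝ => (f x / x.2) ^ 2) (volume.restrict UHP) := (lft_aesm hf).pow 2
  rw [int_push (f := fun x => (f x / x.2) ^ 2) this, ← integral_const_mul]
  refine setIntegral_congr_fun UHP_meas fun x hx => ?_
  have : 0 < x.2 := hx
  field_simp

theorem lft_sub (f g : ℝ × ℝ → ℝ) (X : V4) : lft f X - lft g X = lft (fun x => f x - g x) X := by
  unfold lft; ring

theorem lft_gd {ω : ℝ × ℝ → ℝ} (h : ∀ x ∈ UHP, 0 ≤ ω x) (hm : AEStronglyMeasurable ω (volume.restrict UHP))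
    (h2 : IntegrableOn (fun x => ω x ^ 2) UHP)
    (h1 : IntegrableOn (fun x => x.2 * ω x) UHP) : Gd (lft ω) := by
  refine ⟨fun X => ?_, ?_, ?_⟩
  · unfold lft
    rcases (Ph_nonneg X).eq_or_lt with h0 | h0
    · rw [← h0]; simp
    · exact div_nonneg (h _ h0) h0.le
  · refine (integrable_push (f := fun x => ω x / x.2) (lft_aesm hm)).2 ?_
    refine (h1.const_mul (4 * π)).congr ?_
    filter_upwards [ae_restrict_mem UHP_meas] with x hx
    have : 0 < x.2 := hx
    field_simp
  · have hm' : AEStronglyMeasurable (lft ω) volume := (lft_aesm hm).comp_quasiMeasurePreserving Ph_qmp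
    refine (memLp_two_iff_integrable_sq hm').2 ?_
    refine (integrable_push (f := fun x => (ω x / x.2) ^ 2) ((lft_aesm hm).pow 2)).2 ?_
    refine (h2.const_mul (4 * π)).congr ?_
    filter_upwards [ae_restrict_mem UHP_meas] with x hx
    have : 0 < x.2 := hx
    field_simp

theorem lft_nonneg {ω : ℝ × ℝ → ℝ} (h : ∀ x ∈ UHP, 0 ≤ ω x) (Y : V4) : 0 ≤ lft ω Y := by
  unfold lft
  rcases (Ph_nonneg Y).eq_or_lt with h0 | h0
  · rw [← h0]; simp
  · exact div_nonneg (h _ h0) h0.le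

theorem ne_ae (x : ℝ × ℝ) : ∀ᵐ y ∂(volume.restrict UHP), y ≠ x :=
  ae_restrict_of_ae (by simp [ae_iff])

theorem lft_cv1 {ω : ℝ × ℝ → ℝ} (h : ∀ x ∈ UHP, 0 ≤ ω x) (hm : AEStronglyMeasurable ω (volume.restrict UHP))
    (X : V4) : cv (lft ω) X = (∫⁻ Y, ENNReal.ofReal (kk (X - Y) * lft ω Y)).toReal := by
  have hm' : AEStronglyMeasurable (lft ω) volume := (lft_aesm hm).comp_quasiMeasurePreserving Ph_qmp
  have hkm : Measurable fun Y => kk (X - Y) := kk_meas.comp (measurable_const.sub measurable_id)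
  exact integral_eq_lintegral_of_nonneg_ae
    (Eventually.of_forall fun Y => mul_nonneg (kk_nonneg _) (lft_nonneg h Y)) (hkm.aestronglyMeasurable.mul hm')

theorem lft_cv2 {ω : ℝ × ℝ → ℝ} (h : ∀ x ∈ UHP, 0 ≤ ω x) (hm : AEStronglyMeasurable ω (volume.restrict UHP))
    {x : ℝ × ℝ} (hx : 0 < x.2) :
    Gop ω x / x.2 = (∫⁻ y in UHP, ENNReal.ofReal (GUHP x y * ω y / x.2)).toReal := by
  have hGm : Measurable fun y => GUHP x y := Measurable.of_uncurry_left (f := GUHP) GUHP_meas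
  unfold Gop
  rw [← integral_div]
  refine integral_eq_lintegral_of_nonneg_ae ?_ ?_
  · filter_upwards [ne_ae x, ae_restrict_mem UHP_meas] with y h2 h3
    exact div_nonneg (mul_nonneg (GUHP_nonneg hx h3 h2.symm) (h _ h3)) hx.le
  · exact ((hGm.aemeasurable.mul hm.aemeasurable).div_const _).aestronglyMeasurable

theorem lft_cv3 {ω : ℝ × ℝ → ℝ} (hm : AEStronglyMeasurable ω (volume.restrict UHP))
    {X : V4} (hX : 0 < (Ph X).2) : ∫⁻ Y, ENNReal.ofReal (kk (X - Y) * lft ω Y) =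
    ∫⁻ y in UHP, ENNReal.ofReal (GUHP (Ph X) y * ω y / (Ph X).2) := by
  obtain ⟨w', hwm, hw1⟩ : ∃ w' : ℝ × ℝ → ℝ, Measurable w' ∧ ω =ᵐ[volume.restrict UHP] w' :=
    ⟨hm.mk ω, hm.stronglyMeasurable_mk.measurable, hm.ae_eq_mk⟩
  have hgm : Measurable fun y : ℝ × ℝ => ENNReal.ofReal (w' y / y.2) := (hwm.div measurable_snd).ennreal_ofReal
  have hw2 : ∀ᵐ Y : V4, ω (Ph Y) = w' (Ph Y) := Ph_qmp.ae hw1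
  have hk := kern_lint hX hgm
  have h1 : ∫⁻ Y, ENNReal.ofReal (kk (X - Y) * lft ω Y) =
      ∫⁻ Y, ENNReal.ofReal (kk (X - Y)) * ENNReal.ofReal (w' (Ph Y) / (Ph Y).2) := by
    refine lintegral_congr_ae ?_
    filter_upwards [hw2] with Y hY
    rw [ENNReal.ofReal_mul (kk_nonneg _)]
    unfold lft; rw [hY]
  rw [h1, hk]
  refine lintegral_congr_ae ?_
  filter_upwards [hw1, ne_ae (Ph X), ae_restrict_mem UHP_meas] with y h1 h2 h3
  have h3' : 0 < y.2 := h3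
  have hg := GUHP_nonneg hX h3 h2.symm
  rw [← h1, ← ENNReal.ofReal_mul (by positivity)]
  congr 1
  generalize GUHP (Ph X) y = G
  field_simp

theorem lft_cv {ω : ℝ × ℝ → ℝ} (h : ∀ x ∈ UHP, 0 ≤ ω x) (hm : AEStronglyMeasurable ω (volume.restrict UHP))
    {X : V4} (hX : 0 < (Ph X).2) : cv (lft ω) X = Gop ω (Ph X) / (Ph X).2 := by
  rw [lft_cv1 h hm, lft_cv2 h hm hX, lft_cv3 hm hX]

theorem Gop_aesm {ω : ℝ × ℝ → ℝ} (hm : AEStronglyMeasurable ω (volume.restrict UHP)) :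
    AEStronglyMeasurable (Gop ω) (volume.restrict UHP) := by
  have : AEStronglyMeasurable (fun p : (ℝ × ℝ) × (ℝ × ℝ) => GUHP p.1 p.2 * ω p.2)
      ((volume.restrict UHP).prod (volume.restrict UHP)) :=
    GUHP_meas.aestronglyMeasurable.mul hm.comp_snd
  exact this.integral_prod_right'

theorem lft_BB {ω : ℝ × ℝ → ℝ} (h : ∀ x ∈ UHP, 0 ≤ ω x) (hm : AEStronglyMeasurable ω (volume.restrict UHP))
    (h2 : IntegrableOn (fun x => ω x ^ 2) UHP)
    (h1 : IntegrableOn (fun x => x.2 * ω x) UHP) :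
    BB kk (lft ω) (lft ω) = 4 * π * (2 * kineticE ω) := by
  have hG := lft_gd h hm h2 h1
  rw [BB_eq kk_integrable hG.i2 hG.i2]
  have e : ∀ X, lft ω X * ∫ Y, kk (X - Y) * lft ω Y = (fun x : ℝ × ℝ => (ω x / x.2) * (Gop ω x / x.2)) (Ph X) := by
    intro X
    rcases (Ph_nonneg X).eq_or_lt with h0 | h0
    · unfold lft; simp only; rw [← h0]; simp
    · have := lft_cv h hm h0
      unfold cv at this
      rw [this]; rfl
  simp_rw [e]
  rw [int_push (f := fun x : ℝ × ℝ => (ω x / x.2) * (Gop ω x / x.2)) ((lft_aesm hm).mul (lft_aesm (Gop_aesm hm)))]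
  unfold kineticE
  rw [show 4 * π * (2 * (1 / 2 * ∫ x in UHP, ω x * Gop ω x)) = 4 * π * ∫ x in UHP, ω x * Gop ω x by ring,
    ← integral_const_mul]
  refine setIntegral_congr_fun UHP_meas fun x hx => ?_
  have : 0 < x.2 := hx
  field_simp

theorem lft_FF (lam : ℝ) {ω : ℝ × ℝ → ℝ} (h : ∀ x ∈ UHP, 0 ≤ ω x) (hm : AEStronglyMeasurable ω (volume.restrict UHP))
    (h2 : IntegrableOn (fun x => ω x ^ 2) UHP)
    (h1 : IntegrableOn (fun x => x.2 * ω x) UHP) : FF lam (lft ω) = 4 * π * Efun lam ω := by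
  unfold FF Efun
  rw [lft_BB h hm h2 h1, lft_qq hm]; ring

end

section
open scoped ENNReal

noncomputable def ax (s : ℝ) : V4 := !₂[s, 0, 0, 0]

theorem ax_add (s t : ℝ) : ax s + ax t = ax (s + t) := by
  ext i; fin_cases i <;> simp [ax]

theorem axis_dir {c : V4} (hc : c ≠ ax (c 0)) :
    ∃ e : V4, ‖e‖ = 1 ∧ e 0 = 0 ∧ inner ℝ e c = ‖c - ax (c 0)‖ := by
  have hn : ‖c - ax (c 0)‖ ≠ 0 := norm_ne_zero_iff.2 (sub_ne_zero.2 hc)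
  refine ⟨(‖c - ax (c 0)‖⁻¹ : ℝ) • (c - ax (c 0)), ?_, ?_, ?_⟩
  · rw [norm_smul, norm_inv, norm_norm, inv_mul_cancel₀ hn]
  · simp [ax]
  · have h1 : inner ℝ (c - ax (c 0)) c = ‖c - ax (c 0)‖ ^ 2 := by
      rw [V4_norm_sq, V4_inner]; simp [ax]; ring
    rw [real_inner_smul_left, h1]
    field_simp

def Sy (u : V4 → ℝ) : Prop := ∀ e : V4, ‖e‖ = 1 → e 0 = 0 → ∀ X, u (sg e 0 X) = u X

theorem sg_ax {e : V4} (he0 : e 0 = 0) (X : V4) (s : ℝ) : sg e 0 (X + ax s) = sg e 0 X + ax s := by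
  unfold sg
  have : inner ℝ e (X + ax s) = inner ℝ e X := by
    rw [inner_add_right, V4_inner e (ax s)]; simp [ax, he0]
  rw [this]; module

theorem Sy.trans {u : V4 → ℝ} (h : Sy u) (s : ℝ) : Sy (fun X => u (X + ax s)) := by
  intro e he he0 X
  simp only
  rw [← sg_ax he0, h e he he0]

theorem sg_sub_norm {e : V4} (he : ‖e‖ = 1) (X c : V4) : ‖sg e 0 X - c‖ = ‖X - sg e 0 c‖ := by
  have := sg_iso he 0 X (sg e 0 c)
  rwa [sg_sg he] at this

theorem axis_sym {lam M a : ℝ} (hl : 1 < lam) {ws : V4 → ℝ} (hs : Cx lam M ws) (ha : 0 < a)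
    (ha1 : ∀ X, ‖X‖ < a → 0 < ws X) (ha2 : ∀ X, a ≤ ‖X‖ → ws X = 0) {c : V4}
    (h : ∀ e : V4, ‖e‖ = 1 → e 0 = 0 → ∀ᵐ X, ws (X - c) = ws (sg e 0 X - c)) : c = ax (c 0) := by
  by_contra hc
  obtain ⟨e, he, he0, hec⟩ := axis_dir hc
  have hwc := hs.nx.wcont
  have hsc := sg_cont e 0
  have h1 : (fun X => ws (X - c)) = fun X => ws (sg e 0 X - c) :=
    (Continuous.ae_eq_iff_eq volume (by fun_prop) (by fun_prop)).1 (h e he he0)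
  set d := c - sg e 0 c with hd
  have h2 : ∀ Z, ws Z = ws (Z + d) := by
    intro Z
    have h3 := congrFun h1 (Z + c)
    simp only [add_sub_cancel_right] at h3
    rw [h3]
    refine hs.radial hl ?_
    rw [sg_sub_norm he, hd, add_sub_assoc]
  have h4 : ∀ n : ℕ, ws ((n : ℝ) • d) = ws 0 := by
    intro n
    induction n with
    | zero => simp
    | succ k ih => rw [← ih, h2 ((k : ℝ) • d)]; congr 1; push_cast; module
  have hdn : 0 < ‖d‖ := by
    rw [norm_pos_iff, hd]
    unfold sg
    rw [hec, sub_zero, sub_sub_cancel]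
    have hn : ‖c - ax (c 0)‖ ≠ 0 := norm_ne_zero_iff.2 (sub_ne_zero.2 hc)
    refine smul_ne_zero (by positivity) ?_
    rw [← norm_ne_zero_iff, he]; exact one_ne_zero
  obtain ⟨n, hn⟩ := exists_nat_ge (a / ‖d‖)
  rw [div_le_iff₀ hdn] at hn
  have h5 := ha2 ((n : ℝ) • d) (by rw [norm_smul]; simpa using hn)
  rw [h4] at h5
  have := ha1 0 (by simpa using ha)
  linarith

theorem ball_mass {lam M a : ℝ} {ws : V4 → ℝ} (hs : Cx lam M ws)
    (ha2 : ∀ X, a ≤ ‖X‖ → ws X = 0) (c : V4) : ∫ X in Metric.ball c a, ws (X - c) = M := by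
  rw [setIntegral_eq_integral_of_forall_compl_eq_zero]
  · rw [integral_sub_right_eq_self ws c, hs.nx.mx.mass]
  · intro X hX
    refine ha2 _ ?_
    simpa [dist_eq_norm] using hX

theorem near_ball {lam M a η : ℝ} {ws : V4 → ℝ} (hs : Cx lam M ws)
    (ha2 : ∀ X, a ≤ ‖X‖ → ws X = 0) {u : V4 → ℝ} (hu : Gd u) {c : V4}
    (h : ∫ X, |u X - ws (X - c)| ≤ η) : M - η ≤ ∫ X in Metric.ball c a, u X := by
  have hw : Integrable (fun X => ws (X - c)) := hs.nx.mx.gd.i1.comp_sub_right c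
  have hi : Integrable (fun X => |u X - ws (X - c)|) := (hu.i1.sub hw).abs
  have h1 : ∫ X in Metric.ball c a, (ws (X - c) - u X) ≤ ∫ X in Metric.ball c a, |u X - ws (X - c)| := by
    refine integral_mono (hw.sub hu.i1).integrableOn hi.integrableOn fun X => ?_
    simp only
    rw [abs_sub_comm]; exact le_abs_self _
  have h2 : ∫ X in Metric.ball c a, |u X - ws (X - c)| ≤ ∫ X, |u X - ws (X - c)| :=
    setIntegral_le_integral hi (Eventually.of_forall fun _ => abs_nonneg _)
  rw [integral_sub hw.integrableOn hu.i1.integrableOn, ball_mass hs ha2] at h1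
  linarith

theorem off_axis {lam M a η : ℝ} {ws : V4 → ℝ} (hs : Cx lam M ws)
    (ha2 : ∀ X, a ≤ ‖X‖ → ws X = 0) {u : V4 → ℝ} (hu : Gd u) (hsy : Sy u) {c : V4}
    (h : ∫ X, |u X - ws (X - c)| ≤ η) (hm : ∫ X, u X ≤ M + η) (hη : 3 * η < M) : ‖c - ax (c 0)‖ ≤ a := by
  by_contra! hc'
  have hb := near_ball hs ha2 hu h
  rcases lt_or_ge a 0 with ha | ha
  · have h0 : 0 ≤ η := le_trans (integral_nonneg fun _ => abs_nonneg _) h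
    rw [Metric.ball_eq_empty.2 ha.le] at hb
    simp at hb; linarith
  have hc : c ≠ ax (c 0) := by
    intro h0
    rw [sub_eq_zero.2 h0, norm_zero] at hc'; linarith
  obtain ⟨e, he, he0, hec⟩ := axis_dir hc
  have hball : ∫ X in Metric.ball (sg e 0 c) a, u X = ∫ X in Metric.ball c a, u X := by
    rw [← (sg_mp he 0).setIntegral_preimage_emb (sgE he 0).measurableEmbedding u]
    have : sg e 0 ⁻¹' Metric.ball (sg e 0 c) a = Metric.ball c a := by
      ext X
      simp only [Set.mem_preimage, Metric.mem_ball, dist_eq_norm, sg_iso he]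
    rw [this]
    simp_rw [hsy e he he0]
  have hdis : Disjoint (Metric.ball c a) (Metric.ball (sg e 0 c) a) := by
    refine Metric.ball_disjoint_ball ?_
    rw [dist_eq_norm]
    unfold sg
    rw [sub_sub_cancel, norm_smul, he, hec, sub_zero, Real.norm_eq_abs, abs_of_nonneg (by positivity)]
    linarith
  have h1 := setIntegral_union hdis measurableSet_ball hu.i1.integrableOn (hu.i1.integrableOn (s := Metric.ball (sg e 0 c) a))
  have h2 : ∫ X in Metric.ball c a ∪ Metric.ball (sg e 0 c) a, u X ≤ ∫ X, u X :=
    setIntegral_le_integral hu.i1 (Eventually.of_forall hu.pos)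
  rw [hball] at h1
  linarith

theorem axis_cpt {lam M a : ℝ} (hl : 1 < lam) (hM : 0 < M) {ws : V4 → ℝ} (hs : Cx lam M ws) (ha : 0 < a)
    (ha1 : ∀ X, ‖X‖ < a → 0 < ws X) (ha2 : ∀ X, a ≤ ‖X‖ → ws X = 0) {z : ℕ → V4 → ℝ}
    (hz : ∀ n, Gd (z n)) (hsy : ∀ n, Sy (z n)) (h1 : Tendsto (fun n => ∫ X, z n X) atTop (nhds M))
    (h2 : Tendsto (fun n => FF lam (z n)) atTop (nhds (CC lam * M ^ 2))) :
    ∃ χ : ℕ → ℕ, StrictMono χ ∧ ∃ t : ℕ → ℝ,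
      Tendsto (fun n => qq (fun X => z (χ n) X - ws (X - ax (t n)))) atTop (nhds 0) ∧
      Tendsto (fun n => ∫ X, |z (χ n) X - ws (X - ax (t n))|) atTop (nhds 0) := by
  have hC := CC_pos hl
  obtain ⟨R, β, hR, hβ, hnv⟩ := nonvanish hl
  have ev1 : ∀ᶠ n in atTop, M / 2 < ∫ X, z n X := h1.eventually (lt_mem_nhds (by linarith))
  have ev2 : ∀ᶠ n in atTop, CC lam / 2 * (∫ X, z n X) ^ 2 < FF lam (z n) := by
    have t1 : Tendsto (fun n => FF lam (z n) - CC lam / 2 * (∫ X, z n X) ^ 2) atTop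
        (nhds (CC lam * M ^ 2 - CC lam / 2 * M ^ 2)) := h2.sub ((h1.pow 2).const_mul _)
    have : 0 < CC lam * M ^ 2 - CC lam / 2 * M ^ 2 := by
      have : 0 < CC lam * M ^ 2 := by positivity
      linarith
    filter_upwards [t1.eventually (lt_mem_nhds this)] with n hn
    linarith
  obtain ⟨N, hN⟩ := eventually_atTop.1 (ev1.and ev2)
  have hcs : ∀ n, ∃ c : V4, β * (M / 2) ≤ ∫ X in Metric.ball c R, z (n + N) X := by
    intro n
    obtain ⟨q1, q2⟩ := hN (n + N) (by omega)
    obtain ⟨c, hc⟩ := hnv _ (hz (n + N)) (by linarith) q2.le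
    exact ⟨c, le_trans (mul_le_mul_of_nonneg_left q1.le hβ.le) hc⟩
  choose c hc using hcs
  have hshift : ∀ (f : V4 → ℝ) (b : V4) (r : ℝ),
      ∫ X in Metric.ball (0 : V4) r, f (X + b) = ∫ X in Metric.ball b r, f X := by
    intro f b r
    rw [← (trE_mp b).setIntegral_preimage_emb (trE b).measurableEmbedding f]
    have : trE b ⁻¹' Metric.ball b r = Metric.ball 0 r := by
      ext X; simp [trE, dist_eq_norm]
    rw [this]; rfl
  obtain ⟨φ, hφ, w, hw1, hw2, hw3, -, hw5⟩ := compactness hl hM (β := β * (M / 2)) (R := R) (by positivity)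
    (u := fun n X => z (n + N) (X + c n)) (fun n => (hz _).trans _)
    ((h1.comp (tendsto_add_atTop_nat N)).congr fun n => (integral_add_right_eq_self (z (n + N)) (c n)).symm)
    ((h2.comp (tendsto_add_atTop_nat N)).congr fun n => (FF_trans (lam := lam) (f := z (n + N)) (c n)).symm)
    (fun n => by rw [hshift]; exact hc n)
  obtain ⟨b, hb⟩ := Mx.translate hl hM hs ⟨hw1, hw2, hw3⟩
  -- closeness to a translate centred anywhere
  have e1 : ∀ n, ∫ X, |z (φ n + N) (X + c (φ n)) - w X| = ∫ X, |z (φ n + N) X - ws (X - (b + c (φ n)))| := by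
    intro n
    rw [← integral_add_right_eq_self (fun X => |z (φ n + N) X - ws (X - (b + c (φ n)))|) (c (φ n))]
    refine integral_congr_ae ?_
    filter_upwards [hb] with X hX
    rw [hX, show X + c (φ n) - (b + c (φ n)) = X - b by abel]
  simp only [e1] at hw5
  have t2 : Tendsto (fun n => φ n + N) atTop atTop := (tendsto_add_atTop_nat N).comp hφ.tendsto_atTop
  have ev3 : ∀ᶠ n in atTop, ∫ X, |z (φ n + N) X - ws (X - (b + c (φ n)))| < M / 4 :=
    hw5.eventually (gt_mem_nhds (by linarith))
  have ev4 : ∀ᶠ n in atTop, ∫ X, z (φ n + N) X < M + M / 4 := (h1.comp t2).eventually (gt_mem_nhds (by linarith))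
  obtain ⟨N', hN'⟩ := eventually_atTop.1 (ev3.and ev4)
  set ψ : ℕ → ℕ := fun n => φ (n + N') + N with hψ
  have hψm : StrictMono ψ := fun i j hij => by
    have := hφ (show i + N' < j + N' by omega)
    simp only [hψ]; omega
  set s : ℕ → ℝ := fun n => (b + c (φ (n + N'))) 0 with hsdef
  have hmass : ∀ n, M / 2 ≤ ∫ X in Metric.ball (ax (s n)) (2 * a + 1), z (ψ n) X := by
    intro n
    obtain ⟨q1, q2⟩ := hN' (n + N') (by omega)
    have k1 := off_axis hs ha2 (hz (φ (n + N') + N)) (hsy _) q1.le q2.le (by linarith)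
    have k2 := near_ball hs ha2 (hz (φ (n + N') + N)) q1.le
    have k3 : ∫ X in Metric.ball (b + c (φ (n + N'))) a, z (ψ n) X ≤
        ∫ X in Metric.ball (ax (s n)) (2 * a + 1), z (ψ n) X := by
      refine setIntegral_mono_set (hz _).i1.integrableOn (Eventually.of_forall fun X => (hz _).pos X)
        (LE.le.eventuallyLE ?_)
      refine Metric.ball_subset_ball' ?_
      rw [dist_eq_norm]; linarith
    have : ∫ X in Metric.ball (b + c (φ (n + N'))) a, z (ψ n) X =
      ∫ X in Metric.ball (b + c (φ (n + N'))) a, z (φ (n + N') + N) X := rfl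
    linarith
  obtain ⟨θ, hθ, v, hv1, hv2, hv3, hv4, hv5⟩ := compactness hl hM (β := M / 2) (R := 2 * a + 1) (by positivity)
    (u := fun n X => z (ψ n) (X + ax (s n))) (fun n => (hz _).trans _)
    ((h1.comp hψm.tendsto_atTop).congr fun n => (integral_add_right_eq_self (z (ψ n)) (ax (s n))).symm)
    ((h2.comp hψm.tendsto_atTop).congr fun n => (FF_trans (lam := lam) (f := z (ψ n)) (ax (s n))).symm)
    (fun n => by rw [hshift]; exact hmass n)
  obtain ⟨d, hd⟩ := Mx.translate hl hM hs ⟨hv1, hv2, hv3⟩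
  have hwd : Integrable (fun X => ws (X - d)) := hs.nx.mx.gd.i1.comp_sub_right d
  have e2 : ∀ n, ∫ X, |z (ψ (θ n)) (X + ax (s (θ n))) - v X| = ∫ X, |z (ψ (θ n)) (X + ax (s (θ n))) - ws (X - d)| := by
    intro n
    refine integral_congr_ae ?_
    filter_upwards [hd] with X hX
    rw [hX]
  have e3 : ∀ n, qq (fun X => z (ψ (θ n)) (X + ax (s (θ n))) - v X) =
      qq (fun X => z (ψ (θ n)) (X + ax (s (θ n))) - ws (X - d)) := by
    intro n
    refine integral_congr_ae ?_
    filter_upwards [hd] with X hX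
    rw [hX]
  simp only [e2] at hv5
  simp only [e3] at hv4
  have hax : d = ax (d 0) := by
    refine axis_sym hl hs ha ha1 ha2 fun e he he0 => ?_
    have hmp := sg_mp he 0
    have hws : Integrable (fun X => ws (sg e 0 X - d)) := hmp.integrable_comp_of_integrable hwd
    have hle : ∀ n, ∫ X, |ws (X - d) - ws (sg e 0 X - d)| ≤ 2 * ∫ X, |z (ψ (θ n)) (X + ax (s (θ n))) - ws (X - d)| := by
      intro n
      set y := fun X => z (ψ (θ n)) (X + ax (s (θ n))) with hy
      have hyg : Gd y := (hz _).trans _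
      have hyS : Sy y := (hsy _).trans _
      have i1 : Integrable (fun X => |y X - ws (X - d)|) := (hyg.i1.sub hwd).abs
      have i2 : Integrable (fun X => |y X - ws (sg e 0 X - d)|) := (hyg.i1.sub hws).abs
      have i3 : ∫ X, |y X - ws (sg e 0 X - d)| = ∫ X, |y X - ws (X - d)| := by
        rw [← hmp.integral_comp (sgE he 0).measurableEmbedding (fun X => |y X - ws (X - d)|)]
        simp_rw [hyS e he he0]
      calc ∫ X, |ws (X - d) - ws (sg e 0 X - d)| ≤ ∫ X, (|y X - ws (X - d)| + |y X - ws (sg e 0 X - d)|) := by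
            refine integral_mono (hwd.sub hws).abs (i1.add i2) fun X => ?_
            have := abs_sub_le (ws (X - d)) (y X) (ws (sg e 0 X - d))
            rw [abs_sub_comm (ws (X - d)) (y X)] at this
            exact this
        _ = 2 * ∫ X, |y X - ws (X - d)| := by rw [integral_add i1 i2, i3]; ring
    have hz0 : ∫ X, |ws (X - d) - ws (sg e 0 X - d)| = 0 := by
      refine le_antisymm ?_ (integral_nonneg fun _ => abs_nonneg _)
      have := hv5.const_mul 2
      rw [mul_zero] at this
      exact ge_of_tendsto' this hle
    have hii : Integrable (fun X => |ws (X - d) - ws (sg e 0 X - d)|) := (hwd.sub hws).abs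
    rw [integral_eq_zero_iff_of_nonneg (fun _ => abs_nonneg _) hii] at hz0
    filter_upwards [hz0] with X hX
    exact sub_eq_zero.1 (abs_eq_zero.1 hX)
  refine ⟨fun n => ψ (θ n), hψm.comp hθ, fun n => d 0 + s (θ n), ?_, ?_⟩
  · refine hv4.congr fun n => ?_
    unfold qq
    rw [← integral_add_right_eq_self (fun X => (z (ψ (θ n)) X - ws (X - ax (d 0 + s (θ n)))) ^ 2) (ax (s (θ n)))]
    refine integral_congr_ae (Eventually.of_forall fun X => ?_)
    simp only
    rw [← ax_add, ← hax, show X + ax (s (θ n)) - (d + ax (s (θ n))) = X - d by abel]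
  · refine hv5.congr fun n => ?_
    rw [← integral_add_right_eq_self (fun X => |z (ψ (θ n)) X - ws (X - ax (d 0 + s (θ n)))|) (ax (s (θ n)))]
    refine integral_congr_ae (Eventually.of_forall fun X => ?_)
    simp only
    rw [← ax_add, ← hax, show X + ax (s (θ n)) - (d + ax (s (θ n))) = X - d by abel]

end

section
open scoped ENNReal

structure Su (lam μ : ℝ) (ws : V4 → ℝ) (a : ℝ) : Prop where
  hl : 1 < lam
  hμ : 0 < μ
  hs : Cx lam (4 * π * μ) ws
  ha : 0 < a
  ha1 : ∀ X, ‖X‖ < a → 0 < ws X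
  ha2 : ∀ X, a ≤ ‖X‖ → ws X = 0

theorem exists_Su {lam μ : ℝ} (hl : 1 < lam) (hμ : 0 < μ) : ∃ ws a, Su lam μ ws a := by
  have hM : 0 < 4 * π * μ := by have := Real.pi_pos; positivity
  obtain ⟨ws, hs⟩ := exists_Cx hl hM
  obtain ⟨a, ha, ha1, ha2⟩ := hs.supp hl hM
  exact ⟨ws, a, hl, hμ, hs, ha, ha1, ha2⟩

noncomputable def os (ws : V4 → ℝ) (s : ℝ) (x : ℝ × ℝ) : ℝ := x.2 * ws (std4 (x.1 - s, x.2))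

def bx (a s : ℝ) : Set (ℝ × ℝ) := Set.Icc (s - a) (s + a) ×ˢ Set.Icc (-a) a

theorem bx_meas (a s : ℝ) : MeasurableSet (bx a s) := measurableSet_Icc.prod measurableSet_Icc

theorem std4_cont : Continuous std4 := by
  unfold std4
  refine (PiLp.continuous_toLp 2 _).comp ?_
  refine continuous_pi fun i => ?_
  fin_cases i <;> simp <;> fun_prop

theorem std4_norm (x : ℝ × ℝ) : ‖std4 x‖ ^ 2 = x.1 ^ 2 + x.2 ^ 2 := by
  rw [V4_norm_sq]; simp [std4]

theorem Su.M_pos {lam μ a : ℝ} {ws : V4 → ℝ} (h : Su lam μ ws a) : 0 < 4 * π * μ := by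
  have := Real.pi_pos; have := h.hμ; positivity

theorem os_cont {lam μ a : ℝ} {ws : V4 → ℝ} (h : Su lam μ ws a) (s : ℝ) : Continuous (os ws s) := by
  have h1 := h.hs.nx.wcont
  have h2 := std4_cont
  unfold os; fun_prop

theorem os_zero {lam μ a : ℝ} {ws : V4 → ℝ} (h : Su lam μ ws a) (s : ℝ) {x : ℝ × ℝ} (hx : x ∉ bx a s) :
    os ws s x = 0 := by
  unfold os
  rw [h.ha2, mul_zero]
  by_contra! hlt
  have h1 := std4_norm (x.1 - s, x.2)
  have h2 := norm_nonneg (std4 (x.1 - s, x.2))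
  have h3 : ‖std4 (x.1 - s, x.2)‖ ^ 2 < a ^ 2 := by nlinarith
  rw [h1] at h3
  simp only at h3
  refine hx ⟨?_, ?_⟩
  · have := abs_le_of_sq_le_sq' (show (x.1 - s) ^ 2 ≤ a ^ 2 by nlinarith [sq_nonneg x.2]) h.ha.le
    constructor <;> linarith
  · have := abs_le_of_sq_le_sq' (show x.2 ^ 2 ≤ a ^ 2 by nlinarith [sq_nonneg (x.1 - s)]) h.ha.le
    exact this

theorem os_int {lam μ a : ℝ} {ws : V4 → ℝ} (h : Su lam μ ws a) (s : ℝ) :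
    (∀ x ∈ UHP, 0 ≤ os ws s x) ∧ IntegrableOn (os ws s) UHP ∧ IntegrableOn (fun x => os ws s x ^ 2) UHP ∧
    IntegrableOn (fun x => x.2 * os ws s x) UHP := by
  have hc := os_cont h s
  have hK : IsCompact (bx a s) := isCompact_Icc.prod isCompact_Icc
  refine ⟨fun x hx => mul_nonneg (le_of_lt hx) (h.hs.nx.mx.gd.pos _), ?_, ?_, ?_⟩
  · exact (hc.integrable_of_hasCompactSupport (HasCompactSupport.intro hK fun x hx => os_zero h s hx)).integrableOn
  · have hc2 : Continuous fun x => os ws s x ^ 2 := hc.pow 2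
    exact (hc2.integrable_of_hasCompactSupport (HasCompactSupport.intro hK fun x hx => by
      rw [os_zero h s hx]; simp)).integrableOn
  · have hc2 : Continuous fun x : ℝ × ℝ => x.2 * os ws s x := continuous_snd.mul hc
    exact (hc2.integrable_of_hasCompactSupport (HasCompactSupport.intro hK fun x hx => by
      rw [os_zero h s hx]; simp)).integrableOn

theorem os_lft {lam μ a : ℝ} {ws : V4 → ℝ} (h : Su lam μ ws a) (s : ℝ) {X : V4} (hX : 0 < (Ph X).2) :
    lft (os ws s) X = ws (X - ax s) := by
  unfold lft os
  rw [mul_div_assoc, mul_comm, div_mul_cancel₀ _ hX.ne']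
  refine h.hs.radial h.hl ?_
  have : ‖std4 ((Ph X).1 - s, (Ph X).2)‖ ^ 2 = ‖X - ax s‖ ^ 2 := by
    rw [std4_norm, V4_norm_sq, Ph_sq]; simp [ax, Ph]; ring
  exact (pow_left_inj₀ (norm_nonneg _) (norm_nonneg _) two_ne_zero).1 this

theorem os_lft_ae {lam μ a : ℝ} {ws : V4 → ℝ} (h : Su lam μ ws a) (s : ℝ) :
    lft (os ws s) =ᵐ[volume] fun X => ws (X - ax s) := by
  filter_upwards [Ph_pos] with X hX using os_lft h s hX

theorem os_mass (ws : V4 → ℝ) (s : ℝ) :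
    ∫ x in UHP, os ws s x = ∫ x in UHP, os ws 0 x := by
  rw [← integral_indicator UHP_meas, ← integral_indicator UHP_meas,
    ← integral_add_right_eq_self (UHP.indicator (os ws 0)) (-s, (0 : ℝ))]
  refine integral_congr_ae (Eventually.of_forall fun x => ?_)
  simp only [Set.indicator, UHP, Set.mem_setOf_eq, os]
  simp [sub_eq_add_neg]

theorem lft_Sy (ω : ℝ × ℝ → ℝ) : Sy (lft ω) := by
  intro e he he0 X
  have hPh : Ph (sg e 0 X) = Ph X := by
    refine Ph_ext ?_ ?_
    · unfold sg; simp [he0]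
    · have := sg_iso he 0 X 0
      have h0 : sg e 0 0 = 0 := by unfold sg; simp
      rwa [h0, sub_zero, sub_zero] at this
  unfold lft; rw [hPh]

theorem os_Mx {lam μ a : ℝ} {ws : V4 → ℝ} (h : Su lam μ ws a) (s : ℝ) : Mx lam (4 * π * μ) (lft (os ws s)) := by
  obtain ⟨h1, h2, h3, h4⟩ := os_int h s
  have hm := (h.hs.nx.mx.trans (-(ax s)))
  refine Mx_congr ?_ (lft_nonneg h1) hm
  filter_upwards [os_lft_ae h s] with X hX
  rw [hX, sub_eq_add_neg]

theorem os_adm {lam μ a ν : ℝ} {ws : V4 → ℝ} (h : Su lam μ ws a) (hν : ∫ x in UHP, os ws 0 x ≤ ν) (s : ℝ) :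
    InAdm μ ν (os ws s) ∧ Efun lam (os ws s) = CC lam * (4 * π * μ) ^ 2 / (4 * π) := by
  obtain ⟨h1, h2, h3, h4⟩ := os_int h s
  have hm := os_Mx h s
  have hpi := Real.pi_pos
  refine ⟨⟨h1, h2, h3, h4, ?_, by rw [os_mass]; exact hν⟩, ?_⟩
  · have := hm.mass
    rw [lft_int h2.1] at this
    exact mul_left_cancel₀ (by positivity) this
  · have := hm.mx
    rw [lft_FF lam h1 h2.1 h3 h4] at this
    rw [← this]; field_simp

theorem adm_le {lam μ ν : ℝ} (hl : 1 < lam) {ω : ℝ × ℝ → ℝ} (h : InAdm μ ν ω) :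
    Efun lam ω ≤ CC lam * (4 * π * μ) ^ 2 / (4 * π) := by
  obtain ⟨h1, h2, h3, h4, h5, -⟩ := h
  have hpi := Real.pi_pos
  have := FF_le_CC hl (lft_gd h1 h2.1 h3 h4)
  rw [lft_FF lam h1 h2.1 h3 h4, lft_int h2.1] at this
  unfold impulse at h5
  rw [h5] at this
  rw [le_div_iff₀ (by positivity)]; linarith

theorem Sval_eq {lam μ a ν : ℝ} {ws : V4 → ℝ} (h : Su lam μ ws a) (hν : ∫ x in UHP, os ws 0 x ≤ ν) :
    Sval lam μ ν = CC lam * (4 * π * μ) ^ 2 / (4 * π) := by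
  unfold Sval
  obtain ⟨q1, q2⟩ := os_adm h hν 0
  have hb : ∀ x ∈ {s | ∃ ω, InAdm μ ν ω ∧ s = Efun lam ω}, x ≤ CC lam * (4 * π * μ) ^ 2 / (4 * π) := by
    rintro x ⟨ω, hω, rfl⟩
    exact adm_le h.hl hω
  refine le_antisymm (csSup_le ⟨_, _, q1, rfl⟩ hb) (le_csSup ⟨_, hb⟩ ⟨_, q1, q2.symm⟩)

theorem os_max {lam μ a ν : ℝ} {ws : V4 → ℝ} (h : Su lam μ ws a) (hν : ∫ x in UHP, os ws 0 x ≤ ν) (s : ℝ) :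
    IsMaximizer lam μ ν (os ws s) :=
  ⟨(os_adm h hν s).1, by rw [(os_adm h hν s).2, Sval_eq h hν]⟩

theorem max_char {lam μ a ν : ℝ} {ws : V4 → ℝ} (h : Su lam μ ws a) (hν : ∫ x in UHP, os ws 0 x ≤ ν)
    {ω : ℝ × ℝ → ℝ} (hω : IsMaximizer lam μ ν ω) :
    Mx lam (4 * π * μ) (lft ω) ∧ ∃ s, (lft ω =ᵐ[volume] fun X => ws (X - ax s)) ∧ ω =ᵐ[volume.restrict UHP] os ws s := by
  obtain ⟨⟨h1, h2, h3, h4, h5, -⟩, h6⟩ := hω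
  have hpi := Real.pi_pos
  rw [Sval_eq h hν] at h6
  have hG := lft_gd h1 h2.1 h3 h4
  have hmx : Mx lam (4 * π * μ) (lft ω) := by
    refine ⟨hG, ?_, ?_⟩
    · rw [lft_int h2.1]; unfold impulse at h5; rw [h5]
    · rw [lft_FF lam h1 h2.1 h3 h4, h6]; field_simp
  refine ⟨hmx, ?_⟩
  obtain ⟨c, hc⟩ := Mx.translate h.hl h.M_pos h.hs hmx
  have hax : c = ax (c 0) := by
    refine axis_sym h.hl h.hs h.ha h.ha1 h.ha2 fun e he he0 => ?_
    filter_upwards [hc, (sg_mp he 0).quasiMeasurePreserving.ae hc] with X h7 h8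
    rw [← h7, ← h8, lft_Sy ω e he he0]
  rw [hax] at hc
  refine ⟨c 0, by simpa [ax] using hc, ?_⟩
  obtain ⟨o1, o2, o3, o4⟩ := os_int h (c 0)
  have hdm : AEStronglyMeasurable (fun x => ω x - os ws (c 0) x) (volume.restrict UHP) := h2.1.sub o2.1
  have h9 := lft_abs hdm
  have h10 : ∫ X, |lft (fun x => ω x - os ws (c 0) x) X| = 0 := by
    rw [← integral_zero V4 ℝ]
    refine integral_congr_ae ?_
    filter_upwards [hc, os_lft_ae h (c 0)] with X h11 h12
    rw [← lft_sub, h12, h11]; simp [ax]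
  rw [h10] at h9
  have h13 : normL1 (fun x => x.2 * (ω x - os ws (c 0) x)) = 0 := by
    have : 4 * π ≠ 0 := by positivity
    simpa [this] using h9.symm
  unfold normL1 at h13
  have hi : IntegrableOn (fun x : ℝ × ℝ => |x.2 * (ω x - os ws (c 0) x)|) UHP := by
    have : IntegrableOn (fun x : ℝ × ℝ => x.2 * (ω x - os ws (c 0) x)) UHP := by
      refine (h4.sub o4).congr (Eventually.of_forall fun x => ?_)
      simp only [Pi.sub_apply]; ring
    exact this.abs
  rw [integral_eq_zero_iff_of_nonneg (fun _ => abs_nonneg _) hi] at h13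
  filter_upwards [h13, ae_restrict_mem UHP_meas] with x h14 h15
  have h16 : 0 < x.2 := h15
  have h17 := abs_eq_zero.1 h14
  rcases mul_eq_zero.1 h17 with h18 | h18
  · linarith
  · linarith

theorem cs_box {a s : ℝ} (ha : 0 < a) {f : ℝ × ℝ → ℝ} (hf : IntegrableOn f UHP)
    (hf2 : IntegrableOn (fun x => f x ^ 2) UHP) :
    ∫ x in bx a s, |f x| ∂(volume.restrict UHP) ≤ Real.sqrt (4 * a ^ 2) * Real.sqrt (∫ x in UHP, f x ^ 2) := by
  refine amgm_aux (by positivity) (integral_nonneg fun _ => sq_nonneg _) fun κ hκ => ?_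
  have hv : volume (bx a s) = ENNReal.ofReal (4 * a ^ 2) := by
    unfold bx
    rw [Measure.volume_eq_prod, Measure.prod_prod, Real.volume_Icc, Real.volume_Icc,
      ← ENNReal.ofReal_mul (by linarith)]
    congr 1; ring
  have hle : (volume.restrict UHP) (bx a s) ≤ ENNReal.ofReal (4 * a ^ 2) := by
    rw [← hv]; exact Measure.restrict_apply_le _ _
  have hfin : (volume.restrict UHP) (bx a s) ≠ ∞ := ne_top_of_le_ne_top ENNReal.ofReal_ne_top hle
  have hr : (volume.restrict UHP).real (bx a s) ≤ 4 * a ^ 2 := ENNReal.toReal_le_of_le_ofReal (by positivity) hle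
  have j0 : IntegrableOn (fun _ : ℝ × ℝ => κ) (bx a s) (volume.restrict UHP) := integrableOn_const hfin
  have j1 : IntegrableOn (fun x => f x ^ 2 / κ) (bx a s) (volume.restrict UHP) :=
    (Integrable.integrableOn hf2).div_const κ
  have j2 : IntegrableOn (fun x => (κ + f x ^ 2 / κ) / 2) (bx a s) (volume.restrict UHP) :=
    (j0.add j1).div_const 2
  calc ∫ x in bx a s, |f x| ∂(volume.restrict UHP)
      ≤ ∫ x in bx a s, (κ + f x ^ 2 / κ) / 2 ∂(volume.restrict UHP) := by
        refine integral_mono (Integrable.integrableOn hf).abs j2 fun x => ?_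
        simp only
        have : 0 ≤ (κ - |f x|) ^ 2 / κ := by positivity
        have e : (κ - |f x|) ^ 2 / κ = κ + f x ^ 2 / κ - 2 * |f x| := by
          rw [sub_sq, sq_abs]; field_simp; ring
        linarith
    _ = (κ * (volume.restrict UHP).real (bx a s) + (∫ x in bx a s, f x ^ 2 ∂(volume.restrict UHP)) / κ) / 2 := by
        rw [integral_div, integral_add j0 j1, integral_div]
        simp [mul_comm]
    _ ≤ _ := by
        have h1 : ∫ x in bx a s, f x ^ 2 ∂(volume.restrict UHP) ≤ ∫ x in UHP, f x ^ 2 :=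
          setIntegral_le_integral hf2 (Eventually.of_forall fun _ => sq_nonneg _)
        gcongr

end

section
open scoped ENNReal

theorem FF_diff {lam : ℝ} (hl : 1 < lam) {f g : V4 → ℝ} (hf : MemLp f 2) (hg : MemLp g 2) :
    |FF lam f - FF lam g| ≤ 2 * (nn g * nn (fun X => f X - g X)) + nn (fun X => f X - g X) ^ 2 := by
  set h := fun X => f X - g X with hh
  have hh2 : MemLp h 2 := hf.sub hg
  have e : f = fun X => g X + h X := by ext X; simp [hh]
  have hk : ∫ X, |kk X| = 1 := by
    rw [← kk_integral]; congr 1; ext X; exact abs_of_nonneg (kk_nonneg X)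
  have b1 := BB_bound kk_integrable hg hh2
  have b2 := BB_bound kk_integrable hh2 hh2
  have b3 := cs_int hg hh2
  rw [hk, one_mul] at b1 b2
  have hq : qq h = nn h ^ 2 := (nn_sq h).symm
  have hl0 : 0 < lam := by linarith
  have e2 : FF lam f - FF lam g = BB kk g h + BB kk h h / 2 - (∫ X, g X * h X) / lam - nn h ^ 2 / (2 * lam) := by
    conv_lhs => rw [e]
    unfold FF
    rw [BB_sq_add hg hh2, qq_add hg hh2, hq]
    field_simp; ring
  rw [e2]
  have d1 : |(∫ X, g X * h X) / lam| ≤ nn g * nn h := by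
    rw [abs_div, abs_of_pos hl0]
    exact (div_le_self (abs_nonneg _) hl.le).trans b3
  have d2' : nn h ^ 2 / (2 * lam) ≤ nn h ^ 2 / 2 := by
    gcongr; linarith
  have d3 : 0 ≤ nn h ^ 2 / (2 * lam) := by positivity
  rw [abs_le] at *
  constructor <;> nlinarith [b1.1, b1.2, b2.1, b2.2, d1.1, d1.2]

theorem normL2_sqrt (f : ℝ × ℝ → ℝ) : normL2 f = Real.sqrt (∫ x in UHP, f x ^ 2) := by
  rw [normL2, Real.sqrt_eq_rpow]

theorem nn_lft {f : ℝ × ℝ → ℝ} (hf : AEStronglyMeasurable f (volume.restrict UHP)) :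
    nn (lft f) = Real.sqrt (4 * π) * normL2 f := by
  rw [nn, lft_qq hf, normL2_sqrt, Real.sqrt_mul (by positivity)]

theorem normL1_nonneg (f : ℝ × ℝ → ℝ) : 0 ≤ normL1 f := integral_nonneg fun _ => abs_nonneg _
theorem normL2_nonneg (f : ℝ × ℝ → ℝ) : 0 ≤ normL2 f := by rw [normL2_sqrt]; positivity

theorem sq_sub_int {f g : ℝ × ℝ → ℝ} (hf : IntegrableOn f UHP) (hg : IntegrableOn g UHP)
    (hf2 : IntegrableOn (fun x => f x ^ 2) UHP) (hg2 : IntegrableOn (fun x => g x ^ 2) UHP) :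
    IntegrableOn (fun x => (f x - g x) ^ 2) UHP := by
  have h1 : MemLp f 2 (volume.restrict UHP) := (memLp_two_iff_integrable_sq hf.1).2 hf2
  have h2 : MemLp g 2 (volume.restrict UHP) := (memLp_two_iff_integrable_sq hg.1).2 hg2
  exact (h1.sub h2).integrable_sq

theorem stab {lam μ a ν : ℝ} {ws : V4 → ℝ} (h : Su lam μ ws a) (hν : ∫ x in UHP, os ws 0 x ≤ ν)
    {ζ₀ ζ : ℕ → ℝ × ℝ → ℝ} (k0 : ∀ n, NonnegL1L2 (ζ₀ n)) (k1 : ∀ n, NonnegL1L2 (ζ n))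
    (k2 : ∀ n, IntegrableOn (fun x => x.2 * ζ₀ n x) UHP) (k3 : ∀ n, IntegrableOn (fun x => x.2 * ζ n x) UHP)
    (k4 : ∀ n, kineticE (ζ n) = kineticE (ζ₀ n)) (k5 : ∀ n, impulse (ζ n) = impulse (ζ₀ n))
    (k6 : ∀ n, normL1 (ζ n) = normL1 (ζ₀ n)) (k7 : ∀ n, normL2 (ζ n) = normL2 (ζ₀ n))
    (k8 : ∀ n : ℕ, distToSet {ω | IsMaximizer lam μ ν ω} (ζ₀ n) ≤ 1 / ((n : ℝ) + 1)) {ε : ℝ} (hε : 0 < ε) :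
    ∃ n, distToSet {ω | IsMaximizer lam μ ν ω} (ζ n) ≤ ε := by
  have hpi := Real.pi_pos
  set m := ∫ x in UHP, os ws 0 x with hm
  have hex : ∀ n : ℕ, ∃ ω, IsMaximizer lam μ ν ω ∧ normL1 (fun x => ζ₀ n x - ω x) + normL2 (fun x => ζ₀ n x - ω x) +
      normL1 (fun x => x.2 * (ζ₀ n x - ω x)) ≤ 2 * (1 / ((n : ℝ) + 1)) := by
    intro n
    have hp : 0 < 1 / ((n : ℝ) + 1) := by positivity
    have hne : {d | ∃ w ∈ {ω | IsMaximizer lam μ ν ω}, d = normL1 (fun x => ζ₀ n x - w x) +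
        normL2 (fun x => ζ₀ n x - w x) + normL1 (fun x => x.2 * (ζ₀ n x - w x))}.Nonempty :=
      ⟨_, os ws 0, os_max h hν 0, rfl⟩
    have hlt := lt_of_le_of_lt (k8 n) (show 1 / ((n : ℝ) + 1) < 2 * (1 / ((n : ℝ) + 1)) by linarith)
    unfold distToSet at hlt
    obtain ⟨d, ⟨ω, hω, rfl⟩, hd⟩ := exists_lt_of_csInf_lt hne hlt
    exact ⟨ω, hω, hd.le⟩
  choose ω hω hD using hex
  have tD : Tendsto (fun n : ℕ => 2 * (1 / ((n : ℝ) + 1))) atTop (nhds 0) := by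
    simpa using tendsto_one_div_add_atTop_nhds_zero_nat.const_mul (2 : ℝ)
  have T1 : Tendsto (fun n => normL1 (fun x => ζ₀ n x - ω n x)) atTop (nhds 0) :=
    squeeze_zero (fun n => normL1_nonneg _) (fun n => by
      have := hD n; have := normL2_nonneg (fun x => ζ₀ n x - ω n x)
      have := normL1_nonneg (fun x => x.2 * (ζ₀ n x - ω n x)); linarith) tD
  have T2 : Tendsto (fun n => normL2 (fun x => ζ₀ n x - ω n x)) atTop (nhds 0) :=
    squeeze_zero (fun n => normL2_nonneg _) (fun n => by
      have := hD n; have := normL1_nonneg (fun x => ζ₀ n x - ω n x)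
      have := normL1_nonneg (fun x => x.2 * (ζ₀ n x - ω n x)); linarith) tD
  have T3 : Tendsto (fun n => normL1 (fun x => x.2 * (ζ₀ n x - ω n x))) atTop (nhds 0) :=
    squeeze_zero (fun n => normL1_nonneg _) (fun n => by
      have := hD n; have := normL1_nonneg (fun x => ζ₀ n x - ω n x)
      have := normL2_nonneg (fun x => ζ₀ n x - ω n x); linarith) tD
  have hmeas : ∀ n, AEStronglyMeasurable (fun x => ζ₀ n x - ω n x) (volume.restrict UHP) :=
    fun n => (k0 n).2.1.1.sub (hω n).1.2.1.1
  -- total mass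
  have M1 : Tendsto (fun n => ∫ x in UHP, ζ n x) atTop (nhds m) := by
    have e1 : ∀ n, ∫ x in UHP, ζ n x = ∫ x in UHP, ζ₀ n x := by
      intro n
      have q1 : normL1 (ζ n) = ∫ x in UHP, ζ n x :=
        setIntegral_congr_fun UHP_meas fun x hx => abs_of_nonneg ((k1 n).1 x hx)
      have q2 : normL1 (ζ₀ n) = ∫ x in UHP, ζ₀ n x :=
        setIntegral_congr_fun UHP_meas fun x hx => abs_of_nonneg ((k0 n).1 x hx)
      rw [← q1, ← q2, k6]
    have e2 : ∀ n, ∫ x in UHP, ω n x = m := by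
      intro n
      obtain ⟨-, s, -, hs⟩ := max_char h hν (hω n)
      rw [integral_congr_ae hs, os_mass]
    rw [tendsto_iff_norm_sub_tendsto_zero]
    refine squeeze_zero (fun n => norm_nonneg _) (fun n => ?_) T1
    rw [e1, ← e2 n, ← integral_sub (k0 n).2.1 (hω n).1.2.1]
    exact norm_integral_le_integral_norm _
  have G0 : ∀ n, Gd (lft (ζ₀ n)) := fun n => lft_gd (k0 n).1 (k0 n).2.1.1 (k0 n).2.2 (k2 n)
  have G1 : ∀ n, Gd (lft (ζ n)) := fun n => lft_gd (k1 n).1 (k1 n).2.1.1 (k1 n).2.2 (k3 n)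
  have M2 : Tendsto (fun n => ∫ X, lft (ζ n) X) atTop (nhds (4 * π * μ)) := by
    have e1 : ∀ n, ∫ X, lft (ζ n) X = ∫ X, lft (ζ₀ n) X := by
      intro n
      rw [lft_int (k1 n).2.1.1, lft_int (k0 n).2.1.1]
      have := k5 n
      unfold impulse at this; rw [this]
    rw [tendsto_iff_norm_sub_tendsto_zero]
    have t0 := T3.const_mul (4 * π)
    rw [mul_zero] at t0
    refine squeeze_zero (fun n => norm_nonneg _) (fun n => ?_) t0
    have hx := (max_char h hν (hω n)).1
    rw [e1, ← hx.mass, ← integral_sub (G0 n).i1 hx.gd.i1, ← lft_abs (hmeas n)]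
    refine (norm_integral_le_integral_norm _).trans (le_of_eq ?_)
    congr 1; ext X
    rw [lft_sub, Real.norm_eq_abs]
  have M3 : Tendsto (fun n => FF lam (lft (ζ n))) atTop (nhds (CC lam * (4 * π * μ) ^ 2)) := by
    have e1 : ∀ n, FF lam (lft (ζ n)) = FF lam (lft (ζ₀ n)) := by
      intro n
      rw [lft_FF lam (k1 n).1 (k1 n).2.1.1 (k1 n).2.2 (k3 n), lft_FF lam (k0 n).1 (k0 n).2.1.1 (k0 n).2.2 (k2 n)]
      unfold Efun
      have := k7 n
      rw [normL2_sqrt, normL2_sqrt, Real.sqrt_inj (integral_nonneg fun _ => sq_nonneg _)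
        (integral_nonneg fun _ => sq_nonneg _)] at this
      rw [k4, this]
    have e2 : ∀ n, nn (lft (ω n)) = nn ws := by
      intro n
      obtain ⟨-, s, hs, -⟩ := max_char h hν (hω n)
      unfold nn qq
      rw [← integral_sub_right_eq_self (fun X => ws X ^ 2) (ax s)]
      congr 1
      refine integral_congr_ae ?_
      filter_upwards [hs] with X hX
      rw [hX]
    rw [tendsto_iff_norm_sub_tendsto_zero]
    have t1 : Tendsto (fun n => Real.sqrt (4 * π) * normL2 (fun x => ζ₀ n x - ω n x)) atTop (nhds 0) := by
      simpa using T2.const_mul (Real.sqrt (4 * π))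
    have t0 : Tendsto (fun n => 2 * (nn ws * (Real.sqrt (4 * π) * normL2 (fun x => ζ₀ n x - ω n x))) +
        (Real.sqrt (4 * π) * normL2 (fun x => ζ₀ n x - ω n x)) ^ 2) atTop (nhds 0) := by
      simpa using ((t1.const_mul (nn ws)).const_mul 2).add (t1.pow 2)
    refine squeeze_zero (fun n => norm_nonneg _) (fun n => ?_) t0
    have hx := (max_char h hν (hω n)).1
    have := FF_diff h.hl (G0 n).i2 hx.gd.i2
    rw [e1, ← hx.mx, ← nn_lft (hmeas n), Real.norm_eq_abs, ← e2 n]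
    simp only [lft_sub] at this
    exact this
  obtain ⟨χ, hχ, t, L2, L1⟩ := axis_cpt h.hl h.M_pos h.hs h.ha h.ha1 h.ha2 G1 (fun n => lft_Sy _) M2 M3
  have hdm : ∀ n, AEStronglyMeasurable (fun x => ζ (χ n) x - os ws (t n) x) (volume.restrict UHP) :=
    fun n => (k1 _).2.1.1.sub (os_int h (t n)).2.1.1
  have hae : ∀ n, (fun X => lft (ζ (χ n)) X - ws (X - ax (t n))) =ᵐ[volume]
      lft (fun x => ζ (χ n) x - os ws (t n) x) := by
    intro n
    filter_upwards [os_lft_ae h (t n)] with X hX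
    rw [← lft_sub, hX]
  have S3 : Tendsto (fun n => normL1 (fun x => x.2 * (ζ (χ n) x - os ws (t n) x))) atTop (nhds 0) := by
    have := L1.const_mul (4 * π)⁻¹
    rw [mul_zero] at this
    refine this.congr fun n => ?_
    rw [show ∫ X, |lft (ζ (χ n)) X - ws (X - ax (t n))| = ∫ X, |lft (fun x => ζ (χ n) x - os ws (t n) x) X| from ?_,
      lft_abs (hdm n)]
    · field_simp
    · refine integral_congr_ae ?_
      filter_upwards [hae n] with X hX
      rw [hX]
  have S2 : Tendsto (fun n => normL2 (fun x => ζ (χ n) x - os ws (t n) x)) atTop (nhds 0) := by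
    have := (L2.const_mul (4 * π)⁻¹).sqrt
    rw [mul_zero, Real.sqrt_zero] at this
    refine this.congr fun n => ?_
    rw [show qq (fun X => lft (ζ (χ n)) X - ws (X - ax (t n))) = qq (lft (fun x => ζ (χ n) x - os ws (t n) x)) from ?_,
      lft_qq (hdm n), normL2_sqrt]
    · congr 1; field_simp
    · refine integral_congr_ae ?_
      filter_upwards [hae n] with X hX
      rw [hX]
  have S1 : Tendsto (fun n => normL1 (fun x => ζ (χ n) x - os ws (t n) x)) atTop (nhds 0) := by
    have t0 : Tendsto (fun n => 2 * (Real.sqrt (4 * a ^ 2) * normL2 (fun x => ζ (χ n) x - os ws (t n) x)) +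
        ((∫ x in UHP, ζ (χ n) x) - m)) atTop (nhds 0) := by
      have := ((S2.const_mul (Real.sqrt (4 * a ^ 2))).const_mul 2).add ((M1.comp hχ.tendsto_atTop).sub_const m)
      simpa using this
    refine squeeze_zero (fun n => normL1_nonneg _) (fun n => ?_) t0
    obtain ⟨o1, o2, o3, o4⟩ := os_int h (t n)
    have hl := L1_lem (k1 (χ n)).2.1 o2
      ((ae_restrict_mem UHP_meas).mono fun x hx => (k1 (χ n)).1 x hx)
      ((ae_restrict_mem UHP_meas).mono fun x hx => o1 x hx) (bx_meas a (t n))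
    have hcs := cs_box (s := t n) h.ha (f := fun x => ζ (χ n) x - os ws (t n) x) ((k1 (χ n)).2.1.sub o2)
      (sq_sub_int (k1 (χ n)).2.1 o2 (k1 (χ n)).2.2 o3)
    have hz : ∫ x in (bx a (t n))ᶜ, os ws (t n) x ∂(volume.restrict UHP) = 0 :=
      setIntegral_eq_zero_of_forall_eq_zero fun x hx => os_zero h (t n) hx
    rw [hz, os_mass] at hl
    rw [normL2_sqrt]
    unfold normL1
    linarith
  have hS := (S1.add S2).add S3
  rw [add_zero, add_zero] at hS
  obtain ⟨n, hn⟩ := (hS.eventually (gt_mem_nhds hε)).exists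
  refine ⟨χ n, ?_⟩
  refine le_trans (csInf_le ⟨0, ?_⟩ ⟨os ws (t n), os_max h hν (t n), rfl⟩) hn.le
  rintro d ⟨w, -, rfl⟩
  have := normL1_nonneg (fun x => ζ (χ n) x - w x)
  have := normL2_nonneg (fun x => ζ (χ n) x - w x)
  have := normL1_nonneg (fun x => x.2 * (ζ (χ n) x - w x))
  linarith

end

/-- orbital stability of the set of maximizers under the conservation laws. -/
theorem stmt17 (lam μ : ℝ) (hlam : 1 < lam) (hμ : 0 < μ) :
    ∃ ν₀ : ℝ, μ * varrho lam ≤ ν₀ ∧ ∀ ν : ℝ, ν₀ ≤ ν →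
      ∀ ε : ℝ, 0 < ε → ∃ δ : ℝ, 0 < δ ∧
        ∀ ζ₀ ζ : ℝ × ℝ → ℝ, NonnegL1L2 ζ₀ → NonnegL1L2 ζ →
          IntegrableOn (fun x => x.2 * ζ₀ x) UHP →
          IntegrableOn (fun x => x.2 * ζ x) UHP →
          kineticE ζ = kineticE ζ₀ → impulse ζ = impulse ζ₀ →
          normL1 ζ = normL1 ζ₀ → normL2 ζ = normL2 ζ₀ →
          distToSet {ω | IsMaximizer lam μ ν ω} ζ₀ ≤ δ →
          distToSet {ω | IsMaximizer lam μ ν ω} ζ ≤ ε := by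
  obtain ⟨ws, a, h⟩ := exists_Su hlam hμ
  refine ⟨max (μ * varrho lam) (∫ x in UHP, os ws 0 x), le_max_left _ _, fun ν hν ε hε => ?_⟩
  have hν' := (le_max_right _ _).trans hν
  by_contra! hcon
  have hc := fun n : ℕ => hcon (1 / ((n : ℝ) + 1)) (by positivity)
  choose ζ₀ ζ k0 k1 k2 k3 k4 k5 k6 k7 k8 k9 using hc
  obtain ⟨n, hn⟩ := stab h hν' k0 k1 k2 k3 k4 k5 k6 k7 k8 hε
  exact absurd (k9 n) (not_lt.2 hn)
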